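/- arXiv:2005.09717 — 5 statements merged into one kernel-verified Lean document; each statement's English description precedes it below -/
import Mathlib

section
/- Let a<b be real numbers, let T: D_cdf([a,b]) → ℝ and a nonempty convex D ⊆ D_cdf([a,b]) satisfy the Lipschitz assumption with constant C>0, and suppose D contains H₁, H₂ such that J_τ := τH₁+(1−τ)H₂ ∈ D for every τ∈[0,1] and T(J_{τ₂})−T(J_{τ₁}) ≥ c₋(τ₂−τ₁) for some c₋>0 and all 0 ≤ τ₁ ≤ τ₂ ≤ 1. Then there exists a constant c>0, depending only on T, C, c₋, H₁, H₂ (independent of K, n, and M_K), such that for every closed M_K ⊆ S_K with at least two elements, every policy π with recommendations in M_K, and any randomization measure P_G: sup over potential outcome vectors with independent marginals and cdfs in {J_τ : τ∈[0,1]} of E[r_n(π, M_K)] ≥ c · max over all partitions H of {1,…,K} of κ(H, M_K) · √(|H|/n), for every n ≥ K, where |H| is the number of blocks of H. -/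
open MeasureTheory Set

noncomputable section

namespace TRDT

def IsCdfOn (a b : ℝ) (F : ℝ → ℝ) : Prop :=
  Monotone F ∧ (∀ x, ContinuousWithinAt F (Set.Ici x) x) ∧
    (∀ x, x < a → F x = 0) ∧ (∀ x, b ≤ x → F x = 1)

def supDist (F G : ℝ → ℝ) : ℝ := ⨆ x : ℝ, |F x - G x|

def LipschitzAssumption (a b : ℝ) (T : (ℝ → ℝ) → ℝ) (D : Set (ℝ → ℝ)) (C : ℝ) : Prop :=
  ∀ F ∈ D, ∀ G : ℝ → ℝ, IsCdfOn a b G → |T F - T G| ≤ C * supDist F G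

def mix {K : ℕ} (δ : Fin K → ℝ) (F : Fin K → ℝ → ℝ) : ℝ → ℝ := fun x => ∑ i, δ i * F i x

/-- The history `Z_t` of observed (outcome, randomization) pairs generated by the
assignment rules `pol`, the array `Y` of potential outcomes and the randomizations `G`:
subject `t` is assigned to treatment `pol t (Z_{t-1}) (G_t)` and its outcome is recorded. -/
def hist {K : ℕ} (pol : (t : ℕ) → (Fin t → ℝ × ℝ) → ℝ → Fin K)
    (Y : ℕ → Fin K → ℝ) (G : ℕ → ℝ) : (t : ℕ) → Fin t → ℝ × ℝ
  | 0 => Fin.elim0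
  | t + 1 => Fin.snoc (hist pol Y G t) (Y t (pol t (hist pol Y G t) (G t)), G t)

/-- Extension of a finite outcome array to all of `ℕ` (junk value `0` beyond `n`). -/
def Yext {K n : ℕ} (y : Fin n → Fin K → ℝ) : ℕ → Fin K → ℝ :=
  fun t => if h : t < n then y ⟨t, h⟩ else fun _ => 0

/-- Extension of a finite randomization sequence to all of `ℕ` (junk value `0` beyond). -/
def Gext {n : ℕ} (g : Fin n → ℝ) : ℕ → ℝ :=
  fun t => if h : t < n then g ⟨t, h⟩ else 0

/-- The expected regret `E[r_n(π, M_K)]` of the policy `(pol, polrec)` when the potential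
outcome vectors are i.i.d. with independent coordinates, the `i`-th having law `μ i`, and
the randomizations are i.i.d. with law `PG`. -/
def expectedRegret {K : ℕ} (n : ℕ) (T : (ℝ → ℝ) → ℝ) (M : Set (Fin K → ℝ))
    (pol : (t : ℕ) → (Fin t → ℝ × ℝ) → ℝ → Fin K)
    (polrec : (Fin n → ℝ × ℝ) → ℝ → (Fin K → ℝ))
    (F : Fin K → ℝ → ℝ) (μ : Fin K → ProbabilityMeasure ℝ) (PG : ProbabilityMeasure ℝ) : ℝ :=
  ∫ ω : (Fin n → Fin K → ℝ) × (Fin (n + 1) → ℝ),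
      (sSup ((fun δ => T (mix δ F)) '' M)
        - T (mix (polrec (hist pol (Yext ω.1) (Gext ω.2) n) (ω.2 (Fin.last n))) F))
    ∂((Measure.pi fun _ : Fin n => Measure.pi fun i : Fin K => (μ i : Measure ℝ)).prod
        (Measure.pi fun _ : Fin (n + 1) => (PG : Measure ℝ)))

/-- The quantity `κ(H, M_K)` from Appendix B.1 of the paper, for a partition `H` of
`{1,…,K}` (given as a `Finpartition` of `Finset.univ`): the supremum, over all nonempty
Borel `T ⊊ M`, all `v ∈ [-1,1]^K` and all `w ∈ [-1,1]^K` (the restriction of `w` to a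
block `A` playing the role of `w_i ∈ [-1,1]^{H_i}`, so that `(v + B_i w_i)'δ
 = v'δ + ∑_{j∈A} w_j δ_j`), of
`min( max_{δ∈M} v'δ − sup_{δ∈T} v'δ ,
      min over blocks A of [ max_{δ∈M} (v'δ + ∑_{j∈A} w_j δ_j)
                              − sup_{δ∈M∖T} (v'δ + ∑_{j∈A} w_j δ_j) ] )`. -/
def kappaPart {K : ℕ} (P : Finpartition (Finset.univ : Finset (Fin K)))
    (M : Set (Fin K → ℝ)) : ℝ :=
  sSup {x : ℝ | ∃ (T : Set (Fin K → ℝ)) (v w : Fin K → ℝ),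
    T.Nonempty ∧ T ⊂ M ∧ MeasurableSet T ∧
    (∀ i, v i ∈ Set.Icc (-1 : ℝ) 1) ∧ (∀ i, w i ∈ Set.Icc (-1 : ℝ) 1) ∧
    x = min
      (sSup ((fun δ => ∑ i, v i * δ i) '' M) - sSup ((fun δ => ∑ i, v i * δ i) '' T))
      (sInf ((fun A : Finset (Fin K) =>
          sSup ((fun δ => (∑ j, v j * δ j) + ∑ j ∈ A, w j * δ j) '' M)
            - sSup ((fun δ => (∑ j, v j * δ j) + ∑ j ∈ A, w j * δ j) '' (M \ T)))
        '' (P.parts : Set (Finset (Fin K)))))}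

theorem mp_snoc {α : Type} [MeasurableSpace α] (ν : Measure α) [IsProbabilityMeasure ν] (m : ℕ) :
    MeasurePreserving (fun p : (Fin m → α) × α => (Fin.snoc p.1 p.2 : Fin (m + 1) → α))
      ((Measure.pi fun _ : Fin m => ν).prod ν) (Measure.pi fun _ : Fin (m + 1) => ν) := by
  have h := (measurePreserving_piFinSuccAbove (fun _ : Fin (m + 1) => ν) (Fin.last m)).symm
  have h2 := h.comp (Measure.measurePreserving_swap (μ := Measure.pi fun _ : Fin m => ν) (ν := ν))
  convert h2 using 1
  funext p
  simp [MeasurableEquiv.piFinSuccAbove]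
  rfl

theorem measurable_snoc' {α : Type} [MeasurableSpace α] (m : ℕ) :
    Measurable (fun p : (Fin m → α) × α => (Fin.snoc p.1 p.2 : Fin (m + 1) → α)) := by
  refine measurable_pi_iff.2 fun i => ?_
  refine Fin.lastCases ?_ (fun j => ?_) i
  · simpa using measurable_snd
  · simpa [Function.comp_def] using (measurable_pi_apply (X := fun _ : Fin m => α) j).comp (measurable_fst (β := α))

theorem mp_shuffle {α β γ δ : Type} [MeasurableSpace α] [MeasurableSpace β] [MeasurableSpace γ]
    [MeasurableSpace δ] (μa : Measure α) (μb : Measure β) (μc : Measure γ) (μd : Measure δ)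
    [IsProbabilityMeasure μa] [IsProbabilityMeasure μb] [IsProbabilityMeasure μc]
    [IsProbabilityMeasure μd] :
    MeasurePreserving (fun p : (α × β) × (γ × δ) => ((p.1.1, p.2.2), (p.1.2, p.2.1)))
      ((μa.prod μb).prod (μc.prod μd)) ((μa.prod μd).prod (μb.prod μc)) := by
  have h1 := measurePreserving_prodAssoc μa μb (μc.prod μd)
  have h2 := (MeasurePreserving.id μa).prod (measurePreserving_prodAssoc μb μc μd).symm
  have h3 := (MeasurePreserving.id μa).prod
    (Measure.measurePreserving_swap (μ := μb.prod μc) (ν := μd))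
  have h4 := (measurePreserving_prodAssoc μa μd (μb.prod μc)).symm
  exact h4.comp (h3.comp (h2.comp h1))

theorem hist_congr {K : ℕ} (pol : (t : ℕ) → (Fin t → ℝ × ℝ) → ℝ → Fin K)
    (Y Y' : ℕ → Fin K → ℝ) (G G' : ℕ → ℝ) (t : ℕ)
    (hY : ∀ s < t, Y s = Y' s) (hG : ∀ s < t, G s = G' s) :
    hist pol Y G t = hist pol Y' G' t := by
  induction t with
  | zero => rfl
  | succ t ih =>
    have := ih (fun s hs => hY s (by omega)) (fun s hs => hG s (by omega))
    simp only [hist, this, hY t (by omega), hG t (by omega)]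

/-- one step of the history -/
def Phi {K : ℕ} (pol : (t : ℕ) → (Fin t → ℝ × ℝ) → ℝ → Fin K) (t : ℕ)
    (p : (Fin t → ℝ × ℝ) × (ℝ × (Fin K → ℝ))) : Fin (t + 1) → ℝ × ℝ :=
  Fin.snoc p.1 (p.2.2 (pol t p.1 p.2.1), p.2.1)

theorem measurable_evalAt {K : ℕ} : Measurable (fun q : Fin K × (Fin K → ℝ) => q.2 q.1) :=
  measurable_from_prod_countable_right fun i => measurable_pi_apply i

theorem measurable_Phi {K : ℕ} (pol : (t : ℕ) → (Fin t → ℝ × ℝ) → ℝ → Fin K)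
    (hpol : ∀ t, Measurable fun p : (Fin t → ℝ × ℝ) × ℝ => pol t p.1 p.2) (t : ℕ) :
    Measurable (Phi pol t) := by
  unfold Phi
  refine (measurable_snoc' (α := ℝ × ℝ) t).comp (g := fun p : (Fin t → ℝ × ℝ) × (ℝ × ℝ) =>
    (Fin.snoc p.1 p.2 : Fin (t + 1) → ℝ × ℝ))
    (f := fun p : (Fin t → ℝ × ℝ) × (ℝ × (Fin K → ℝ)) =>
      (p.1, (p.2.2 (pol t p.1 p.2.1), p.2.1))) ?_
  have h1 : Measurable fun p : (Fin t → ℝ × ℝ) × (ℝ × (Fin K → ℝ)) => pol t p.1 p.2.1 :=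
    (hpol t).comp (measurable_fst.prodMk measurable_snd.fst)
  exact measurable_fst.prodMk ((measurable_evalAt.comp (h1.prodMk measurable_snd.snd)).prodMk
    measurable_snd.fst)

theorem measurable_hist {K : ℕ} (pol : (t : ℕ) → (Fin t → ℝ × ℝ) → ℝ → Fin K)
    (hpol : ∀ t, Measurable fun p : (Fin t → ℝ × ℝ) × ℝ => pol t p.1 p.2) (t : ℕ) :
    Measurable (fun w : (ℕ → Fin K → ℝ) × (ℕ → ℝ) => hist pol w.1 w.2 t) := by
  induction t with
  | zero => exact measurable_of_subsingleton_codomain _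
  | succ t ih =>
    have : Measurable fun w : (ℕ → Fin K → ℝ) × (ℕ → ℝ) =>
      (hist pol w.1 w.2 t, (w.2 t, w.1 t)) :=
      ih.prodMk (((measurable_pi_apply t).comp measurable_snd).prodMk
        ((measurable_pi_apply t).comp measurable_fst))
    exact (measurable_Phi pol hpol t).comp this

theorem measurable_Yext {K n : ℕ} : Measurable (Yext : (Fin n → Fin K → ℝ) → ℕ → Fin K → ℝ) := by
  refine measurable_pi_iff.2 fun t => ?_
  unfold Yext
  by_cases h : t < n
  · simpa [h] using measurable_pi_apply (⟨t, h⟩ : Fin n)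
  · simp [h]

theorem measurable_Gext {n : ℕ} : Measurable (Gext : (Fin n → ℝ) → ℕ → ℝ) := by
  refine measurable_pi_iff.2 fun t => ?_
  unfold Gext
  by_cases h : t < n
  · simpa [h] using measurable_pi_apply (⟨t, h⟩ : Fin n)
  · simp [h]

theorem Yext_snoc_lt {K n : ℕ} (y : Fin n → Fin K → ℝ) (z : Fin K → ℝ) (s : ℕ) (hs : s < n) :
    Yext (Fin.snoc y z : Fin (n + 1) → Fin K → ℝ) s = Yext y s := by
  simp only [Yext, hs, dif_pos, Nat.lt_succ_of_lt hs]
  exact Fin.snoc_castSucc (α := fun _ => Fin K → ℝ) z y ⟨s, hs⟩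

theorem Yext_snoc_self {K n : ℕ} (y : Fin n → Fin K → ℝ) (z : Fin K → ℝ) :
    Yext (Fin.snoc y z : Fin (n + 1) → Fin K → ℝ) n = z := by
  simp only [Yext, Nat.lt_succ_self, dif_pos]
  exact Fin.snoc_last (α := fun _ => Fin K → ℝ) z y

theorem Gext_snoc_lt {n : ℕ} (y : Fin n → ℝ) (z : ℝ) (s : ℕ) (hs : s < n) :
    Gext (Fin.snoc y z : Fin (n + 1) → ℝ) s = Gext y s := by
  simp only [Gext, hs, dif_pos, Nat.lt_succ_of_lt hs]
  exact Fin.snoc_castSucc (α := fun _ => ℝ) z y ⟨s, hs⟩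

theorem Gext_snoc_self {n : ℕ} (y : Fin n → ℝ) (z : ℝ) :
    Gext (Fin.snoc y z : Fin (n + 1) → ℝ) n = z := by
  simp only [Gext, Nat.lt_succ_self, dif_pos]
  exact Fin.snoc_last (α := fun _ => ℝ) z y

/-- law of the history -/
def Q {K : ℕ} (pol : (t : ℕ) → (Fin t → ℝ × ℝ) → ℝ → Fin K) (PG : Measure ℝ)
    (μ : Fin K → Measure ℝ) : (t : ℕ) → Measure (Fin t → ℝ × ℝ)
  | 0 => Measure.dirac Fin.elim0
  | t + 1 => Measure.map (Phi pol t) ((Q pol PG μ t).prod (PG.prod (Measure.pi μ)))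

theorem Q_prob {K : ℕ} (pol : (t : ℕ) → (Fin t → ℝ × ℝ) → ℝ → Fin K)
    (hpol : ∀ t, Measurable fun p : (Fin t → ℝ × ℝ) × ℝ => pol t p.1 p.2)
    (PG : Measure ℝ) [IsProbabilityMeasure PG]
    (μ : Fin K → Measure ℝ) [∀ i, IsProbabilityMeasure (μ i)] (t : ℕ) :
    IsProbabilityMeasure (Q pol PG μ t) := by
  induction t with
  | zero => simp only [Q]; infer_instance
  | succ t ih =>
    simp only [Q]
    exact Measure.isProbabilityMeasure_map (measurable_Phi pol hpol t).aemeasurable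

theorem mp_hist {K : ℕ} (pol : (t : ℕ) → (Fin t → ℝ × ℝ) → ℝ → Fin K)
    (hpol : ∀ t, Measurable fun p : (Fin t → ℝ × ℝ) × ℝ => pol t p.1 p.2)
    (PG : Measure ℝ) [IsProbabilityMeasure PG]
    (μ : Fin K → Measure ℝ) [∀ i, IsProbabilityMeasure (μ i)] (m : ℕ) :
    MeasurePreserving (fun w : (Fin m → Fin K → ℝ) × (Fin m → ℝ) =>
        hist pol (Yext w.1) (Gext w.2) m)
      ((Measure.pi fun _ : Fin m => Measure.pi μ).prod (Measure.pi fun _ : Fin m => PG))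
      (Q pol PG μ m) := by
  have hme : ∀ m, Measurable (fun w : (Fin m → Fin K → ℝ) × (Fin m → ℝ) =>
        hist pol (Yext w.1) (Gext w.2) m) := fun m => (measurable_hist pol hpol m).comp
      ((measurable_Yext.comp measurable_fst).prodMk (measurable_Gext.comp measurable_snd))
  induction m with
  | zero =>
    refine ⟨hme 0, ?_⟩
    have : (fun w : (Fin 0 → Fin K → ℝ) × (Fin 0 → ℝ) =>
        hist pol (Yext w.1) (Gext w.2) 0) = fun _ => Fin.elim0 := rfl
    rw [this, Measure.map_const]
    simp [Q]
  | succ m ih =>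
    refine ⟨hme (m + 1), ?_⟩
    have hE := ((mp_snoc (Measure.pi μ) m).prod (mp_snoc PG m)).comp
      (mp_shuffle (Measure.pi fun _ : Fin m => Measure.pi μ) (Measure.pi fun _ : Fin m => PG)
        PG (Measure.pi μ))
    have := Q_prob pol hpol PG μ m
    have h2 := ih.prod (MeasurePreserving.id (PG.prod (Measure.pi μ)))
    rw [← hE.map_eq, Measure.map_map (hme (m + 1)) hE.measurable]
    simp only [Q]
    rw [← h2.map_eq, Measure.map_map (measurable_Phi pol hpol m) h2.measurable]
    congr 1
    funext ⟨⟨y, g⟩, ⟨c, z⟩⟩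
    have hh : hist pol (Yext (Fin.snoc y z : Fin (m + 1) → Fin K → ℝ))
        (Gext (Fin.snoc g c : Fin (m + 1) → ℝ)) m = hist pol (Yext y) (Gext g) m :=
      hist_congr pol _ _ _ _ m (fun s hs => Yext_snoc_lt y z s hs)
        (fun s hs => Gext_snoc_lt g c s hs)
    simp only [Function.comp, Prod.map, Phi, hist, hh, Yext_snoc_self, Gext_snoc_self, id]

theorem mp_final {K : ℕ} (pol : (t : ℕ) → (Fin t → ℝ × ℝ) → ℝ → Fin K)
    (hpol : ∀ t, Measurable fun p : (Fin t → ℝ × ℝ) × ℝ => pol t p.1 p.2)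
    (PG : Measure ℝ) [IsProbabilityMeasure PG]
    (μ : Fin K → Measure ℝ) [∀ i, IsProbabilityMeasure (μ i)] (n : ℕ) :
    MeasurePreserving (fun w : (Fin n → Fin K → ℝ) × (Fin (n + 1) → ℝ) =>
        (hist pol (Yext w.1) (Gext w.2) n, w.2 (Fin.last n)))
      ((Measure.pi fun _ : Fin n => Measure.pi μ).prod (Measure.pi fun _ : Fin (n + 1) => PG))
      ((Q pol PG μ n).prod PG) := by
  have hme : Measurable (fun w : (Fin n → Fin K → ℝ) × (Fin (n + 1) → ℝ) =>
        (hist pol (Yext w.1) (Gext w.2) n, w.2 (Fin.last n))) :=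
    ((measurable_hist pol hpol n).comp
      ((measurable_Yext.comp measurable_fst).prodMk (measurable_Gext.comp measurable_snd))).prodMk
      ((measurable_pi_apply _).comp measurable_snd)
  refine ⟨hme, ?_⟩
  have hE := ((MeasurePreserving.id (Measure.pi fun _ : Fin n => Measure.pi μ)).prod
    (mp_snoc PG n)).comp (measurePreserving_prodAssoc (Measure.pi fun _ : Fin n => Measure.pi μ)
      (Measure.pi fun _ : Fin n => PG) PG)
  have h2 := (mp_hist pol hpol PG μ n).prod (MeasurePreserving.id PG)
  rw [← hE.map_eq, Measure.map_map hme hE.measurable, ← h2.map_eq]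
  congr 1
  funext ⟨⟨y, g⟩, c⟩
  have hh : hist pol (Yext y)
      (Gext (Fin.snoc g c : Fin (n + 1) → ℝ)) n = hist pol (Yext y) (Gext g) n :=
    hist_congr pol _ _ _ _ n (fun s hs => rfl) (fun s hs => Gext_snoc_lt g c s hs)
  simp only [Function.comp, Prod.map, id]
  refine Prod.ext hh ?_
  exact Fin.snoc_last (α := fun _ => ℝ) c g

def BM {α : Type} [MeasurableSpace α] (f : α → ℝ) : Prop := Measurable f ∧ ∃ B, ∀ x, |f x| ≤ B

theorem BM.integrable {α : Type} [MeasurableSpace α] {f : α → ℝ} (h : BM f) (μ : Measure α)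
    [IsProbabilityMeasure μ] : Integrable f μ := by
  obtain ⟨hm, B, hB⟩ := h
  exact Integrable.of_bound hm.aestronglyMeasurable B (Filter.Eventually.of_forall hB)

theorem BM.const {α : Type} [MeasurableSpace α] (c : ℝ) : BM (fun _ : α => c) :=
  ⟨measurable_const, |c|, fun _ => le_rfl⟩

theorem BM.add {α : Type} [MeasurableSpace α] {f g : α → ℝ} (hf : BM f) (hg : BM g) :
    BM (fun x => f x + g x) := by
  obtain ⟨hm, B, hB⟩ := hf
  obtain ⟨hm', B', hB'⟩ := hg
  exact ⟨hm.add hm', B + B', fun x => (abs_add_le _ _).trans (add_le_add (hB x) (hB' x))⟩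

theorem BM.mul {α : Type} [MeasurableSpace α] {f g : α → ℝ} (hf : BM f) (hg : BM g) :
    BM (fun x => f x * g x) := by
  obtain ⟨hm, B, hB⟩ := hf
  obtain ⟨hm', B', hB'⟩ := hg
  refine ⟨hm.mul hm', B * B', fun x => ?_⟩
  rw [abs_mul]
  exact mul_le_mul (hB x) (hB' x) (abs_nonneg _) ((abs_nonneg _).trans (hB x))

theorem BM.comp {α β : Type} [MeasurableSpace α] [MeasurableSpace β] {f : α → ℝ} (hf : BM f)
    {g : β → α} (hg : Measurable g) : BM (fun x => f (g x)) :=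
  ⟨hf.1.comp hg, hf.2.imp fun _ h _ => h _⟩

theorem BM.exp {α : Type} [MeasurableSpace α] {f : α → ℝ} (hf : BM f) :
    BM (fun x => Real.exp (f x)) := by
  obtain ⟨hm, B, hB⟩ := hf
  refine ⟨Real.measurable_exp.comp hm, Real.exp B, fun x => ?_⟩
  rw [abs_of_pos (Real.exp_pos _)]
  exact Real.exp_le_exp.2 ((le_abs_self _).trans (hB x))

theorem BM.integral {α β : Type} [MeasurableSpace α] [MeasurableSpace β] {f : α × β → ℝ}
    (hf : BM f) (μ : Measure β) [IsProbabilityMeasure μ] : BM (fun x => ∫ y, f (x, y) ∂μ) := by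
  obtain ⟨hm, B, hB⟩ := hf
  refine ⟨(StronglyMeasurable.integral_prod_right (f := fun x y => f (x, y))
    hm.stronglyMeasurable).measurable, B, fun x => ?_⟩
  have := norm_integral_le_of_norm_le_const (μ := μ) (f := fun y => f (x, y)) (C := B)
    (Filter.Eventually.of_forall fun y => hB _)
  simpa using this

section chg

variable {K : ℕ} (pol : (t : ℕ) → (Fin t → ℝ × ℝ) → ℝ → Fin K)
    (hpol : ∀ t, Measurable fun p : (Fin t → ℝ × ℝ) × ℝ => pol t p.1 p.2)
    (PG : Measure ℝ) [IsProbabilityMeasure PG]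

theorem Q_step (hpol : ∀ t, Measurable fun p : (Fin t → ℝ × ℝ) × ℝ => pol t p.1 p.2)
    (μ : Fin K → Measure ℝ) [∀ i, IsProbabilityMeasure (μ i)] (t : ℕ)
    (f : (Fin (t + 1) → ℝ × ℝ) → ℝ) (hf : BM f) :
    ∫ h, f h ∂(Q pol PG μ (t + 1)) =
      ∫ h, ∫ q, f (Phi pol t (h, q)) ∂(PG.prod (Measure.pi μ)) ∂(Q pol PG μ t) := by
  have := Q_prob pol hpol PG μ t
  simp only [Q]
  rw [integral_map (measurable_Phi pol hpol t).aemeasurable hf.1.aestronglyMeasurable,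
    integral_prod _ ((hf.comp (measurable_Phi pol hpol t)).integrable _)]

theorem inner_eq (μ : Fin K → Measure ℝ) [∀ i, IsProbabilityMeasure (μ i)]
    (F : ℝ × ℝ → ℝ) (hF : BM F) (G : Fin K → ℝ → ℝ) (hG : ∀ i, Measurable (G i))
    (hGB : ∃ B, ∀ i y, |G i y| ≤ B)
    (i : ℝ → Fin K) (hi : Measurable i) :
    ∫ q, F (q.1, q.2 (i q.1)) * G (i q.1) (q.2 (i q.1)) ∂(PG.prod (Measure.pi μ)) =
      ∫ g, ∫ y, F (g, y) * G (i g) y ∂(μ (i g)) ∂PG := by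
  have hm : Measurable fun q : ℝ × (Fin K → ℝ) => q.2 (i q.1) :=
    measurable_evalAt.comp ((hi.comp measurable_fst).prodMk measurable_snd)
  have hG2 : Measurable (fun q : Fin K × ℝ => G q.1 q.2) := measurable_from_prod_countable_right hG
  have hG3 : BM (fun q : Fin K × ℝ => G q.1 q.2) := ⟨hG2, hGB.imp fun B h x => h _ _⟩
  rw [integral_prod]
  · congr 1
    funext g
    have hmp := measurePreserving_eval μ (i g)
    have hh := integral_map (μ := Measure.pi μ) hmp.measurable.aemeasurable
      (f := fun y => F (g, y) * G (i g) y)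
      ((hF.comp measurable_prodMk_left).1.mul (hG _)).aestronglyMeasurable
    rw [hmp.map_eq] at hh
    exact hh.symm
  · refine BM.integrable (BM.mul (hF.comp (measurable_fst.prodMk hm))
      (hG3.comp (g := fun q : ℝ × (Fin K → ℝ) => (i q.1, q.2 (i q.1))) ?_)) _
    exact (hi.comp measurable_fst).prodMk hm

/-- log-likelihood ratio -/
def ell (R : Fin K → ℝ → ℝ) : (t : ℕ) → (Fin t → ℝ × ℝ) → ℝ
  | 0 => fun _ => 0
  | t + 1 => fun h => ell R t (Fin.init h) +
      Real.log (R (pol t (Fin.init h) (h (Fin.last t)).2) (h (Fin.last t)).1)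

theorem ell_Phi (R : Fin K → ℝ → ℝ) (t : ℕ) (h : Fin t → ℝ × ℝ) (q : ℝ × (Fin K → ℝ)) :
    ell pol R (t + 1) (Phi pol t (h, q)) = ell pol R t h +
      Real.log (R (pol t h q.1) (q.2 (pol t h q.1))) := by
  simp [ell, Phi]

theorem log_R_bound {r : ℝ} (h1 : 1 / 2 ≤ r) (h2 : r ≤ 3 / 2) : |Real.log r| ≤ 1 := by
  have hr : 0 < r := by linarith
  rw [abs_le]
  constructor
  · have := Real.one_sub_inv_le_log_of_pos hr
    have h3 : r⁻¹ ≤ 2 := by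
      rw [inv_le_comm₀ hr (by norm_num)]; linarith
    linarith
  · have := Real.log_le_sub_one_of_pos hr
    linarith

theorem ell_BM (hpol : ∀ t, Measurable fun p : (Fin t → ℝ × ℝ) × ℝ => pol t p.1 p.2)
    (R : Fin K → ℝ → ℝ) (hR : ∀ i, Measurable (R i))
    (hRl : ∀ i y, 1 / 2 ≤ R i y) (hRu : ∀ i y, R i y ≤ 3 / 2) (t : ℕ) :
    BM (ell pol R t) := by
  induction t with
  | zero => exact BM.const 0
  | succ t ih =>
    have hinit : Measurable (fun h : Fin (t + 1) → ℝ × ℝ => (Fin.init h : Fin t → ℝ × ℝ)) :=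
      measurable_pi_iff.2 fun i => measurable_pi_apply _
    have hlast : Measurable (fun h : Fin (t + 1) → ℝ × ℝ => h (Fin.last t)) :=
      measurable_pi_apply _
    refine (ih.comp hinit).add ?_
    have hL : BM (fun q : Fin K × ℝ => Real.log (R q.1 q.2)) :=
      ⟨measurable_from_prod_countable_right fun i => Real.measurable_log.comp (hR i), 1,
        fun q => log_R_bound (hRl _ _) (hRu _ _)⟩
    exact hL.comp (g := fun h : Fin (t + 1) → ℝ × ℝ =>
      (pol t (Fin.init h) (h (Fin.last t)).2, (h (Fin.last t)).1))
      (((hpol t).comp (hinit.prodMk hlast.snd)).prodMk hlast.fst)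

theorem change (hpol : ∀ t, Measurable fun p : (Fin t → ℝ × ℝ) × ℝ => pol t p.1 p.2)
    (R : Fin K → ℝ → ℝ) (hR : ∀ i, Measurable (R i))
    (hRl : ∀ i y, 1 / 2 ≤ R i y) (hRu : ∀ i y, R i y ≤ 3 / 2)
    (μ μ' : Fin K → Measure ℝ) [∀ i, IsProbabilityMeasure (μ i)]
    [∀ i, IsProbabilityMeasure (μ' i)]
    (hd : ∀ i, ∀ φ : ℝ → ℝ, BM φ → ∫ y, φ y ∂(μ' i) = ∫ y, φ y * R i y ∂(μ i))
    (t : ℕ) (f : (Fin t → ℝ × ℝ) → ℝ) (hf : BM f) :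
    ∫ h, f h ∂(Q pol PG μ' t) = ∫ h, f h * Real.exp (ell pol R t h) ∂(Q pol PG μ t) := by
  induction t with
  | zero => simp [Q, ell]
  | succ t ih =>
    have hRB : ∃ B, ∀ i y, |R i y| ≤ B := ⟨3 / 2, fun i y => by
      rw [abs_le]; constructor <;> linarith [hRl i y, hRu i y]⟩
    rw [Q_step pol PG hpol μ' t f hf, Q_step pol PG hpol μ t _
      (hf.mul (ell_BM pol hpol R hR hRl hRu (t + 1)).exp), ih]
    · congr 1
      funext h
      have hi : Measurable (pol t h) := (hpol t).comp measurable_prodMk_left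
      have hF : BM (fun p : ℝ × ℝ => f (Fin.snoc h (p.2, p.1))) := hf.comp
        ((measurable_snoc' (α := ℝ × ℝ) t).comp (g := fun p : (Fin t → ℝ × ℝ) × (ℝ × ℝ) =>
            (Fin.snoc p.1 p.2 : Fin (t + 1) → ℝ × ℝ))
          (measurable_const.prodMk (measurable_snd.prodMk measurable_fst)))
      have e1 := inner_eq PG μ' _ hF (fun _ _ => 1) (fun _ => measurable_const)
        ⟨1, fun _ _ => by simp⟩ (pol t h) hi
      have e2 := inner_eq PG μ _ hF R hR hRB (pol t h) hi
      have e3 : ∫ g, ∫ y, f (Fin.snoc h (y, g)) * 1 ∂(μ' (pol t h g)) ∂PG =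
          ∫ g, ∫ y, f (Fin.snoc h (y, g)) * R (pol t h g) y ∂(μ (pol t h g)) ∂PG := by
        congr 1
        funext g
        simp only [mul_one]
        exact hd _ _ (hF.comp measurable_prodMk_left)
      simp only [ell_Phi]
      have e4 : ∀ q : ℝ × (Fin K → ℝ), f (Phi pol t (h, q)) *
          Real.exp (ell pol R t h + Real.log (R (pol t h q.1) (q.2 (pol t h q.1)))) =
          Real.exp (ell pol R t h) * (f (Phi pol t (h, q)) *
            R (pol t h q.1) (q.2 (pol t h q.1))) := by
        intro q
        rw [Real.exp_add, Real.exp_log (by linarith [hRl (pol t h q.1) (q.2 (pol t h q.1))])]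
        ring
      simp only [e4]
      rw [integral_const_mul, mul_comm]
      congr 1
      simp only [Phi]
      have e5 := e1.trans (e3.trans e2.symm)
      simp only [mul_one] at e5
      exact e5
    · exact (hf.comp (measurable_Phi pol hpol t)).integral _

theorem ell_lower (hpol : ∀ t, Measurable fun p : (Fin t → ℝ × ℝ) × ℝ => pol t p.1 p.2)
    (R : Fin K → ℝ → ℝ) (hR : ∀ i, Measurable (R i))
    (hRl : ∀ i y, 1 / 2 ≤ R i y) (hRu : ∀ i y, R i y ≤ 3 / 2)
    (μ : Fin K → Measure ℝ) [∀ i, IsProbabilityMeasure (μ i)]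
    (e : Fin K → ℝ) (he : ∀ i, - e i ≤ ∫ y, Real.log (R i y) ∂(μ i)) (t : ℕ) :
    - ∑ s ∈ Finset.range t, ∫ h, ∫ g, e (pol s h g) ∂PG ∂(Q pol PG μ s) ≤
      ∫ h, ell pol R t h ∂(Q pol PG μ t) := by
  induction t with
  | zero => simp [ell]
  | succ t ih =>
    have := Q_prob pol hpol PG μ t
    have hE := ell_BM pol hpol R hR hRl hRu
    have hebm : BM (fun p : (Fin t → ℝ × ℝ) × ℝ => e (pol t p.1 p.2)) := by
      refine BM.comp (f := e) ⟨measurable_of_countable e, ∑ i, |e i|, fun i => ?_⟩ (hpol t)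
      exact Finset.single_le_sum (f := fun i => |e i|) (fun _ _ => abs_nonneg _)
        (Finset.mem_univ i)
    rw [Q_step pol PG hpol μ t _ (hE (t + 1)), Finset.sum_range_succ, neg_add]
    refine (add_le_add ih le_rfl).trans ?_
    have hneg : Integrable (fun h => -∫ g, e (pol t h g) ∂PG) (Q pol PG μ t) :=
      ((hebm.integral PG).integrable _).neg
    rw [← integral_neg, ← integral_add ((hE t).integrable _) hneg]
    refine integral_mono (((hE t).integrable _).add hneg)
      ((((hE (t + 1)).comp (measurable_Phi pol hpol t)).integral _).integrable _) ?_
    intro h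
    have hi : Measurable (pol t h) := (hpol t).comp measurable_prodMk_left
    have e2 := inner_eq PG μ (fun _ => 1) (BM.const 1) (fun i y => Real.log (R i y))
      (fun i => Real.measurable_log.comp (hR i))
      ⟨1, fun i y => log_R_bound (hRl _ _) (hRu _ _)⟩ (pol t h) hi
    have hL : BM (fun q : Fin K × ℝ => Real.log (R q.1 q.2)) :=
      ⟨measurable_from_prod_countable_right fun i => Real.measurable_log.comp (hR i), 1,
        fun q => log_R_bound (hRl _ _) (hRu _ _)⟩
    have hL2 : BM (fun q : ℝ × (Fin K → ℝ) =>
        Real.log (R (pol t h q.1) (q.2 (pol t h q.1)))) := by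
      refine hL.comp (g := fun q : ℝ × (Fin K → ℝ) => (pol t h q.1, q.2 (pol t h q.1))) ?_
      exact (hi.comp measurable_fst).prodMk
        (measurable_evalAt.comp ((hi.comp measurable_fst).prodMk measurable_snd))
    simp only [ell_Phi]
    rw [integral_add (integrable_const _) (hL2.integrable _)]
    simp only [one_mul] at e2
    rw [e2, integral_const]
    simp only [probReal_univ, one_smul]
    refine add_le_add le_rfl ?_
    rw [← integral_neg]
    refine integral_mono ((hebm.comp measurable_prodMk_left).integrable PG).neg ?_
      (fun g => he _)
    have hcm : BM (fun i : Fin K => ∫ y, Real.log (R i y) ∂(μ i)) :=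
      ⟨measurable_of_countable _, ∑ i, |∫ y, Real.log (R i y) ∂(μ i)|, fun i =>
        Finset.single_le_sum (f := fun i => |∫ y, Real.log (R i y) ∂(μ i)|)
          (fun _ _ => abs_nonneg _) (Finset.mem_univ i)⟩
    exact (hcm.comp hi).integrable PG

theorem two_point (hpol : ∀ t, Measurable fun p : (Fin t → ℝ × ℝ) × ℝ => pol t p.1 p.2)
    (R : Fin K → ℝ → ℝ) (hR : ∀ i, Measurable (R i))
    (hRl : ∀ i y, 1 / 2 ≤ R i y) (hRu : ∀ i y, R i y ≤ 3 / 2)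
    (μ μ' : Fin K → Measure ℝ) [∀ i, IsProbabilityMeasure (μ i)]
    [∀ i, IsProbabilityMeasure (μ' i)]
    (hd : ∀ i, ∀ φ : ℝ → ℝ, BM φ → ∫ y, φ y ∂(μ' i) = ∫ y, φ y * R i y ∂(μ i))
    (n : ℕ) (hl : -(1 / 16) ≤ ∫ h, ell pol R n h ∂(Q pol PG μ n))
    (s : (Fin n → ℝ × ℝ) × ℝ → ℝ) (hsm : Measurable s) (hs0 : ∀ p, 0 ≤ s p) (hs1 : ∀ p, s p ≤ 1) :
    2 / 5 ≤ ∫ p, s p ∂((Q pol PG μ n).prod PG) + ∫ p, (1 - s p) ∂((Q pol PG μ' n).prod PG) := by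
  have := Q_prob pol hpol PG μ n
  have := Q_prob pol hpol PG μ' n
  have hE := ell_BM pol hpol R hR hRl hRu n
  have hs : BM s := ⟨hsm, 1, fun p => by rw [abs_of_nonneg (hs0 p)]; exact hs1 p⟩
  have hs' : BM (fun p => 1 - s p) := ⟨measurable_const.sub hsm, 1, fun p => by
    rw [abs_of_nonneg (by linarith [hs1 p])]; linarith [hs0 p]⟩
  rw [integral_prod _ (hs.integrable _), integral_prod _ (hs'.integrable _)]
  rw [change pol PG hpol R hR hRl hRu μ μ' hd n _ (hs'.integral PG)]
  rw [← integral_add ((hs.integral PG).integrable _)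
    (((hs'.integral PG).mul hE.exp).integrable _)]
  have h1 := change pol PG hpol R hR hRl hRu μ μ' hd n _ (BM.const 1)
  simp only [integral_const, probReal_univ, one_smul, one_mul] at h1
  have key : ∫ h, ((8 / 5 + 2 * ell pol R n h) + (-1) * Real.exp (ell pol R n h)) ∂(Q pol PG μ n) ≤
      ∫ h, (∫ g, s (h, g) ∂PG + (∫ g, (1 - s (h, g)) ∂PG) * Real.exp (ell pol R n h))
        ∂(Q pol PG μ n) := by
    refine integral_mono ((((BM.const _).add ((BM.const 2).mul hE)).add
      ((BM.const (-1)).mul hE.exp)).integrable _)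
      (((hs.integral PG).add ((hs'.integral PG).mul hE.exp)).integrable _) ?_
    intro h
    simp only
    rw [integral_sub (integrable_const _) ((hs.comp measurable_prodMk_left).integrable PG)]
    simp only [integral_const, probReal_univ, one_smul]
    have a0 : 0 ≤ ∫ g, s (h, g) ∂PG := integral_nonneg fun g => hs0 _
    have a1 : ∫ g, s (h, g) ∂PG ≤ 1 := by
      have := integral_mono ((hs.comp measurable_prodMk_left).integrable PG) (integrable_const 1)
        (fun g => hs1 (h, g))
      simpa using this
    generalize (∫ g, s (h, g) ∂PG) = a at *
    generalize ell pol R n h = l at *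
    have b1 := Real.add_one_le_exp l
    have b2 : 3 / 5 + 2 * l ≤ Real.exp l := by
      have := Real.add_one_le_exp (l - Real.log 2)
      rw [Real.exp_sub, Real.exp_log (by norm_num)] at this
      have := Real.log_two_lt_d9
      linarith
    nlinarith
  refine le_trans ?_ key
  rw [integral_add (((BM.const _).add ((BM.const 2).mul hE)).integrable _)
      (((BM.const (-1)).mul hE.exp).integrable _),
    integral_add ((BM.const _).integrable _) (((BM.const 2).mul hE).integrable _),
    integral_const_mul, integral_const_mul, ← h1]
  simp only [integral_const, probReal_univ, one_smul]
  linarith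

end chg

theorem exists_cdf {a b : ℝ} {F : ℝ → ℝ} (hF : IsCdfOn a b F) :
    ∃ ν : Measure ℝ, IsProbabilityMeasure ν ∧ ∀ y, ν (Set.Iic y) = ENNReal.ofReal (F y) := by
  obtain ⟨hm, hc, h0, h1⟩ := hF
  let f : StieltjesFunction ℝ := ⟨F, hm, hc⟩
  have hb : Filter.Tendsto f Filter.atBot (nhds 0) := by
    refine tendsto_const_nhds.congr' ?_
    filter_upwards [Filter.eventually_lt_atBot a] with x hx
    exact (h0 x hx).symm
  have ht : Filter.Tendsto f Filter.atTop (nhds 1) := by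
    refine tendsto_const_nhds.congr' ?_
    filter_upwards [Filter.eventually_ge_atTop b] with x hx
    exact (h1 x hx).symm
  refine ⟨f.measure, f.isProbabilityMeasure hb ht, fun y => ?_⟩
  rw [f.measure_Iic hb, sub_zero]

theorem cdf_nonneg {a b : ℝ} {F : ℝ → ℝ} (hF : IsCdfOn a b F) (y : ℝ) : 0 ≤ F y := by
  obtain ⟨hm, hc, h0, h1⟩ := hF
  have := hm (min_le_left y (a - 1))
  rwa [h0 _ (lt_of_le_of_lt (min_le_right _ _) (by linarith))] at this

def mixM (ν1 ν2 : Measure ℝ) (τ : ℝ) : Measure ℝ :=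
  ENNReal.ofReal τ • ν1 + ENNReal.ofReal (1 - τ) • ν2

theorem mixM_prob (ν1 ν2 : Measure ℝ) [IsProbabilityMeasure ν1] [IsProbabilityMeasure ν2] {τ : ℝ}
    (h : τ ∈ Set.Icc (0 : ℝ) 1) : IsProbabilityMeasure (mixM ν1 ν2 τ) := by
  refine ⟨?_⟩
  simp only [mixM, Measure.coe_add, Measure.coe_smul, Pi.add_apply, Pi.smul_apply, measure_univ,
    smul_eq_mul, mul_one]
  rw [← ENNReal.ofReal_add h.1 (by linarith [h.2])]
  simp

theorem mixM_Iic (ν1 ν2 : Measure ℝ) {H1 H2 : ℝ → ℝ} (h1 : ∀ y, 0 ≤ H1 y) (h2 : ∀ y, 0 ≤ H2 y)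
    (hν1 : ∀ y, ν1 (Set.Iic y) = ENNReal.ofReal (H1 y))
    (hν2 : ∀ y, ν2 (Set.Iic y) = ENNReal.ofReal (H2 y)) {τ : ℝ}
    (h : τ ∈ Set.Icc (0 : ℝ) 1) (y : ℝ) :
    mixM ν1 ν2 τ (Set.Iic y) = ENNReal.ofReal (τ * H1 y + (1 - τ) * H2 y) := by
  simp only [mixM, Measure.coe_add, Measure.coe_smul, Pi.add_apply, Pi.smul_apply, hν1, hν2,
    smul_eq_mul]
  have h3 : 0 ≤ 1 - τ := by linarith [h.2]
  rw [ENNReal.ofReal_add (mul_nonneg h.1 (h1 y)) (mul_nonneg h3 (h2 y)),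
    ENNReal.ofReal_mul h.1, ENNReal.ofReal_mul h3]

theorem mixM_integral (ν1 ν2 : Measure ℝ) [IsProbabilityMeasure ν1] [IsProbabilityMeasure ν2]
    {τ : ℝ} (h : τ ∈ Set.Icc (0 : ℝ) 1) (φ : ℝ → ℝ) (hφ : BM φ) :
    ∫ y, φ y ∂(mixM ν1 ν2 τ) = ∫ y, (τ * (ν1.rnDeriv (ν1 + ν2) y).toReal +
      (1 - τ) * (ν2.rnDeriv (ν1 + ν2) y).toReal) * φ y ∂(ν1 + ν2) := by
  have a1 : ν1 ≪ ν1 + ν2 := Measure.absolutelyContinuous_of_le (Measure.le_add_right le_rfl)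
  have a2 : ν2 ≪ ν1 + ν2 := Measure.absolutelyContinuous_of_le (Measure.le_add_left le_rfl)
  have i1 := (integrable_rnDeriv_smul_iff a1).2 (hφ.integrable ν1)
  have i2 := (integrable_rnDeriv_smul_iff a2).2 (hφ.integrable ν2)
  have e1 := integral_rnDeriv_smul (f := φ) a1
  have e2 := integral_rnDeriv_smul (f := φ) a2
  unfold mixM
  rw [integral_add_measure ((hφ.integrable ν1).smul_measure (by simp))
    ((hφ.integrable ν2).smul_measure (by simp)), integral_smul_measure, integral_smul_measure,
    ENNReal.toReal_ofReal h.1, ENNReal.toReal_ofReal (by linarith [h.2]), ← e1, ← e2,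
    ← integral_smul, ← integral_smul]
  have i3 : Integrable (fun x => τ • (ν1.rnDeriv (ν1 + ν2) x).toReal • φ x) (ν1 + ν2) := i1.smul τ
  have i4 : Integrable (fun x => (1 - τ) • (ν2.rnDeriv (ν1 + ν2) x).toReal • φ x) (ν1 + ν2) :=
    i2.smul (1 - τ)
  rw [← integral_add i3 i4]
  congr 1
  funext y
  simp only [smul_eq_mul]
  ring

theorem density (ν1 ν2 : Measure ℝ) [IsProbabilityMeasure ν1] [IsProbabilityMeasure ν2]
    {τ τ' : ℝ} (h : τ ∈ Set.Icc (1 / 4 : ℝ) (3 / 4)) (h' : τ' ∈ Set.Icc (0 : ℝ) 1) :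
    ∃ R : ℝ → ℝ, Measurable R ∧ (∀ y, |R y - 1| ≤ 4 * |τ' - τ|) ∧
      ∀ φ : ℝ → ℝ, BM φ → ∫ y, φ y ∂(mixM ν1 ν2 τ') = ∫ y, φ y * R y ∂(mixM ν1 ν2 τ) := by
  have h0 : τ ∈ Set.Icc (0 : ℝ) 1 := ⟨by linarith [h.1], by linarith [h.2]⟩
  set p1 : ℝ → ℝ := fun y => (ν1.rnDeriv (ν1 + ν2) y).toReal with hp1
  set p2 : ℝ → ℝ := fun y => (ν2.rnDeriv (ν1 + ν2) y).toReal with hp2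
  have m1 : Measurable p1 := (Measure.measurable_rnDeriv _ _).ennreal_toReal
  have m2 : Measurable p2 := (Measure.measurable_rnDeriv _ _).ennreal_toReal
  have n1 : ∀ y, 0 ≤ p1 y := fun y => ENNReal.toReal_nonneg
  have n2 : ∀ y, 0 ≤ p2 y := fun y => ENNReal.toReal_nonneg
  set R : ℝ → ℝ := fun y => 1 + (τ' - τ) * ((p1 y - p2 y) / (τ * p1 y + (1 - τ) * p2 y)) with hR
  have mR : Measurable R := measurable_const.add (measurable_const.mul
    ((m1.sub m2).div ((measurable_const.mul m1).add (measurable_const.mul m2))))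
  have bR : ∀ y, |R y - 1| ≤ 4 * |τ' - τ| := by
    intro y
    have : R y - 1 = (τ' - τ) * ((p1 y - p2 y) / (τ * p1 y + (1 - τ) * p2 y)) := by
      simp [hR]
    rw [this, abs_mul, mul_comm 4]
    refine mul_le_mul_of_nonneg_left ?_ (abs_nonneg _)
    have hm : 0 ≤ τ * p1 y + (1 - τ) * p2 y :=
      add_nonneg (mul_nonneg h0.1 (n1 y)) (mul_nonneg (by linarith [h0.2]) (n2 y))
    rw [abs_div, abs_of_nonneg hm]
    refine div_le_of_le_mul₀ hm (by norm_num) ?_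
    have c1 := mul_le_mul_of_nonneg_right h.1 (n1 y)
    have c2 := mul_le_mul_of_nonneg_right h.2 (n2 y)
    rw [abs_le]
    constructor <;> nlinarith [n1 y, n2 y]
  refine ⟨R, mR, bR, fun φ hφ => ?_⟩
  have hRB : BM R := ⟨mR, 4 * |τ' - τ| + 1, fun y => by
    have := abs_add_le (R y - 1) 1
    simp only [sub_add_cancel, abs_one] at this
    linarith [bR y]⟩
  rw [mixM_integral ν1 ν2 h' φ hφ, mixM_integral ν1 ν2 h0 _ (hφ.mul hRB)]
  congr 1
  funext y
  change (τ' * p1 y + (1 - τ') * p2 y) * φ y = (τ * p1 y + (1 - τ) * p2 y) *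
    (φ y * (1 + (τ' - τ) * ((p1 y - p2 y) / (τ * p1 y + (1 - τ) * p2 y))))
  by_cases hm : τ * p1 y + (1 - τ) * p2 y = 0
  · have c1 := mul_le_mul_of_nonneg_right h.1 (n1 y)
    have c2 := mul_le_mul_of_nonneg_right h.2 (n2 y)
    have z1 : p1 y = 0 := by nlinarith [n1 y, n2 y]
    have z2 : p2 y = 0 := by nlinarith [n1 y, n2 y]
    simp [z1, z2]
  · have hq : (τ * p1 y + (1 - τ) * p2 y) * ((p1 y - p2 y) / (τ * p1 y + (1 - τ) * p2 y)) =
      p1 y - p2 y := mul_div_cancel₀ _ hm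
    linear_combination (-(φ y * (τ' - τ))) * hq

theorem log_integral (μ : Measure ℝ) [IsProbabilityMeasure μ] (R : ℝ → ℝ) (hR : Measurable R)
    (x : ℝ) (hx : x ≤ 1 / 2) (hb : ∀ y, |R y - 1| ≤ x) (h1 : ∫ y, R y ∂μ = 1) :
    -(2 * x ^ 2) ≤ ∫ y, Real.log (R y) ∂μ := by
  have hl : ∀ y, 1 / 2 ≤ R y := fun y => by have := (abs_le.1 (hb y)).1; linarith
  have hu : ∀ y, R y ≤ 3 / 2 := fun y => by have := (abs_le.1 (hb y)).2; linarith
  have bR : BM R := ⟨hR, 3 / 2, fun y => by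
    rw [abs_le]; constructor <;> linarith [hl y, hu y]⟩
  have bL : BM (fun y => Real.log (R y)) := ⟨Real.measurable_log.comp hR, 1, fun y =>
    log_R_bound (hl y) (hu y)⟩
  have : ∫ y, (R y + (-1 - 2 * x ^ 2)) ∂μ ≤ ∫ y, Real.log (R y) ∂μ := by
    refine integral_mono ((bR.add (BM.const _)).integrable μ) (bL.integrable μ) fun y => ?_
    have hp : 0 < R y := by linarith [hl y]
    have c := Real.one_sub_inv_le_log_of_pos hp
    have h2 : (R y - 1) ^ 2 ≤ x ^ 2 := sq_le_sq' (by linarith [(abs_le.1 (hb y)).1])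
      (abs_le.1 (hb y)).2
    refine le_trans ?_ c
    have h3 : (1 - (R y)⁻¹) - (R y - 1) + 2 * (R y - 1) ^ 2 =
      (R y - 1) ^ 2 * (2 * R y - 1) / R y := by field_simp; ring
    have h4 : 0 ≤ (R y - 1) ^ 2 * (2 * R y - 1) / R y :=
      div_nonneg (mul_nonneg (sq_nonneg _) (by linarith [hl y])) hp.le
    simp only
    linarith
  rw [integral_add (bR.integrable μ) (integrable_const _), h1] at this
  simp only [integral_const, probReal_univ, one_smul] at this
  linarith

theorem mix_eq {K : ℕ} (H1 H2 : ℝ → ℝ) (τ δ : Fin K → ℝ) (hδ : δ ∈ stdSimplex ℝ (Fin K)) :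
    mix δ (fun i z => τ i * H1 z + (1 - τ i) * H2 z) =
      fun x => (∑ i, δ i * τ i) * H1 x + (1 - ∑ i, δ i * τ i) * H2 x := by
  funext x
  have h1 : ∑ i, δ i = 1 := hδ.2
  simp only [mix]
  have h2 : (1 - ∑ i, δ i * τ i) = ∑ i, (δ i - δ i * τ i) := by
    rw [Finset.sum_sub_distrib, h1]
  rw [h2, Finset.sum_mul, Finset.sum_mul, ← Finset.sum_add_distrib]
  exact Finset.sum_congr rfl fun i _ => by ring

theorem dot_mem {K : ℕ} (τ δ : Fin K → ℝ) (hδ : δ ∈ stdSimplex ℝ (Fin K))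
    (hτ : ∀ i, τ i ∈ Set.Icc (0 : ℝ) 1) : ∑ i, δ i * τ i ∈ Set.Icc (0 : ℝ) 1 := by
  constructor
  · exact Finset.sum_nonneg fun i _ => mul_nonneg (hδ.1 i) (hτ i).1
  · rw [← hδ.2]
    exact Finset.sum_le_sum fun i _ => mul_le_of_le_one_right (hδ.1 i) (hτ i).2

theorem sSup_lin {α : Type} (f : α → ℝ) (M : Set α) (hM : M.Nonempty) (k r : ℝ) (hk : 0 < k)
    (δ : α) (h : ∀ δ' ∈ M, k * (f δ' - f δ) ≤ r) : k * (sSup (f '' M) - f δ) ≤ r := by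
  have : sSup (f '' M) ≤ f δ + r / k := by
    refine csSup_le (hM.image f) ?_
    rintro _ ⟨δ', hδ', rfl⟩
    have := (le_div_iff₀' hk).2 (h δ' hδ')
    linarith
  have h2 : sSup (f '' M) - f δ ≤ r / k := by linarith
  exact (le_div_iff₀' hk).1 h2

section reg

variable (T : (ℝ → ℝ) → ℝ) (H1 H2 : ℝ → ℝ) (cminus : ℝ)

theorem g_mono (hcminus : 0 < cminus)
    (hgrow : ∀ τ₁ τ₂ : ℝ, 0 ≤ τ₁ → τ₁ ≤ τ₂ → τ₂ ≤ 1 →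
      cminus * (τ₂ - τ₁)
        ≤ T (fun x => τ₂ * H1 x + (1 - τ₂) * H2 x)
          - T (fun x => τ₁ * H1 x + (1 - τ₁) * H2 x)) (s t : ℝ) (hs : 0 ≤ s) (hst : s ≤ t)
    (ht : t ≤ 1) : T (fun x => s * H1 x + (1 - s) * H2 x) ≤ T (fun x => t * H1 x + (1 - t) * H2 x) := by
  have := hgrow s t hs hst ht
  have h2 : 0 ≤ cminus * (t - s) := mul_nonneg hcminus.le (by linarith)
  linarith

theorem reg_bdd (hcminus : 0 < cminus)
    (hgrow : ∀ τ₁ τ₂ : ℝ, 0 ≤ τ₁ → τ₁ ≤ τ₂ → τ₂ ≤ 1 →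
      cminus * (τ₂ - τ₁)
        ≤ T (fun x => τ₂ * H1 x + (1 - τ₂) * H2 x)
          - T (fun x => τ₁ * H1 x + (1 - τ₁) * H2 x)) {K : ℕ} (M : Set (Fin K → ℝ))
    (hM : M ⊆ stdSimplex ℝ (Fin K)) (τ : Fin K → ℝ) (hτ : ∀ i, τ i ∈ Set.Icc (0 : ℝ) 1) :
    T (fun x => 1 * H1 x + (1 - 1) * H2 x) ∈ upperBounds
      ((fun δ => T (mix δ (fun i z => τ i * H1 z + (1 - τ i) * H2 z))) '' M) := by
  rintro _ ⟨δ, hδ, rfl⟩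
  simp only
  rw [mix_eq H1 H2 τ δ (hM hδ)]
  have := dot_mem τ δ (hM hδ) hτ
  exact g_mono T H1 H2 cminus hcminus hgrow _ _ this.1 this.2 le_rfl

theorem reg_lower (hcminus : 0 < cminus)
    (hgrow : ∀ τ₁ τ₂ : ℝ, 0 ≤ τ₁ → τ₁ ≤ τ₂ → τ₂ ≤ 1 →
      cminus * (τ₂ - τ₁)
        ≤ T (fun x => τ₂ * H1 x + (1 - τ₂) * H2 x)
          - T (fun x => τ₁ * H1 x + (1 - τ₁) * H2 x)) {K : ℕ} (M : Set (Fin K → ℝ))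
    (hM : M ⊆ stdSimplex ℝ (Fin K)) (τ : Fin K → ℝ) (hτ : ∀ i, τ i ∈ Set.Icc (0 : ℝ) 1)
    (δ δ' : Fin K → ℝ) (hδ : δ ∈ M) (hδ' : δ' ∈ M) :
    cminus * (∑ i, δ' i * τ i - ∑ i, δ i * τ i) ≤
      sSup ((fun δ => T (mix δ (fun i z => τ i * H1 z + (1 - τ i) * H2 z))) '' M)
        - T (mix δ (fun i z => τ i * H1 z + (1 - τ i) * H2 z)) := by
  have hb := reg_bdd T H1 H2 cminus hcminus hgrow M hM τ hτ
  have h1 := le_csSup ⟨_, hb⟩ (Set.mem_image_of_mem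
    (fun δ => T (mix δ (fun i z => τ i * H1 z + (1 - τ i) * H2 z))) hδ)
  have h2 := le_csSup ⟨_, hb⟩ (Set.mem_image_of_mem
    (fun δ => T (mix δ (fun i z => τ i * H1 z + (1 - τ i) * H2 z))) hδ')
  have d1 := dot_mem τ δ (hM hδ) hτ
  have d2 := dot_mem τ δ' (hM hδ') hτ
  rcases le_total (∑ i, δ i * τ i) (∑ i, δ' i * τ i) with h | h
  · have := hgrow _ _ d1.1 h d2.2
    simp only [mix_eq H1 H2 τ δ (hM hδ), mix_eq H1 H2 τ δ' (hM hδ')] at h1 h2 ⊢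
    linarith
  · have : cminus * (∑ i, δ' i * τ i - ∑ i, δ i * τ i) ≤ 0 :=
      mul_nonpos_of_nonneg_of_nonpos hcminus.le (by linarith)
    linarith

theorem expReg_lower (hcminus : 0 < cminus)
    (hgrow : ∀ τ₁ τ₂ : ℝ, 0 ≤ τ₁ → τ₁ ≤ τ₂ → τ₂ ≤ 1 →
      cminus * (τ₂ - τ₁)
        ≤ T (fun x => τ₂ * H1 x + (1 - τ₂) * H2 x)
          - T (fun x => τ₁ * H1 x + (1 - τ₁) * H2 x)) {K : ℕ} (n : ℕ) (M : Set (Fin K → ℝ))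
    (hM : M ⊆ stdSimplex ℝ (Fin K)) (τ : Fin K → ℝ) (hτ : ∀ i, τ i ∈ Set.Icc (0 : ℝ) 1)
    (pol : (t : ℕ) → (Fin t → ℝ × ℝ) → ℝ → Fin K)
    (hpol : ∀ t, Measurable fun p : (Fin t → ℝ × ℝ) × ℝ => pol t p.1 p.2)
    (polrec : (Fin n → ℝ × ℝ) → ℝ → (Fin K → ℝ))
    (hrec : Measurable (fun p : (Fin n → ℝ × ℝ) × ℝ => polrec p.1 p.2))
    (hrecM : ∀ h g, polrec h g ∈ M) (PG : ProbabilityMeasure ℝ)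
    (μ : Fin K → ProbabilityMeasure ℝ)
    (u : (Fin n → ℝ × ℝ) × ℝ → ℝ) (hu : BM u) (k : ℝ)
    (hk : ∀ p : (Fin n → ℝ × ℝ) × ℝ, k * u p ≤
      sSup ((fun δ => T (mix δ (fun i z => τ i * H1 z + (1 - τ i) * H2 z))) '' M)
        - T (mix (polrec p.1 p.2) (fun i z => τ i * H1 z + (1 - τ i) * H2 z))) :
    k * ∫ p, u p ∂((Q pol PG (fun i => (μ i : Measure ℝ)) n).prod (PG : Measure ℝ)) ≤
      expectedRegret n T M pol polrec (fun i z => τ i * H1 z + (1 - τ i) * H2 z) μ PG := by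
  have hmp := mp_final pol hpol (PG : Measure ℝ) (fun i => (μ i : Measure ℝ)) n
  have := Q_prob pol hpol (PG : Measure ℝ) (fun i => (μ i : Measure ℝ)) n
  set S := sSup ((fun δ => T (mix δ (fun i z => τ i * H1 z + (1 - τ i) * H2 z))) '' M) with hS
  set reg : (Fin n → ℝ × ℝ) × ℝ → ℝ := fun p =>
    S - T (mix (polrec p.1 p.2) (fun i z => τ i * H1 z + (1 - τ i) * H2 z)) with hreg
  set g : ℝ → ℝ := fun s => T (fun x => (max 0 (min 1 s)) * H1 x + (1 - max 0 (min 1 s)) * H2 x)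
    with hg
  have hgm : Monotone g := fun s t hst => g_mono T H1 H2 cminus hcminus hgrow _ _
    (le_max_left _ _) (max_le_max le_rfl (min_le_min le_rfl hst))
    (max_le zero_le_one (min_le_left _ _))
  have hregeq : reg = fun p => S - g (∑ i, polrec p.1 p.2 i * τ i) := by
    funext p
    have hd := dot_mem τ _ (hM (hrecM p.1 p.2)) hτ
    simp only [hreg, hg]
    rw [mix_eq H1 H2 τ _ (hM (hrecM p.1 p.2)), min_eq_right hd.2, max_eq_right hd.1]
  have hdm : Measurable fun p : (Fin n → ℝ × ℝ) × ℝ => ∑ i, polrec p.1 p.2 i * τ i :=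
    Finset.measurable_sum _ fun i _ => ((measurable_pi_apply i).comp hrec).mul measurable_const
  have hregBM : BM reg := by
    refine ⟨?_, |S| + (|g 0| + |g 1|), fun p => ?_⟩
    · rw [hregeq]
      exact measurable_const.sub (hgm.measurable.comp hdm)
    · rw [hregeq]
      have hd := dot_mem τ _ (hM (hrecM p.1 p.2)) hτ
      refine (abs_sub _ _).trans (add_le_add le_rfl ?_)
      have g0 := hgm hd.1
      have g1 := hgm hd.2
      rw [abs_le]
      constructor
      · linarith [neg_abs_le (g 0), abs_nonneg (g 1)]
      · linarith [le_abs_self (g 1), abs_nonneg (g 0)]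
  have e : expectedRegret n T M pol polrec (fun i z => τ i * H1 z + (1 - τ i) * H2 z) μ PG =
      ∫ p, reg p ∂((Q pol PG (fun i => (μ i : Measure ℝ)) n).prod (PG : Measure ℝ)) := by
    rw [← hmp.map_eq, integral_map hmp.measurable.aemeasurable
      hregBM.1.aestronglyMeasurable]
    rfl
  rw [e, ← integral_const_mul]
  exact integral_mono (((BM.const k).mul hu).integrable _) (hregBM.integrable _) hk

theorem expReg_upper (hcminus : 0 < cminus)
    (hgrow : ∀ τ₁ τ₂ : ℝ, 0 ≤ τ₁ → τ₁ ≤ τ₂ → τ₂ ≤ 1 →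
      cminus * (τ₂ - τ₁)
        ≤ T (fun x => τ₂ * H1 x + (1 - τ₂) * H2 x)
          - T (fun x => τ₁ * H1 x + (1 - τ₁) * H2 x)) {K : ℕ} (n : ℕ) (M : Set (Fin K → ℝ))
    (hM : M ⊆ stdSimplex ℝ (Fin K)) (hne : M.Nonempty)
    (τ : Fin K → ℝ) (hτ : ∀ i, τ i ∈ Set.Icc (0 : ℝ) 1)
    (pol : (t : ℕ) → (Fin t → ℝ × ℝ) → ℝ → Fin K)
    (polrec : (Fin n → ℝ × ℝ) → ℝ → (Fin K → ℝ))
    (hrecM : ∀ h g, polrec h g ∈ M) (PG : ProbabilityMeasure ℝ)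
    (μ : Fin K → ProbabilityMeasure ℝ) :
    expectedRegret n T M pol polrec (fun i z => τ i * H1 z + (1 - τ i) * H2 z) μ PG ≤
      T (fun x => 1 * H1 x + (1 - 1) * H2 x) - T (fun x => 0 * H1 x + (1 - 0) * H2 x) := by
  have h01 := g_mono T H1 H2 cminus hcminus hgrow 0 1 le_rfl zero_le_one le_rfl
  have hS := csSup_le (hne.image _) (reg_bdd T H1 H2 cminus hcminus hgrow M hM τ hτ)
  unfold expectedRegret
  by_cases hi : Integrable (fun ω : (Fin n → Fin K → ℝ) × (Fin (n + 1) → ℝ) =>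
      (sSup ((fun δ => T (mix δ (fun i z => τ i * H1 z + (1 - τ i) * H2 z))) '' M)
        - T (mix (polrec (hist pol (Yext ω.1) (Gext ω.2) n) (ω.2 (Fin.last n)))
          (fun i z => τ i * H1 z + (1 - τ i) * H2 z))))
    ((Measure.pi fun _ : Fin n => Measure.pi fun i : Fin K => (μ i : Measure ℝ)).prod
        (Measure.pi fun _ : Fin (n + 1) => (PG : Measure ℝ)))
  · refine (integral_mono hi (integrable_const (T (fun x => 1 * H1 x + (1 - 1) * H2 x) -
      T (fun x => 0 * H1 x + (1 - 0) * H2 x))) fun ω => ?_).trans ?_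
    · simp only
      refine sub_le_sub hS ?_
      have hm := hrecM (hist pol (Yext ω.1) (Gext ω.2) n) (ω.2 (Fin.last n))
      rw [mix_eq H1 H2 τ _ (hM hm)]
      have := dot_mem τ _ (hM hm) hτ
      exact g_mono T H1 H2 cminus hcminus hgrow _ _ le_rfl this.1 this.2
    · rw [integral_const, probReal_univ, one_smul]
  · rw [integral_undef hi]
    linarith

end reg

theorem exists_part {K : ℕ} (hK : 2 ≤ K) (n : ℕ)
    (P : Finpartition (Finset.univ : Finset (Fin K)))
    (pol : (t : ℕ) → (Fin t → ℝ × ℝ) → ℝ → Fin K)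
    (hpol : ∀ t, Measurable fun p : (Fin t → ℝ × ℝ) × ℝ => pol t p.1 p.2)
    (PG : Measure ℝ) [IsProbabilityMeasure PG]
    (μ : Fin K → Measure ℝ) [∀ i, IsProbabilityMeasure (μ i)] :
    0 < P.parts.card ∧ ∃ A ∈ P.parts, ∑ s ∈ Finset.range n,
      ∫ h, ∫ g, (if pol s h g ∈ A then (1 : ℝ) else 0) ∂PG ∂(Q pol PG μ s) ≤
        n / P.parts.card := by
  have hne : P.parts.Nonempty := by
    obtain ⟨A, hA, -⟩ := P.exists_mem (Finset.mem_univ (⟨0, by omega⟩ : Fin K))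
    exact ⟨A, hA⟩
  have hc : 0 < P.parts.card := hne.card_pos
  refine ⟨hc, ?_⟩
  refine Finset.exists_le_of_sum_le (g := fun _ => (n : ℝ) / P.parts.card) hne ?_
  rw [Finset.sum_comm]
  have hone : ∀ i : Fin K, ∑ A ∈ P.parts, (if i ∈ A then (1 : ℝ) else 0) = 1 := by
    intro i
    obtain ⟨A, ⟨hA, hiA⟩, huniq⟩ := P.existsUnique_mem (Finset.mem_univ i)
    rw [Finset.sum_eq_single A]
    · simp [hiA]
    · intro B hB hne
      rw [if_neg]
      intro hiB
      exact hne (huniq B ⟨hB, hiB⟩)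
    · intro h; exact absurd hA h
  have : ∀ s ∈ Finset.range n, ∑ A ∈ P.parts,
      ∫ h, ∫ g, (if pol s h g ∈ A then (1 : ℝ) else 0) ∂PG ∂(Q pol PG μ s) = 1 := by
    intro s _
    have := Q_prob pol hpol PG μ s
    have hb : ∀ A : Finset (Fin K), BM (fun p : (Fin s → ℝ × ℝ) × ℝ =>
        if pol s p.1 p.2 ∈ A then (1 : ℝ) else 0) := fun A =>
      BM.comp (f := fun i : Fin K => if i ∈ A then (1 : ℝ) else 0)
        ⟨measurable_of_countable _, 1, fun i => by
          show |if i ∈ A then (1 : ℝ) else 0| ≤ 1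
          split_ifs <;> simp⟩ (hpol s)
    rw [← integral_finsetSum _ fun A _ => ((hb A).integral PG).integrable _]
    have : ∀ h : Fin s → ℝ × ℝ, ∑ A ∈ P.parts,
        ∫ g, (if pol s h g ∈ A then (1 : ℝ) else 0) ∂PG = 1 := by
      intro h
      rw [← integral_finsetSum _ fun A _ => ((hb A).comp measurable_prodMk_left).integrable PG]
      simp [hone]
    simp [this]
  rw [Finset.sum_congr rfl this]
  have hc' : (P.parts.card : ℝ) ≠ 0 := by positivity
  simp only [Finset.sum_const, Finset.card_range, nsmul_eq_mul, mul_one]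
  rw [mul_div_cancel₀ _ hc']

/-- Theorem B.2 of the paper: under Assumptions 1–4 there is a constant `c > 0`
(independent of `K`, `n` and `M_K`) such that for every closed `M_K ⊆ S_K` with at least
two elements, every policy with recommendations in `M_K`, any randomization measure
`P_G`, and every partition `H` of `{1,…,K}`,
`sup E[r_n(π, M_K)] ≥ c·κ(H, M_K)·√(|H|/n)` for every `n ≥ K` (hence the supremum of the
expected regret dominates `c·max_H κ(H, M_K)·√(|H|/n)`), the supremum being over all
potential outcome vectors with independent marginals and cdfs in `{J_τ : τ ∈ [0,1]}`. -/
theorem lower_bound_kappaPart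
    (a b : ℝ) (hab : a < b)
    (T : (ℝ → ℝ) → ℝ) (D : Set (ℝ → ℝ)) (hDne : D.Nonempty)
    (hDcdf : ∀ F ∈ D, IsCdfOn a b F) (hDconv : Convex ℝ D)
    (C : ℝ) (hC : 0 < C) (hLip : LipschitzAssumption a b T D C)
    (H1 H2 : ℝ → ℝ) (hH1 : H1 ∈ D) (hH2 : H2 ∈ D)
    (hJ : ∀ τ : ℝ, τ ∈ Set.Icc (0 : ℝ) 1 → (fun x => τ * H1 x + (1 - τ) * H2 x) ∈ D)
    (cminus : ℝ) (hcminus : 0 < cminus)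
    (hgrow : ∀ τ₁ τ₂ : ℝ, 0 ≤ τ₁ → τ₁ ≤ τ₂ → τ₂ ≤ 1 →
      cminus * (τ₂ - τ₁)
        ≤ T (fun x => τ₂ * H1 x + (1 - τ₂) * H2 x)
          - T (fun x => τ₁ * H1 x + (1 - τ₁) * H2 x)) :
    ∃ c : ℝ, 0 < c ∧
      ∀ (K n : ℕ), 2 ≤ K → K ≤ n →
      ∀ M : Set (Fin K → ℝ), M ⊆ stdSimplex ℝ (Fin K) → IsClosed M → M.Nontrivial →
      ∀ pol : (t : ℕ) → (Fin t → ℝ × ℝ) → ℝ → Fin K,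
        (∀ t, Measurable fun p : (Fin t → ℝ × ℝ) × ℝ => pol t p.1 p.2) →
      ∀ polrec : (Fin n → ℝ × ℝ) → ℝ → (Fin K → ℝ),
        Measurable (fun p : (Fin n → ℝ × ℝ) × ℝ => polrec p.1 p.2) →
        (∀ h g, polrec h g ∈ M) →
      ∀ PG : ProbabilityMeasure ℝ,
      ∀ P : Finpartition (Finset.univ : Finset (Fin K)),
        c * kappaPart P M * Real.sqrt (P.parts.card / n) ≤
          sSup {x : ℝ | ∃ (τ : Fin K → ℝ) (μ : Fin K → ProbabilityMeasure ℝ),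
            (∀ i, τ i ∈ Set.Icc (0 : ℝ) 1) ∧
            (∀ (i : Fin K) (y : ℝ),
              (μ i : Measure ℝ) (Set.Iic y)
                = ENNReal.ofReal (τ i * H1 y + (1 - τ i) * H2 y)) ∧
            x = expectedRegret n T M pol polrec
                  (fun i z => τ i * H1 z + (1 - τ i) * H2 z) μ PG} := by
  obtain ⟨ν1, hν1p, hν1⟩ := exists_cdf (hDcdf H1 hH1)
  obtain ⟨ν2, hν2p, hν2⟩ := exists_cdf (hDcdf H2 hH2)
  have hH1n := cdf_nonneg (hDcdf H1 hH1)
  have hH2n := cdf_nonneg (hDcdf H2 hH2)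
  refine ⟨cminus / 120, by positivity, ?_⟩
  intro K n hK hKn M hM hMc hMn pol hpol polrec hrec hrecM PG P
  set SS := {x : ℝ | ∃ (τ : Fin K → ℝ) (μ : Fin K → ProbabilityMeasure ℝ),
            (∀ i, τ i ∈ Set.Icc (0 : ℝ) 1) ∧
            (∀ (i : Fin K) (y : ℝ),
              (μ i : Measure ℝ) (Set.Iic y)
                = ENNReal.ofReal (τ i * H1 y + (1 - τ i) * H2 y)) ∧
            x = expectedRegret n T M pol polrec
                  (fun i z => τ i * H1 z + (1 - τ i) * H2 z) μ PG} with hSS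
  have hMne : M.Nonempty := hMn.nonempty
  have hMcomp : IsCompact M := (isCompact_stdSimplex ℝ (Fin K)).of_isClosed_subset hMc hM
  have hSSb : BddAbove SS := by
    refine ⟨T (fun x => 1 * H1 x + (1 - 1) * H2 x) - T (fun x => 0 * H1 x + (1 - 0) * H2 x), ?_⟩
    rintro _ ⟨τ, μ, hτ, -, rfl⟩
    exact expReg_upper T H1 H2 cminus hcminus hgrow n M hM hMne τ hτ pol polrec hrecM PG μ
  have hn : (0 : ℝ) < n := by exact_mod_cast (by omega : 0 < n)
  have hcard0 : 0 < P.parts.card := by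
    obtain ⟨A, hA, -⟩ := P.exists_mem (Finset.mem_univ (⟨0, by omega⟩ : Fin K))
    exact Finset.card_pos.2 ⟨A, hA⟩
  have hcard : (0 : ℝ) < P.parts.card := by exact_mod_cast hcard0
  have hcardle : (P.parts.card : ℝ) ≤ n := by
    have := P.card_parts_le_card
    simp only [Finset.card_univ, Fintype.card_fin] at this
    exact_mod_cast this.trans hKn
  set q := Real.sqrt (P.parts.card / n) with hq
  have hq0 : 0 < q := Real.sqrt_pos.2 (by positivity)
  have hqsq : q ^ 2 = P.parts.card / n := Real.sq_sqrt (by positivity)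
  have hq1 : q ≤ 1 := by
    rw [hq]
    exact Real.sqrt_le_one.2 ((div_le_one hn).2 hcardle)
  have hk : kappaPart P M ≤ sSup SS / (cminus / 120 * q) := by
    unfold kappaPart
    refine csSup_le ?_ ?_
    · obtain ⟨x, hx, y, hy, hxy⟩ := hMn
      refine ⟨_, {x}, 0, 0, Set.singleton_nonempty x, ?_, measurableSet_singleton x, ?_, ?_, rfl⟩
      · rw [Set.ssubset_iff_of_subset (by simpa using hx)]
        exact ⟨y, hy, fun h => hxy (by simpa using h.symm)⟩
      · intro i; simp
      · intro i; simp
    · rintro x ⟨T', v, w, hT'n, hT'M, hT'm, hv, hw, hx⟩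
      rw [le_div_iff₀' (by positivity)]
      set ε := q / 24 with hε
      have hε0 : 0 < ε := by positivity
      have hε1 : ε ≤ 1 / 24 := by rw [hε]; linarith
      have hvε : ∀ i, |ε * v i| ≤ 1 / 24 := fun i => by
        rw [abs_mul, abs_of_pos hε0]
        have := abs_le.2 ⟨(hv i).1, (hv i).2⟩
        nlinarith [abs_nonneg (v i)]
      have hwε : ∀ i, |ε * w i| ≤ ε := fun i => by
        rw [abs_mul, abs_of_pos hε0]
        have := abs_le.2 ⟨(hw i).1, (hw i).2⟩
        nlinarith [abs_nonneg (w i)]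
      -- base parameters
      let τ0 : Fin K → ℝ := fun i => 1 / 2 + ε * v i
      have hτ0 : ∀ i, τ0 i ∈ Set.Icc (1 / 4 : ℝ) (3 / 4) := fun i => by
        have := abs_le.1 (hvε i)
        constructor <;> simp only [τ0] <;> linarith
      have hτ0' : ∀ i, τ0 i ∈ Set.Icc (0 : ℝ) 1 := fun i =>
        ⟨by linarith [(hτ0 i).1], by linarith [(hτ0 i).2]⟩
      let μ0 : Fin K → ProbabilityMeasure ℝ := fun i =>
        ⟨mixM ν1 ν2 (τ0 i), mixM_prob ν1 ν2 (hτ0' i)⟩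
      obtain ⟨-, A, hA, hAn⟩ := exists_part hK n P pol hpol (PG : Measure ℝ)
        (fun i => (μ0 i : Measure ℝ))
      let τ1 : Fin K → ℝ := fun i => 1 / 2 + ε * v i + (if i ∈ A then ε * w i else 0)
      have hdiff : ∀ i, |τ1 i - τ0 i| ≤ if i ∈ A then ε else 0 := fun i => by
        have : τ1 i - τ0 i = if i ∈ A then ε * w i else 0 := by simp [τ1, τ0]
        rw [this]
        split_ifs
        · exact hwε i
        · simp
      have hdiff' : ∀ i, |τ1 i - τ0 i| ≤ 1 / 24 := fun i => (hdiff i).trans (by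
        split_ifs
        · exact hε1
        · norm_num)
      have hτ1' : ∀ i, τ1 i ∈ Set.Icc (0 : ℝ) 1 := fun i => by
        have h1 := abs_le.1 (hdiff' i)
        have h2 := hτ0 i
        exact ⟨by linarith [h2.1], by linarith [h2.2]⟩
      let μ1 : Fin K → ProbabilityMeasure ℝ := fun i =>
        ⟨mixM ν1 ν2 (τ1 i), mixM_prob ν1 ν2 (hτ1' i)⟩
      choose R hRm hRb hRd using fun i => density ν1 ν2 (hτ0 i) (hτ1' i)
      have hRb' : ∀ i y, |R i y - 1| ≤ 1 / 2 := fun i y =>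
        (hRb i y).trans (by linarith [hdiff' i])
      have hRl : ∀ i y, 1 / 2 ≤ R i y := fun i y => by linarith [(abs_le.1 (hRb' i y)).1]
      have hRu : ∀ i y, R i y ≤ 3 / 2 := fun i y => by linarith [(abs_le.1 (hRb' i y)).2]
      have hloge : ∀ i, -(32 * ε ^ 2 * (if i ∈ A then (1 : ℝ) else 0)) ≤
          ∫ y, Real.log (R i y) ∂(μ0 i : Measure ℝ) := fun i => by
        have h1 : ∫ y, R i y ∂(μ0 i : Measure ℝ) = 1 := by
          have := hRd i (fun _ => 1) (BM.const 1)
          have hp := mixM_prob ν1 ν2 (hτ1' i)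
          simp only [integral_const, probReal_univ, one_smul, one_mul] at this
          exact this.symm
        have h2 : 4 * |τ1 i - τ0 i| ≤ 1 / 2 := by linarith [hdiff' i]
        have h3 := log_integral (μ0 i : Measure ℝ) (R i) (hRm i) _ h2 (hRb i) h1
        refine le_trans ?_ h3
        have h4 := hdiff i
        have h5 := abs_nonneg (τ1 i - τ0 i)
        split_ifs at h4 ⊢
        · nlinarith
        · have : |τ1 i - τ0 i| = 0 := le_antisymm h4 h5
          rw [this]; norm_num
      have hell := ell_lower pol (PG : Measure ℝ) hpol R hRm hRl hRu
        (fun i => (μ0 i : Measure ℝ)) (fun i => 32 * ε ^ 2 * (if i ∈ A then (1 : ℝ) else 0))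
        hloge n
      simp only [integral_const_mul] at hell
      rw [← Finset.mul_sum] at hell
      have hell' : -(1 / 16) ≤ ∫ h, ell pol R n h ∂(Q pol PG (fun i => (μ0 i : Measure ℝ)) n) := by
        refine le_trans ?_ hell
        have h1 : 32 * ε ^ 2 * (n / P.parts.card) = 1 / 18 := by
          rw [hε, div_pow, hqsq]
          field_simp
          norm_num
        have h2 := mul_le_mul_of_nonneg_left hAn (show 0 ≤ 32 * ε ^ 2 by positivity)
        linarith
      let s : (Fin n → ℝ × ℝ) × ℝ → ℝ := fun p => T'.indicator (fun _ => 1) (polrec p.1 p.2)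
      have hsm : Measurable s := (measurable_const.indicator hT'm).comp hrec
      have hs0 : ∀ p, 0 ≤ s p := fun p => Set.indicator_nonneg (fun _ _ => zero_le_one) _
      have hs1 : ∀ p, s p ≤ 1 := fun p => Set.indicator_le_self' (fun _ _ => zero_le_one) _
      have htwo := two_point pol (PG : Measure ℝ) hpol R hRm hRl hRu
        (fun i => (μ0 i : Measure ℝ)) (fun i => (μ1 i : Measure ℝ)) hRd n hell' s hsm hs0 hs1
      have hsBM : BM s := ⟨hsm, 1, fun p => by rw [abs_of_nonneg (hs0 p)]; exact hs1 p⟩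
      have hsBM' : BM (fun p => 1 - s p) := ⟨measurable_const.sub hsm, 1, fun p => by
        rw [abs_of_nonneg (by linarith [hs1 p])]; linarith [hs0 p]⟩
      have mem0 : expectedRegret n T M pol polrec
          (fun i z => τ0 i * H1 z + (1 - τ0 i) * H2 z) μ0 PG ∈ SS :=
        ⟨τ0, μ0, hτ0', fun i y => mixM_Iic ν1 ν2 hH1n hH2n hν1 hν2 (hτ0' i) y, rfl⟩
      have mem1 : expectedRegret n T M pol polrec
          (fun i z => τ1 i * H1 z + (1 - τ1 i) * H2 z) μ1 PG ∈ SS :=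
        ⟨τ1, μ1, hτ1', fun i y => mixM_Iic ν1 ν2 hH1n hH2n hν1 hν2 (hτ1' i) y, rfl⟩
      have le0 := le_csSup hSSb mem0
      have le1 := le_csSup hSSb mem1
      have dot0 : ∀ δ ∈ M, ∑ i, δ i * τ0 i = 1 / 2 + ε * ∑ i, v i * δ i := fun δ hδ => by
        have h1 : ∑ i, δ i = 1 := (hM hδ).2
        have : ∀ i, δ i * τ0 i = δ i * (1 / 2) + ε * (v i * δ i) := fun i => by
          simp only [τ0]; ring
        simp only [this]
        rw [Finset.sum_add_distrib, ← Finset.sum_mul, h1, ← Finset.mul_sum]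
        ring
      have dot1 : ∀ δ ∈ M, ∑ i, δ i * τ1 i =
          1 / 2 + ε * ((∑ i, v i * δ i) + ∑ j ∈ A, w j * δ j) := fun δ hδ => by
        have h1 : ∑ i, δ i = 1 := (hM hδ).2
        have : ∀ i, δ i * τ1 i = δ i * (1 / 2) + ε * (v i * δ i) +
            ε * (if i ∈ A then w i * δ i else 0) := fun i => by
          simp only [τ1]; split_ifs <;> ring
        simp only [this]
        rw [Finset.sum_add_distrib, Finset.sum_add_distrib, ← Finset.sum_mul, h1,
          ← Finset.mul_sum, ← Finset.mul_sum, Finset.sum_ite_mem, Finset.univ_inter]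
        ring
      have nn0 : ∀ δ ∈ M, 0 ≤
          sSup ((fun δ => T (mix δ (fun i z => τ0 i * H1 z + (1 - τ0 i) * H2 z))) '' M)
          - T (mix δ (fun i z => τ0 i * H1 z + (1 - τ0 i) * H2 z)) := fun δ hδ => by
        have := reg_lower T H1 H2 cminus hcminus hgrow M hM τ0 hτ0' δ δ hδ hδ
        simpa using this
      have nn1 : ∀ δ ∈ M, 0 ≤
          sSup ((fun δ => T (mix δ (fun i z => τ1 i * H1 z + (1 - τ1 i) * H2 z))) '' M)
          - T (mix δ (fun i z => τ1 i * H1 z + (1 - τ1 i) * H2 z)) := fun δ hδ => by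
        have := reg_lower T H1 H2 cminus hcminus hgrow M hM τ1 hτ1' δ δ hδ hδ
        simpa using this
      have hk0 : 0 < cminus * ε := by positivity
      have cont0 : Continuous (fun δ : Fin K → ℝ => ∑ i, v i * δ i) := by fun_prop
      have cont1 : Continuous (fun δ : Fin K → ℝ => (∑ i, v i * δ i) + ∑ j ∈ A, w j * δ j) := by
        fun_prop
      have r0 : ∀ p : (Fin n → ℝ × ℝ) × ℝ, (cminus * ε * x) * s p ≤
          sSup ((fun δ => T (mix δ (fun i z => τ0 i * H1 z + (1 - τ0 i) * H2 z))) '' M)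
          - T (mix (polrec p.1 p.2) (fun i z => τ0 i * H1 z + (1 - τ0 i) * H2 z)) := by
        intro p
        by_cases hp : polrec p.1 p.2 ∈ T'
        · have hs : s p = 1 := by simp only [s]; rw [Set.indicator_of_mem hp]
          rw [hs, mul_one]
          have hl := sSup_lin (fun δ : Fin K → ℝ => ∑ i, v i * δ i) M hMne (cminus * ε) _ hk0
            (polrec p.1 p.2) (fun δ' hδ' => by
              have := reg_lower T H1 H2 cminus hcminus hgrow M hM τ0 hτ0' _ δ' (hrecM p.1 p.2) hδ'
              rw [dot0 _ (hrecM p.1 p.2), dot0 _ hδ'] at this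
              refine le_trans (le_of_eq ?_) this
              ring)
          refine le_trans (mul_le_mul_of_nonneg_left ?_ hk0.le) hl
          have hx1 := hx.le.trans (min_le_left _ _)
          have := le_csSup ((hMcomp.bddAbove_image cont0.continuousOn).mono
            (Set.image_mono hT'M.subset)) (Set.mem_image_of_mem
              (fun δ : Fin K → ℝ => ∑ i, v i * δ i) hp)
          beta_reduce at this hx1 ⊢
          linarith
        · have hs : s p = 0 := by simp only [s]; rw [Set.indicator_of_notMem hp]
          rw [hs, mul_zero]
          exact nn0 _ (hrecM _ _)
      have r1 : ∀ p : (Fin n → ℝ × ℝ) × ℝ, (cminus * ε * x) * (1 - s p) ≤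
          sSup ((fun δ => T (mix δ (fun i z => τ1 i * H1 z + (1 - τ1 i) * H2 z))) '' M)
          - T (mix (polrec p.1 p.2) (fun i z => τ1 i * H1 z + (1 - τ1 i) * H2 z)) := by
        intro p
        by_cases hp : polrec p.1 p.2 ∈ T'
        · have hs : s p = 1 := by simp only [s]; rw [Set.indicator_of_mem hp]
          rw [hs, sub_self, mul_zero]
          exact nn1 _ (hrecM _ _)
        · have hs : s p = 0 := by simp only [s]; rw [Set.indicator_of_notMem hp]
          rw [hs, sub_zero, mul_one]
          have hl := sSup_lin (fun δ : Fin K → ℝ => (∑ i, v i * δ i) + ∑ j ∈ A, w j * δ j)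
            M hMne (cminus * ε) _ hk0
            (polrec p.1 p.2) (fun δ' hδ' => by
              have := reg_lower T H1 H2 cminus hcminus hgrow M hM τ1 hτ1' _ δ' (hrecM p.1 p.2) hδ'
              rw [dot1 _ (hrecM p.1 p.2), dot1 _ hδ'] at this
              refine le_trans (le_of_eq ?_) this
              ring)
          refine le_trans (mul_le_mul_of_nonneg_left ?_ hk0.le) hl
          have hx1 := (hx.le.trans (min_le_right _ _)).trans (csInf_le
            ((P.parts.finite_toSet.image _).bddBelow) (Set.mem_image_of_mem _
              (Finset.mem_coe.2 hA)))
          have := le_csSup ((hMcomp.bddAbove_image cont1.continuousOn).mono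
            (Set.image_mono (Set.sdiff_subset (t := T')))) (Set.mem_image_of_mem
              (fun δ : Fin K → ℝ => (∑ i, v i * δ i) + ∑ j ∈ A, w j * δ j)
              (show polrec p.1 p.2 ∈ M \ T' from ⟨hrecM _ _, hp⟩))
          beta_reduce at this hx1 ⊢
          linarith
      rcases le_total x 0 with hx0 | hx0
      · have h := expReg_lower T H1 H2 cminus hcminus hgrow n M hM τ0 hτ0' pol hpol polrec hrec
          hrecM PG μ0 s hsBM 0 (fun p => by rw [zero_mul]; exact nn0 _ (hrecM _ _))
        rw [zero_mul] at h
        have : cminus / 120 * q * x ≤ 0 :=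
          mul_nonpos_of_nonneg_of_nonpos (by positivity) hx0
        linarith
      · have h0 := expReg_lower T H1 H2 cminus hcminus hgrow n M hM τ0 hτ0' pol hpol polrec hrec
          hrecM PG μ0 s hsBM _ r0
        have h1 := expReg_lower T H1 H2 cminus hcminus hgrow n M hM τ1 hτ1' pol hpol polrec hrec
          hrecM PG μ1 _ hsBM' _ r1
        have h2 := mul_le_mul_of_nonneg_left htwo (mul_nonneg hk0.le hx0)
        rw [mul_add] at h2
        have h3 : cminus / 120 * q * x = (cminus * ε * x * (2 / 5)) / 2 := by
          rw [hε]; ring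
        rw [h3]
        linarith
  have := (le_div_iff₀ (by positivity)).1 hk
  calc cminus / 120 * kappaPart P M * q = kappaPart P M * (cminus / 120 * q) := by ring
    _ ≤ _ := this

end TRDT
end
end

section
/- Let K ≥ 2 and let M_K ⊆ S_K be closed with at least two elements. Then 4 · κ({{1,…,K}}, M_K) ≥ diam²(M_K), where κ({{1,…,K}}, M_K) is the quantity κ(H, M_K) for the trivial one-block partition H = {{1,…,K}} and diam(M_K) := max{‖ν−γ‖ : ν,γ ∈ M_K} in the Euclidean norm. -/
open MeasureTheory Set

noncomputable section

namespace TRDT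

/-- The quantity `κ({{1,…,K}}, M_K)` for the trivial one-block partition:
the supremum over all nonempty Borel `T ⊊ M`, all `v ∈ [-1,1]^K` and all `w ∈ [-1,1]^K` of
`min( max_{δ∈M} v'δ - sup_{δ∈T} v'δ , max_{δ∈M} (v+w)'δ - sup_{δ∈M∖T} (v+w)'δ )`. -/
def kappaOneBlock {K : ℕ} (M : Set (Fin K → ℝ)) : ℝ :=
  sSup {x : ℝ | ∃ (T : Set (Fin K → ℝ)) (v w : Fin K → ℝ),
    T.Nonempty ∧ T ⊂ M ∧ MeasurableSet T ∧
    (∀ i, v i ∈ Set.Icc (-1 : ℝ) 1) ∧ (∀ i, w i ∈ Set.Icc (-1 : ℝ) 1) ∧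
    x = min
      (sSup ((fun δ => ∑ i, v i * δ i) '' M) - sSup ((fun δ => ∑ i, v i * δ i) '' T))
      (sSup ((fun δ => ∑ i, (v i + w i) * δ i) '' M)
        - sSup ((fun δ => ∑ i, (v i + w i) * δ i) '' (M \ T)))}

/-- The squared (Euclidean) diameter `diam²(M_K) = max{‖ν-γ‖² : ν,γ ∈ M_K}`. -/
def diamSq {K : ℕ} (M : Set (Fin K → ℝ)) : ℝ :=
  sSup {x : ℝ | ∃ ν ∈ M, ∃ γ ∈ M, x = ∑ i, (ν i - γ i) ^ 2}

lemma abs_dot_le {K : ℕ} {v δ : Fin K → ℝ} (hv : ∀ i, v i ∈ Set.Icc (-1 : ℝ) 1)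
    (hδ : δ ∈ stdSimplex ℝ (Fin K)) : |∑ i, v i * δ i| ≤ 1 := by
  rw [← hδ.2]
  refine (Finset.abs_sum_le_sum_abs _ _).trans (Finset.sum_le_sum fun i _ => ?_)
  rw [abs_mul, abs_of_nonneg (hδ.1 i)]
  have h1 : |v i| ≤ 1 := abs_le.2 (hv i)
  have := mul_le_mul_of_nonneg_right h1 (hδ.1 i)
  linarith

lemma bddAbove_img {K : ℕ} {v : Fin K → ℝ} {M : Set (Fin K → ℝ)}
    (hv : ∀ i, v i ∈ Set.Icc (-1 : ℝ) 1) (hM : M ⊆ stdSimplex ℝ (Fin K)) :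
    BddAbove ((fun δ => ∑ i, v i * δ i) '' M) := by
  refine ⟨1, ?_⟩
  rintro _ ⟨δ, hδ, rfl⟩
  exact (abs_le.1 (abs_dot_le hv (hM hδ))).2

lemma pair_le {K : ℕ} {M : Set (Fin K → ℝ)}
    (hMsub : M ⊆ stdSimplex ℝ (Fin K)) (hMclosed : IsClosed M) {ν γ : Fin K → ℝ}
    (hν : ν ∈ M) (hγ : γ ∈ M) (hne : ν ≠ γ) :
    ∑ i, (ν i - γ i) ^ 2 ≤ 4 * kappaOneBlock M := by
  have hle1 : ∀ δ ∈ M, ∀ i, 0 ≤ δ i ∧ δ i ≤ 1 := fun δ hδ i =>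
    ⟨(hMsub hδ).1 i, by
      rw [← (hMsub hδ).2]
      exact Finset.single_le_sum (fun j _ => (hMsub hδ).1 j) (Finset.mem_univ i)⟩
  have hd : ∀ i, -1 ≤ ν i - γ i ∧ ν i - γ i ≤ 1 := fun i => by
    have a := hle1 ν hν i
    have b := hle1 γ hγ i
    constructor <;> linarith
  set D := ∑ i, (ν i - γ i) ^ 2 with hD
  have hDpos : 0 < D := by
    obtain ⟨i, hi⟩ := Function.ne_iff.1 hne
    refine Finset.sum_pos' (fun j _ => sq_nonneg _) ⟨i, Finset.mem_univ i, ?_⟩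
    have : ν i - γ i ≠ 0 := sub_ne_zero.2 hi
    positivity
  set v : Fin K → ℝ := fun i => (ν i - γ i) / 2 with hvdef
  set w : Fin K → ℝ := fun i => -(ν i - γ i) with hwdef
  have hv : ∀ i, v i ∈ Set.Icc (-1 : ℝ) 1 := fun i => by
    have := hd i
    constructor <;> simp only [hvdef] <;> linarith
  have hw : ∀ i, w i ∈ Set.Icc (-1 : ℝ) 1 := fun i => by
    have := hd i
    constructor <;> simp only [hwdef] <;> linarith
  have hvw : ∀ i, (fun i => v i + w i) i ∈ Set.Icc (-1 : ℝ) 1 := fun i => by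
    have := hd i
    constructor <;> simp only [hwdef, hvdef] <;> linarith
  have hneg : ∀ δ : Fin K → ℝ, ∑ i, (v i + w i) * δ i = - ∑ i, v i * δ i := fun δ => by
    rw [← Finset.sum_neg_distrib]
    refine Finset.sum_congr rfl fun i _ => ?_
    simp only [hwdef, hvdef]; ring
  have hdiff : ∑ i, v i * ν i - ∑ i, v i * γ i = D / 2 := by
    rw [hD, ← Finset.sum_sub_distrib, Finset.sum_div]
    refine Finset.sum_congr rfl fun i _ => ?_
    simp only [hvdef]; ring
  set c := (∑ i, v i * ν i + ∑ i, v i * γ i) / 2 with hc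
  set T : Set (Fin K → ℝ) := M ∩ {δ | ∑ i, v i * δ i ≤ c} with hT
  have hγT : γ ∈ T := ⟨hγ, by simp only [mem_setOf_eq]; linarith⟩
  have hνT : ν ∉ T := fun h => by
    have := h.2
    simp only [mem_setOf_eq] at this
    linarith
  have hcl : IsClosed T := hMclosed.inter (isClosed_le (by fun_prop) (by fun_prop))
  have key : D / 4 ≤ kappaOneBlock M := by
    have hbdd : BddAbove {x : ℝ | ∃ (T : Set (Fin K → ℝ)) (v w : Fin K → ℝ),
        T.Nonempty ∧ T ⊂ M ∧ MeasurableSet T ∧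
        (∀ i, v i ∈ Set.Icc (-1 : ℝ) 1) ∧ (∀ i, w i ∈ Set.Icc (-1 : ℝ) 1) ∧
        x = min
          (sSup ((fun δ => ∑ i, v i * δ i) '' M) - sSup ((fun δ => ∑ i, v i * δ i) '' T))
          (sSup ((fun δ => ∑ i, (v i + w i) * δ i) '' M)
            - sSup ((fun δ => ∑ i, (v i + w i) * δ i) '' (M \ T)))} := by
      refine ⟨2, ?_⟩
      rintro x ⟨T, v, w, ⟨t, ht⟩, hTM, -, hv, hw, rfl⟩
      refine (min_le_left _ _).trans ?_
      have h1 : sSup ((fun δ => ∑ i, v i * δ i) '' M) ≤ 1 := by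
        refine csSup_le (Set.Nonempty.image _ ⟨t, hTM.1 ht⟩) ?_
        rintro _ ⟨δ, hδ, rfl⟩
        exact (abs_le.1 (abs_dot_le hv (hMsub hδ))).2
      have h2 : ∑ i, v i * t i ≤ sSup ((fun δ => ∑ i, v i * δ i) '' T) :=
        le_csSup (bddAbove_img hv (hTM.1.trans hMsub)) ⟨t, ht, rfl⟩
      have h3 := (abs_le.1 (abs_dot_le hv (hMsub (hTM.1 ht)))).1
      linarith
    refine le_trans ?_ (le_csSup hbdd ⟨T, v, w, ⟨γ, hγT⟩, ⟨inter_subset_left, fun h => hνT (h hν)⟩,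
      hcl.measurableSet, hv, hw, rfl⟩)
    refine le_min ?_ ?_
    · have h1 : ∑ i, v i * ν i ≤ sSup ((fun δ => ∑ i, v i * δ i) '' M) :=
        le_csSup (bddAbove_img hv hMsub) ⟨ν, hν, rfl⟩
      have h2 : sSup ((fun δ => ∑ i, v i * δ i) '' T) ≤ c := by
        refine csSup_le (Set.Nonempty.image _ ⟨γ, hγT⟩) ?_
        rintro _ ⟨δ, hδ, rfl⟩
        exact hδ.2
      linarith
    · have h1 : ∑ i, (v i + w i) * γ i ≤ sSup ((fun δ => ∑ i, (v i + w i) * δ i) '' M) :=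
        le_csSup (bddAbove_img hvw hMsub) ⟨γ, hγ, rfl⟩
      have h2 : sSup ((fun δ => ∑ i, (v i + w i) * δ i) '' (M \ T)) ≤ -c := by
        refine csSup_le (Set.Nonempty.image _ ⟨ν, hν, hνT⟩) ?_
        rintro _ ⟨δ, hδ, rfl⟩
        have : c < ∑ i, v i * δ i := by
          by_contra h
          exact hδ.2 ⟨hδ.1, not_lt.1 h⟩
        have h3 := hneg δ
        simp only
        linarith
      have h3 := hneg γ
      linarith
  linarith

/-- Lemma B.1 of the paper: for closed `M_K ⊆ S_K` with at least two elements,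
`4 · κ({{1,…,K}}, M_K) ≥ diam²(M_K)`. -/
theorem four_mul_kappaOneBlock_ge_diamSq
    (K : ℕ) (hK : 2 ≤ K) (M : Set (Fin K → ℝ))
    (hMsub : M ⊆ stdSimplex ℝ (Fin K)) (hMclosed : IsClosed M) (hM2 : M.Nontrivial) :
    diamSq M ≤ 4 * kappaOneBlock M := by
  obtain ⟨a, ha, b, hb, hab⟩ := hM2
  refine csSup_le ⟨_, a, ha, b, hb, rfl⟩ ?_
  rintro x ⟨ν, hν, γ, hγ, rfl⟩
  by_cases h : ν = γ
  · subst h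
    have := pair_le hMsub hMclosed ha hb hab
    have h0 : (0 : ℝ) ≤ ∑ i, (a i - b i) ^ 2 := Finset.sum_nonneg fun i _ => sq_nonneg _
    simp only [sub_self, ne_eq, OfNat.ofNat_ne_zero, not_false_eq_true, zero_pow,
      Finset.sum_const_zero]
    linarith
  · exact pair_le hMsub hMclosed hν hγ h

end TRDT
end
end

section
/- Let K ≥ 2 and let M_K ⊆ S_K be closed with at least two elements. If there exists an index j ∈ {1,…,K} such that max_{δ∈M_K} δ_j = min_{δ∈M_K} δ_j (i.e., the j-th coordinate is constant on M_K), then κ(M_K) = 0. -/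
open MeasureTheory Set

noncomputable section

namespace TRDT

/-- The quantity `κ(M_K)` from the paper. -/
def kappa {K : ℕ} (M : Set (Fin K → ℝ)) : ℝ :=
  sSup {x : ℝ | ∃ (T : Set (Fin K → ℝ)) (v w : Fin K → ℝ),
    T.Nonempty ∧ T ⊂ M ∧ MeasurableSet T ∧
    (∀ i, v i ∈ Set.Icc (-1 : ℝ) 1) ∧ (∀ i, w i ∈ Set.Icc (-1 : ℝ) 1) ∧
    x = min
      (sSup ((fun δ => ∑ i, v i * δ i) '' M) - sSup ((fun δ => ∑ i, v i * δ i) '' T))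
      (⨅ i : Fin K,
        (sSup ((fun δ => (∑ j, v j * δ j) + w i * δ i) '' M)
          - sSup ((fun δ => (∑ j, v j * δ j) + w i * δ i) '' (M \ T))))}

theorem aux_le {α : Type*} (f : α → ℝ) (M A : Set α) (d : α) (hA : A ⊆ M) (hd : d ∈ A)
    (hmax : ∀ x ∈ M, f x ≤ f d) : sSup (f '' M) - sSup (f '' A) ≤ 0 := by
  have h1 : sSup (f '' M) ≤ f d := by
    refine csSup_le (Set.Nonempty.image f ⟨d, hA hd⟩) ?_
    rintro _ ⟨x, hx, rfl⟩
    exact hmax x hx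
  have h2 : f d ≤ sSup (f '' A) := by
    refine le_csSup ?_ (Set.mem_image_of_mem f hd)
    refine ⟨f d, ?_⟩
    rintro _ ⟨x, hx, rfl⟩
    exact hmax x (hA hx)
  linarith

/-- Footnote 7 of the paper: if for some treatment `j` the weight `δ_j` is constant on
`M_K` (i.e. `max_{δ∈M_K} δ_j = min_{δ∈M_K} δ_j`), then `κ(M_K) = 0`. -/
theorem kappa_eq_zero_of_constant_coordinate
    (K : ℕ) (hK : 2 ≤ K) (M : Set (Fin K → ℝ))
    (hMsub : M ⊆ stdSimplex ℝ (Fin K)) (hMclosed : IsClosed M) (hM2 : M.Nontrivial)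
    (hconst : ∃ j : Fin K, ∀ δ ∈ M, ∀ δ' ∈ M, δ j = δ' j) :
    kappa M = 0 := by
  obtain ⟨j, hj⟩ := hconst
  have hcomp : IsCompact M := (isCompact_stdSimplex ℝ (Fin K)).of_isClosed_subset hMclosed hMsub
  unfold kappa
  apply IsGreatest.csSup_eq
  constructor
  · obtain ⟨a, ha, b, hb, hab⟩ := hM2
    have : Nonempty (Fin K) := ⟨j⟩
    have hMn : M.Nonempty := ⟨a, ha⟩
    have hbn : (M \ {a}).Nonempty := ⟨b, hb, fun h => hab (by simpa using h.symm)⟩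
    refine ⟨{a}, 0, 0, singleton_nonempty a, ?_, measurableSet_singleton a, ?_, ?_, ?_⟩
    · exact ⟨by simpa using ha, fun h => hab (by simpa using (h hb).symm)⟩
    · intro i; simp
    · intro i; simp
    · simp [hMn.image_const, hbn.image_const]
  · rintro x ⟨T, v, w, hTn, hTM, -, -, -, rfl⟩
    obtain ⟨d, hd, hmax⟩ := hcomp.exists_isMaxOn hM2.nonempty
      (f := fun δ : Fin K → ℝ => ∑ i, v i * δ i) (by fun_prop)
    have hmax' : ∀ x ∈ M, ∑ i, v i * x i ≤ ∑ i, v i * d i := fun x hx => hmax hx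
    by_cases hdT : d ∈ T
    · exact (min_le_left _ _).trans (aux_le _ M T d hTM.1 hdT hmax')
    · have key := aux_le (fun δ : Fin K → ℝ => (∑ i, v i * δ i) + w j * δ j) M (M \ T) d
        (fun _ h => h.1) ⟨hd, hdT⟩ (by
          intro x hx
          have h1 := hmax' x hx
          have h2 := hj x hx d hd
          show (∑ i, v i * x i) + w j * x j ≤ (∑ i, v i * d i) + w j * d j
          rw [h2]
          linarith)
      exact (min_le_right _ _).trans (ciInf_le_of_le (finite_range _).bddBelow j key)

end TRDT
end
end

section
/- Let a<b be real numbers, let T: D_cdf([a,b]) → ℝ and a nonempty convex D ⊆ D_cdf([a,b]) satisfy the Lipschitz assumption with constant C>0 and the measurability assumption, and let M_K ⊆ S_K be closed with at least two elements. Consider the static assignment policy π̂ with a given partition Π_n = (Π_{n,1},…,Π_{n,K}) of {1,…,n} into K nonempty blocks and finite nonempty discretization M_K^n ⊆ M_K, which assigns subject t to treatment j if t ∈ Π_{n,j}, forms the empirical cdfs F̂^j_{n,Π_n}(·) := |Π_{n,j}|^{-1} Σ_{t∈Π_{n,j}} 1{Y_{j,t} ≤ ·}, and recommends the lexicographic minimum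 of argmax_{δ∈M_K^n} T(⟨δ, F̂_{n,Π_n}⟩). Then, with β_n := min_{j=1,…,K} |Π_{n,j}| and ε(n) := sup_{F∈D×…×D} | max_{δ∈M_K} T(⟨δ,F⟩) − max_{δ∈M_K^n} T(⟨δ,F⟩) |, it holds for every n ≥ K that sup over all F¹,…,F^K ∈ D (under i.i.d. sampling of the potential outcome vectors) of E[r_n(π̂, M_K)] ≤ ε(n) + 3.01 · C · √( log(K) / β_n ). -/
open MeasureTheory Set

noncomputable section

namespace TRDT

/-- Assumption 5 of the paper: for every `m` and every `δ` in the standard simplex,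
`x ↦ T(∑_j δ_j 1{x_j ≤ ·})` is Borel measurable on `[a,b]^m`. -/
def MeasurabilityAssumption (a b : ℝ) (T : (ℝ → ℝ) → ℝ) : Prop :=
  ∀ (m : ℕ) (δ : Fin m → ℝ), δ ∈ stdSimplex ℝ (Fin m) →
    Measurable fun x : Fin m → Set.Icc a b =>
      T fun z => ∑ j, δ j * (if (x j : ℝ) ≤ z then (1 : ℝ) else 0)

/-- The lexicographic minimum of the set of maximizers of `f` over the finite set `S`
(used as the empirical-success recommendation rule; ties are broken lexicographically). -/
def lexMinArgmax {K : ℕ} (S : Finset (Fin K → ℝ)) (f : (Fin K → ℝ) → ℝ) : Fin K → ℝ := by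
  classical
  haveI : WellFoundedLT (Fin K) := inferInstance
  exact if h : (S.filter fun δ => ∀ γ ∈ S, f γ ≤ f δ).Nonempty
    then ofLex (((S.filter fun δ => ∀ γ ∈ S, f γ ≤ f δ).image toLex).min' (h.image _))
    else fun _ => 0

/-- The empirical cdfs `F̂^j_{n,Π_n}` produced by a static assignment with partition `Π`
from the outcome array `ω` (`ω t j` = potential outcome of subject `t` under `j`). -/
def empCdfPartition {K n : ℕ} (Pi : Fin K → Finset (Fin n)) (ω : Fin n → Fin K → ℝ) :
    Fin K → ℝ → ℝ :=
  fun j z => (∑ t ∈ Pi j, if ω t j ≤ z then (1 : ℝ) else 0) / (Pi j).card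

/-- The worst-case optimization error `ε(n)` of the discretization `Mn` of `M`. -/
def epsOpt {K : ℕ} (T : (ℝ → ℝ) → ℝ) (D : Set (ℝ → ℝ)) (M : Set (Fin K → ℝ))
    (Mn : Finset (Fin K → ℝ)) : ℝ :=
  sSup {x : ℝ | ∃ G : Fin K → ℝ → ℝ, (∀ i, G i ∈ D) ∧
    x = |sSup ((fun δ => T (mix δ G)) '' M)
          - sSup ((fun δ => T (mix δ G)) '' (Mn : Set (Fin K → ℝ)))|}

section Aux

open ProbabilityTheory
open scoped ENNReal

lemma logphi (l : ℝ) (h0 : 0 < l) (h1 : l < 1) :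
    31/20 * l^2 ≤ Real.log (1+l) - Real.log (1-l) - Real.log (1+2*l) := by
  have hm : MonotoneOn (fun x : ℝ => Real.log (1+x) - Real.log (1-x) - Real.log (1+2*x) - 31/20*x^2) (Set.Ico 0 1) := by
    have hd : ∀ x ∈ Set.Ico (0:ℝ) 1, HasDerivAt (fun x : ℝ => Real.log (1+x) - Real.log (1-x) - Real.log (1+2*x) - 31/20*x^2)
        (1/(1+x) - (-1)/(1-x) - (2*1)/(1+2*x) - 31/20*(2*x)) x := by
      intro x hx
      obtain ⟨hx0, hx1⟩ := hx
      have e1 := ((hasDerivAt_id x).const_add 1).log (by simp; linarith)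
      have e2 := ((hasDerivAt_id x).const_sub 1).log (by simp; linarith)
      have e3 := (((hasDerivAt_id x).const_mul 2).const_add 1).log (by simp; linarith)
      have e4 := ((hasDerivAt_id x).pow 2).const_mul (31/20:ℝ)
      have := ((e1.sub e2).sub e3).sub e4
      convert! this using 1
      simp
    apply monotoneOn_of_deriv_nonneg (convex_Ico 0 1)
    · intro x hx; exact (hd x hx).continuousAt.continuousWithinAt
    · intro x hx; rw [interior_Ico] at hx
      exact (hd x ⟨hx.1.le, hx.2⟩).differentiableAt.differentiableWithinAt
    · intro x hx; rw [interior_Ico] at hx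
      obtain ⟨hx0, hx1⟩ := hx
      rw [(hd x ⟨hx0.le, hx1⟩).deriv]
      have p1 : 0 < 1 - x := by linarith
      have p2 : 0 < 1 + x := by linarith
      have p3 : 0 < 1 + 2*x := by linarith
      have : (1/(1+x) - (-1)/(1-x) - (2*1)/(1+2*x) - 31/20*(2*x)) = 2*x*(9/20-21/10*x+31/20*x^2+31/10*x^3)/((1+x)*(1-x)*(1+2*x)) := by
        field_simp; ring
      rw [this]
      have : 0 ≤ 9/20-21/10*x+31/20*x^2+31/10*x^3 := by
        nlinarith [mul_nonneg hx0.le (sq_nonneg (x - 7/20)), sq_nonneg (x-7/20)]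
      positivity
  have := hm (by simp : (0:ℝ) ∈ Set.Ico (0:ℝ) 1) ⟨h0.le, h1⟩ h0.le
  simp at this
  linarith

lemma logmono (l w : ℝ) (h0 : 0 < l) (h1 : l < w) (hw : w ≤ 1) :
    Real.log (1+l) - Real.log (1-l) ≤ w * (Real.log (1+l/w) - Real.log (1-l/w)) := by
  have hw0 : 0 < w := h0.trans h1
  have a1 := Real.hasSum_log_sub_log_of_abs_lt_one (x := l) (by rw [abs_of_pos h0]; linarith)
  have a2 := (Real.hasSum_log_sub_log_of_abs_lt_one (x := l/w) (by rw [abs_of_pos (by positivity)]; rw [div_lt_one hw0]; exact h1)).mul_left w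
  refine hasSum_le (fun k => ?_) a1 a2
  have : w * (2 * (1 / (2 * (k:ℝ) + 1)) * (l / w) ^ (2 * k + 1)) = 2 * (1 / (2 * (k:ℝ) + 1)) * (l ^ (2*k+1) / w^(2*k)) := by
    rw [div_pow]; field_simp; ring
  rw [this]
  have : l ^ (2*k+1) ≤ l ^ (2*k+1) / w^(2*k) := by
    rw [le_div_iff₀ (by positivity)]
    exact mul_le_of_le_one_right (by positivity) (pow_le_one₀ hw0.le hw)
  gcongr

/-- pointwise bound on the likelihood ratio -/
lemma hbound (l y : ℝ) (h0 : 0 < l) (hy : 0 < y) (hyl : y + l ≤ 1) :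
    31/20 * l^2 ≤ - Real.log (1+2*l) + (y+l) * Real.log (1+2*l/y) := by
  have h2 := logmono l (y+l) h0 (by linarith) hyl
  have h1 := logphi l h0 (by linarith)
  have : Real.log (1+l/(y+l)) - Real.log (1-l/(y+l)) = Real.log (1+2*l/y) := by
    have hp : 0 < y + l := by linarith
    rw [← Real.log_div]
    · congr 1
      have h3 : 1 - l/(y+l) = y/(y+l) := by field_simp; ring
      rw [h3]; field_simp; ring
    · positivity
    · have : 1 - l/(y+l) = y/(y+l) := by field_simp; ring
      rw [this]; positivity
  rw [this] at h2
  linarith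

lemma pi_withDensity {ι E : Type*} [Fintype ι] [MeasurableSpace E] (μ : Measure E)
    [IsProbabilityMeasure μ] (f : ι → E → ℝ≥0∞) (hf : ∀ i, Measurable (f i))
    [∀ i, IsProbabilityMeasure (μ.withDensity (f i))] :
    Measure.pi (fun i => μ.withDensity (f i)) =
      (Measure.pi fun _ : ι => μ).withDensity (fun ω => ∏ i, f i (ω i)) := by
  refine Measure.pi_eq fun S hS => ?_
  rw [withDensity_apply _ (MeasurableSet.univ_pi hS), ← lintegral_indicator (MeasurableSet.univ_pi hS)]
  have : ∀ ω : ι → E, (Set.univ.pi S).indicator (fun ω => ∏ i, f i (ω i)) ω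
      = ∏ i, (S i).indicator (f i) (ω i) := by
    intro ω
    by_cases h : ω ∈ Set.univ.pi S
    · rw [indicator_of_mem h]
      exact Finset.prod_congr rfl fun i _ => (indicator_of_mem (h i (mem_univ i)) _).symm
    · rw [indicator_of_notMem h]
      simp only [Set.mem_pi, mem_univ, true_imp_iff, not_forall] at h
      obtain ⟨i, hi⟩ := h
      exact (Finset.prod_eq_zero (Finset.mem_univ i) (indicator_of_notMem hi _)).symm
  simp_rw [this]
  have hm : ∀ i, Measurable ((S i).indicator (f i)) := fun i => (hf i).indicator (hS i)
  rw [lintegral_prod_eq_prod_lintegral_of_indepFun Finset.univ (fun i (ω : ι → E) => (S i).indicator (f i) (ω i))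
    (iIndepFun_pi (fun i => (hm i).aemeasurable)) (fun i => (hm i).comp (measurable_pi_apply i))]
  refine Finset.prod_congr rfl fun i _ => ?_
  rw [(measurePreserving_eval (fun _ : ι => μ) i).lintegral_comp (hm i),
    lintegral_indicator (hS i), withDensity_apply _ (hS i)]

/-- the tilted density -/
noncomputable def dens {E : Type*} (B : Set E) (F l : ℝ) (y : E) : ℝ≥0∞ :=
  open Classical in
  if y ∈ B then ENNReal.ofReal (1/(1+2*l)) else ENNReal.ofReal ((1+2*l/(1-F))/(1+2*l))

lemma dens_meas {E : Type*} [MeasurableSpace E] {B : Set E} (hB : MeasurableSet B) (F l : ℝ) :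
    Measurable (dens B F l) := by
  unfold dens
  exact Measurable.ite hB measurable_const measurable_const

lemma dens_prob {E : Type*} [MeasurableSpace E] (μ : Measure E) [IsProbabilityMeasure μ]
    {B : Set E} (hB : MeasurableSet B) (l : ℝ) (hl : 0 < l) (h1 : μ.real B < 1) :
    IsProbabilityMeasure (μ.withDensity (dens B (μ.real B) l)) := by
  constructor
  rw [withDensity_apply _ MeasurableSet.univ, Measure.restrict_univ, ← lintegral_add_compl _ hB]
  have e1 : ∫⁻ y in B, dens B (μ.real B) l y ∂μ = ENNReal.ofReal (1/(1+2*l)) * μ B := by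
    rw [← setLIntegral_const]
    exact setLIntegral_congr_fun hB fun y hy => by simp [dens, hy]
  have e2 : ∫⁻ y in Bᶜ, dens B (μ.real B) l y ∂μ
      = ENNReal.ofReal ((1+2*l/(1-μ.real B))/(1+2*l)) * μ Bᶜ := by
    rw [← setLIntegral_const]
    refine setLIntegral_congr_fun hB.compl fun y hy => ?_
    have : y ∉ B := hy
    simp [dens, this]
  have hc : μ.real Bᶜ = 1 - μ.real B := probReal_compl_eq_one_sub hB
  have h3 : 0 < 1 - μ.real B := by linarith
  have h4 : 0 ≤ μ.real B := measureReal_nonneg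
  rw [e1, e2, ← ofReal_measureReal, ← ofReal_measureReal, hc, ← ENNReal.ofReal_mul (by positivity),
    ← ENNReal.ofReal_mul (by positivity), ← ENNReal.ofReal_add (by positivity) (by positivity)]
  rw [← ENNReal.ofReal_one]
  congr 1
  field_simp
  ring

/-- the one-coordinate consistency of the tilted laws -/
lemma dens_consistent {E X : Type*} [MeasurableSpace E] [MeasurableSpace X] (μ : Measure E)
    [IsProbabilityMeasure μ] {B B' : Set E} (hB : MeasurableSet B) (hB' : MeasurableSet B')
    (hBB : B ⊆ B') (l : ℝ) (hl : 0 < l) (h1 : μ.real B < 1) (h1' : μ.real B' < 1)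
    (φ : E → X) (hφ : Measurable φ) (c : X) (hc : ∀ y, y ∉ B → φ y = c) :
    (μ.withDensity (dens B (μ.real B) l)).map φ = (μ.withDensity (dens B' (μ.real B') l)).map φ := by
  have := dens_prob μ hB l hl h1
  have := dens_prob μ hB' l hl h1'
  set m1 := μ.withDensity (dens B (μ.real B) l) with hm1
  set m2 := μ.withDensity (dens B' (μ.real B') l) with hm2
  have key : ∀ U, MeasurableSet U → U ⊆ B → m1 U = m2 U := by
    intro U hU hUB
    rw [hm1, hm2, withDensity_apply _ hU, withDensity_apply _ hU]
    refine setLIntegral_congr_fun hU fun y hy => ?_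
    simp [dens, hUB hy, hBB (hUB hy)]
  have keyc : m1 Bᶜ = m2 Bᶜ := by
    rw [prob_compl_eq_one_sub hB, prob_compl_eq_one_sub hB, key B hB subset_rfl]
  ext S hS
  rw [Measure.map_apply hφ hS, Measure.map_apply hφ hS]
  have hU : MeasurableSet (φ ⁻¹' S) := hφ hS
  rw [← measure_inter_add_sdiff _ hB, ← measure_inter_add_sdiff (μ := m2) _ hB,
    key _ (hU.inter hB) inter_subset_right]
  congr 1
  by_cases hcS : c ∈ S
  · have : φ ⁻¹' S \ B = Bᶜ := by
      ext y; constructor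
      · exact fun h => h.2
      · intro h; exact ⟨by simpa [hc y h] using hcS, h⟩
    rw [this, keyc]
  · have : φ ⁻¹' S \ B = ∅ := by
      ext y
      simp only [mem_sdiff, mem_preimage, mem_empty_iff_false, iff_false, not_and, not_not]
      intro h; by_contra h'; exact hcS (hc y h' ▸ h)
    simp [this]

noncomputable def frac {ι E : Type*} (s : Finset ι) (B : Set E) (ω : ι → E) : ℝ :=
  (∑ t ∈ s, B.indicator (fun _ => (1:ℝ)) (ω t)) / s.card

lemma frac_meas {ι E : Type*} [MeasurableSpace E] (s : Finset ι) {B : Set E}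
    (hB : MeasurableSet B) : Measurable (frac s B) := by
  unfold frac
  refine Measurable.div_const (Finset.measurable_sum _ fun t _ => ?_) _
  exact (measurable_const.indicator hB).comp (measurable_pi_apply t)

/-- lower bound on the likelihood ratio at a hit -/
lemma dens_prod_ge {ι E : Type*} [Fintype ι] (s : Finset ι) (hs : s.Nonempty)
    (B : Set E) (F l : ℝ) (hl : 0 < l) (hF1 : F < 1) (ω : ι → E) (hit : frac s B ω ≤ F - l) :
    ENNReal.ofReal (Real.exp (31/20 * s.card * l^2)) ≤ ∏ t ∈ s, dens B F l (ω t) := by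
  classical
  have hm : (0:ℝ) < s.card := by exact_mod_cast hs.card_pos
  set y := 1 - F with hy
  have hy0 : 0 < y := by linarith
  set A := ∑ t ∈ s, B.indicator (fun _ => (1:ℝ)) (ω t) with hA
  have hA0 : 0 ≤ A := Finset.sum_nonneg fun t _ => indicator_nonneg (fun _ _ => zero_le_one) _
  have hfr : frac s B ω = A / s.card := rfl
  have h0 : 0 ≤ frac s B ω := by rw [hfr]; positivity
  have hb := hbound l y hl hy0 (by linarith)
  have hd : ∀ t, dens B F l (ω t) = ENNReal.ofReal (Real.exp (- Real.log (1+2*l)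
      + (1 - B.indicator (fun _ => (1:ℝ)) (ω t)) * Real.log (1+2*l/y))) := by
    intro t
    by_cases h : ω t ∈ B
    · simp only [dens, h, if_true, indicator_of_mem]
      rw [sub_self, zero_mul, add_zero, Real.exp_neg, Real.exp_log (by positivity), one_div]
    · simp only [dens, h, if_false, indicator_of_notMem, not_false_eq_true]
      rw [sub_zero, one_mul, Real.exp_add, Real.exp_neg, Real.exp_log (by positivity),
        Real.exp_log (by positivity), div_eq_mul_inv, mul_comm]
  simp_rw [hd]
  rw [← ENNReal.ofReal_prod_of_nonneg (fun t _ => (Real.exp_pos _).le), ← Real.exp_sum]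
  apply ENNReal.ofReal_le_ofReal
  apply Real.exp_le_exp.2
  rw [Finset.sum_add_distrib, ← Finset.sum_mul, Finset.sum_sub_distrib, ← hA]
  simp only [Finset.sum_const, nsmul_eq_mul, mul_one]
  have hlog : 0 ≤ Real.log (1+2*l/y) := Real.log_nonneg (by
    have : 0 ≤ 2*l/y := by positivity
    linarith)
  have hA2 : s.card * (y + l) ≤ s.card - A := by
    rw [hfr, div_le_iff₀ hm] at hit
    nlinarith
  have := mul_le_mul_of_nonneg_right hA2 hlog
  have := mul_le_mul_of_nonneg_left hb hm.le
  nlinarith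

lemma chain_core {ι E : Type*} [Fintype ι] [MeasurableSpace E] (μ : Measure E)
    [IsProbabilityMeasure μ] (B : ℚ → Set E) (hB : ∀ q, MeasurableSet (B q)) (hBm : Monotone B)
    (s : Finset ι) (hs : s.Nonempty) (l : ℝ) (hl : 0 < l) (G : Finset ℚ)
    (hG : ∀ q ∈ G, μ.real (B q) < 1) :
    (Measure.pi fun _ : ι => μ) {ω | ∃ q ∈ G, frac s (B q) ω ≤ μ.real (B q) - l}
      ≤ ENNReal.ofReal (Real.exp (-(31/20 * s.card * l^2))) := by
  classical
  rcases G.eq_empty_or_nonempty with rfl | hGne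
  · simp
  set P := Measure.pi fun _ : ι => μ with hP
  set hit : ℚ → Set (ι → E) := fun q => {ω | frac s (B q) ω ≤ μ.real (B q) - l} with hhit
  have hitm : ∀ q, MeasurableSet (hit q) := fun q =>
    measurableSet_le (frac_meas s (hB q)) measurable_const
  set A : ℚ → Set (ι → E) := fun q => hit q ∩ ⋂ j ∈ G.filter (· < q), (hit j)ᶜ with hAdef
  have hAm : ∀ q, MeasurableSet (A q) := fun q =>
    (hitm q).inter (Finset.measurableSet_biInter _ fun j _ => (hitm j).compl)
  set f : ℚ → ι → E → ℝ≥0∞ := fun q t =>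
    if t ∈ s then dens (B q) (μ.real (B q)) l else fun _ => 1 with hf
  have hfm : ∀ q t, Measurable (f q t) := by
    intro q t
    by_cases h : t ∈ s
    · simpa [hf, h] using dens_meas (hB q) _ l
    · simp [hf, h]
  have hfp : ∀ q ∈ G, ∀ t, IsProbabilityMeasure (μ.withDensity (f q t)) := by
    intro q hq t
    by_cases h : t ∈ s
    · simpa [hf, h] using dens_prob μ (hB q) l hl (hG q hq)
    · simp only [hf, h, if_false]
      have : (fun _ : E => (1:ℝ≥0∞)) = 1 := rfl
      rw [this, withDensity_one]; infer_instance
  set Q : ℚ → Measure (ι → E) := fun q => Measure.pi fun t => μ.withDensity (f q t) with hQ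
  set r := G.max' hGne with hr
  have hrG : r ∈ G := G.max'_mem hGne
  have : ∀ t, IsProbabilityMeasure (μ.withDensity (f r t)) := hfp r hrG
  have step1 : ∀ q ∈ G, P (A q) ≤ ENNReal.ofReal (Real.exp (-(31/20 * s.card * l^2))) * Q q (A q) := by
    intro q hq
    have := hfp q hq
    have hQq : Q q = P.withDensity (fun ω => ∏ t, f q t (ω t)) := pi_withDensity μ (f q) (hfm q)
    rw [hQq, withDensity_apply _ (hAm q)]
    have : ENNReal.ofReal (Real.exp (31/20 * s.card * l^2)) * P (A q)
        ≤ ∫⁻ ω in A q, ∏ t, f q t (ω t) ∂P := by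
      rw [← setLIntegral_const]
      refine setLIntegral_mono (Finset.measurable_prod _ fun t _ => (hfm q t).comp (measurable_pi_apply t)) fun ω hω => ?_
      have h := dens_prod_ge s hs (B q) _ l hl (hG q hq) ω hω.1
      refine h.trans (le_of_eq ?_)
      rw [← Finset.prod_subset (Finset.subset_univ s)]
      · exact Finset.prod_congr rfl fun t ht => by simp [hf, ht]
      · intro t _ ht; simp [hf, ht]
    calc P (A q) = ENNReal.ofReal (Real.exp (-(31/20 * s.card * l^2))) *
          (ENNReal.ofReal (Real.exp (31/20 * s.card * l^2)) * P (A q)) := by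
          rw [← mul_assoc, ← ENNReal.ofReal_mul (Real.exp_pos _).le, ← Real.exp_add]; simp
      _ ≤ _ := by gcongr
  have step2 : ∀ q ∈ G, Q q (A q) = Q r (A q) := by
    intro q hq
    have := hfp q hq
    have hqr : q ≤ r := G.le_max' q hq
    set φ : E → ℚ → ℝ := fun y j => if j ≤ q then (B j).indicator (fun _ => (1:ℝ)) y else 0 with hφ
    have hφm : Measurable φ := by
      refine measurable_pi_lambda _ fun j => ?_
      by_cases h : j ≤ q
      · simpa [hφ, h] using measurable_const.indicator (hB j)
      · simp [hφ, h]
    have hφc : ∀ y, y ∉ B q → φ y = 0 := by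
      intro y hy
      ext j
      by_cases h : j ≤ q
      · have : y ∉ B j := fun h' => hy (hBm h h')
        simp [hφ, this]
      · simp [hφ, h]
    have hmap : ∀ t, (μ.withDensity (f q t)).map φ = (μ.withDensity (f r t)).map φ := by
      intro t
      by_cases h : t ∈ s
      · simp only [hf, h, if_true]
        exact dens_consistent μ (hB q) (hB r) (hBm hqr) l hl (hG q hq) (hG r hrG) φ hφm 0 hφc
      · simp [hf, h]
    set hit' : ℚ → Set (ι → ℚ → ℝ) := fun j => {x | (∑ t ∈ s, x t j) / s.card ≤ μ.real (B j) - l}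
    have hit'm : ∀ j, MeasurableSet (hit' j) := fun j =>
      measurableSet_le (by fun_prop) measurable_const
    have hpre : ∀ j ≤ q, hit j = (fun (x : ι → E) i => φ (x i)) ⁻¹' hit' j := by
      intro j hj
      ext ω
      simp [hhit, hit', hφ, hj, frac]
    set S := hit' q ∩ ⋂ j ∈ G.filter (· < q), (hit' j)ᶜ
    have hSm : MeasurableSet S := (hit'm q).inter (Finset.measurableSet_biInter _ fun j _ => (hit'm j).compl)
    have hAS : A q = (fun (x : ι → E) i => φ (x i)) ⁻¹' S := by
      simp only [hAdef, S, preimage_inter, preimage_iInter, preimage_compl]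
      rw [hpre q le_rfl]
      congr 1
      refine iInter₂_congr fun j hj => ?_
      rw [hpre j (Finset.mem_filter.1 hj).2.le]
    have hΦ : Measurable (fun (x : ι → E) i => φ (x i)) :=
      measurable_pi_lambda _ fun i => hφm.comp (measurable_pi_apply i)
    have hpm : ∀ q' ∈ G, ∀ t, IsProbabilityMeasure ((μ.withDensity (f q' t)).map φ) := fun q' hq' t =>
      have := hfp q' hq' t
      Measure.isProbabilityMeasure_map hφm.aemeasurable
    have := hpm q hq
    have := hpm r hrG
    rw [hAS, ← Measure.map_apply hΦ hSm, ← Measure.map_apply hΦ hSm]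
    simp only [hQ]
    rw [Measure.pi_map_pi (fun _ => hφm.aemeasurable), Measure.pi_map_pi (fun _ => hφm.aemeasurable)]
    simp_rw [hmap]
  have hdisj : (G : Set ℚ).PairwiseDisjoint A := by
    have aux : ∀ q ∈ G, ∀ q' ∈ G, q < q' → Disjoint (A q) (A q') := by
      intro q hq q' hq' hlt
      rw [Set.disjoint_left]
      intro ω h1 h2
      have := h2.2
      simp only [mem_iInter, mem_compl_iff] at this
      exact this q (Finset.mem_filter.2 ⟨hq, hlt⟩) h1.1
    intro q hq q' hq' hne
    rcases lt_or_gt_of_ne hne with h | h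
    · exact aux q hq q' hq' h
    · exact (aux q' hq' q hq h).symm
  have hcov : {ω | ∃ q ∈ G, frac s (B q) ω ≤ μ.real (B q) - l} ⊆ ⋃ q ∈ G, A q := by
    rintro ω ⟨q, hq, hω⟩
    have hne : (G.filter fun j => ω ∈ hit j).Nonempty := ⟨q, Finset.mem_filter.2 ⟨hq, hω⟩⟩
    have hmem := Finset.min'_mem _ hne
    rw [Finset.mem_filter] at hmem
    simp only [mem_iUnion]
    refine ⟨_, hmem.1, hmem.2, ?_⟩
    simp only [mem_iInter, mem_compl_iff]
    intro j hj hjh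
    rw [Finset.mem_filter] at hj
    exact absurd (Finset.min'_le _ j (Finset.mem_filter.2 ⟨hj.1, hjh⟩)) (not_le.2 hj.2)
  have : IsProbabilityMeasure (Q r) := by simp only [hQ]; infer_instance
  calc P _ ≤ P (⋃ q ∈ G, A q) := measure_mono hcov
    _ ≤ ∑ q ∈ G, P (A q) := measure_biUnion_finset_le _ _
    _ ≤ ∑ q ∈ G, ENNReal.ofReal (Real.exp (-(31/20 * s.card * l^2))) * Q r (A q) :=
        Finset.sum_le_sum fun q hq => (step1 q hq).trans (by rw [step2 q hq])
    _ = ENNReal.ofReal (Real.exp (-(31/20 * s.card * l^2))) * Q r (⋃ q ∈ G, A q) := by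
        rw [← Finset.mul_sum, measure_biUnion_finset hdisj (fun q _ => hAm q)]
    _ ≤ ENNReal.ofReal (Real.exp (-(31/20 * s.card * l^2))) * 1 := by gcongr; exact prob_le_one
    _ = _ := mul_one _

lemma chain_tail {ι E : Type*} [Fintype ι] [MeasurableSpace E] (μ : Measure E)
    [IsProbabilityMeasure μ] (B : ℚ → Set E) (hB : ∀ q, MeasurableSet (B q)) (hBm : Monotone B)
    (s : Finset ι) (hs : s.Nonempty) (l : ℝ) (hl : 0 < l) :
    (Measure.pi fun _ : ι => μ) {ω | ∃ q, frac s (B q) ω ≤ μ.real (B q) - l}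
      ≤ ENNReal.ofReal (Real.exp (-(31/20 * s.card * l^2))) := by
  classical
  set P := Measure.pi fun _ : ι => μ with hP
  set V : Finset ℚ → Set (ι → E) := fun G =>
    {ω | ∃ q ∈ G.filter (fun q => μ.real (B q) < 1), frac s (B q) ω ≤ μ.real (B q) - l} with hV
  have hae : ∀ᵐ ω ∂P, ∀ q, μ.real (B q) = 1 → ∀ t, ω t ∈ B q := by
    rw [ae_all_iff]; intro q
    by_cases h : μ.real (B q) = 1
    · simp only [h, true_imp_iff]
      rw [ae_all_iff]; intro t
      have : ∀ᵐ y ∂μ, y ∈ B q := by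
        refine (mem_ae_iff_prob_eq_one (hB q)).2 ?_
        rw [measureReal_def] at h
        rwa [ENNReal.toReal_eq_one_iff] at h
      exact Measure.tendsto_eval_ae_ae this
    · simp [h]
  have h1 : P {ω | ∃ q, frac s (B q) ω ≤ μ.real (B q) - l} ≤ P (⋃ G, V G) := by
    refine measure_mono_ae ?_
    filter_upwards [hae] with ω hω h
    obtain ⟨q, hq⟩ := h
    have hle : μ.real (B q) ≤ 1 := measureReal_le_one
    rcases hle.lt_or_eq with h | h
    · refine mem_iUnion.2 ⟨{q}, q, ?_, hq⟩
      simp [h]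
    · exfalso
      have hall := hω q h
      have : frac s (B q) ω = 1 := by
        have hm : (s.card : ℝ) ≠ 0 := by exact_mod_cast hs.card_pos.ne'
        simp [frac, hall, hm]
      rw [this, h] at hq
      linarith
  have hdir : Directed (· ⊆ ·) V := by
    intro G G'
    refine ⟨G ∪ G', ?_, ?_⟩
    · rintro ω ⟨q, hq, h⟩
      refine ⟨q, ?_, h⟩
      rw [Finset.mem_filter] at hq ⊢
      exact ⟨Finset.mem_union_left _ hq.1, hq.2⟩
    · rintro ω ⟨q, hq, h⟩
      refine ⟨q, ?_, h⟩
      rw [Finset.mem_filter] at hq ⊢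
      exact ⟨Finset.mem_union_right _ hq.1, hq.2⟩
  refine h1.trans ?_
  rw [hdir.measure_iUnion]
  exact iSup_le fun G => chain_core μ B hB hBm s hs l hl _ fun q hq => (Finset.mem_filter.1 hq).2

lemma log_const (K : ℕ) (hK : 2 ≤ K) :
    (Real.log (2*K) + 1) / (31/20) ≤ 1.505^2 * Real.log K := by
  have hK' : (2:ℝ) ≤ K := by exact_mod_cast hK
  have h1 : Real.log 2 ≤ Real.log K := Real.log_le_log (by norm_num) hK'
  have h2 := Real.log_two_gt_d9
  rw [Real.log_mul (by norm_num) (by positivity), div_le_iff₀ (by norm_num)]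
  norm_num at h2 ⊢
  linarith

lemma expect_bound {Ω : Type*} [MeasurableSpace Ω] (P : Measure Ω) [IsProbabilityMeasure P]
    (g : Ω → ℝ) (hg0 : ∀ ω, 0 ≤ g ω) (hgi : Integrable g P) (K : ℕ) (hK : 2 ≤ K) (β : ℝ) (hβ : 0 < β)
    (htail : ∀ l, 0 < l → P {ω | l < g ω} ≤ ENNReal.ofReal (2 * K * Real.exp (-(31/20 * β * l^2)))) :
    ∫ ω, g ω ∂P ≤ 1.505 * Real.sqrt (Real.log K / β) := by
  have hK' : (2:ℝ) ≤ K := by exact_mod_cast hK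
  have hlogK : 0 < Real.log K := Real.log_pos (by linarith)
  set α := 1.505 * Real.sqrt (Real.log K / β) with hα
  have hα0 : 0 < α := by positivity
  set c := 31/20 * β with hc
  have hc0 : 0 < c := by positivity
  set v0 := Real.log (2*K) / c with hv0
  have hv00 : 0 ≤ v0 := div_nonneg (Real.log_nonneg (by linarith)) hc0.le
  have hα2 : v0 + 1/c ≤ α^2 := by
    have := log_const K hK
    rw [hα, mul_pow, Real.sq_sqrt (by positivity), hv0, hc]
    rw [div_le_iff₀ (by norm_num)] at this
    rw [← add_div, div_le_iff₀ (by positivity)]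
    calc _ ≤ _ := this
      _ = _ := by field_simp
  have hL : ∫⁻ ω, ENNReal.ofReal (g ω ^ 2) ∂P ≤ ENNReal.ofReal (α^2) := by
    rw [lintegral_eq_lintegral_meas_lt P (ae_of_all _ fun ω => sq_nonneg _) (hgi.aemeasurable.pow_const 2)]
    have hpt : ∀ v, 0 < v → P {ω | v < g ω ^ 2} ≤ ENNReal.ofReal (2*K*Real.exp (-c * v)) := by
      intro v hv
      have := htail (Real.sqrt v) (Real.sqrt_pos.2 hv)
      rw [Real.sq_sqrt hv.le] at this
      refine (measure_mono ?_).trans (this.trans_eq (by rw [hc]; ring_nf))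
      intro ω hω
      exact (Real.sqrt_lt' (by
        rcases (hg0 ω).lt_or_eq with h | h
        · exact h
        · simp only [mem_ofPred_eq, ← h] at hω; norm_num at hω; linarith)).2 hω
    rw [← Ioc_union_Ioi_eq_Ioi hv00]
    refine (lintegral_union_le _ _ _).trans ?_
    have e1 : ∫⁻ v in Ioc 0 v0, P {ω | v < g ω ^ 2} ≤ ENNReal.ofReal v0 := by
      calc _ ≤ ∫⁻ v in Ioc 0 v0, 1 := lintegral_mono fun v => prob_le_one
        _ = _ := by simp
    have e2 : ∫⁻ v in Ioi v0, P {ω | v < g ω ^ 2} ≤ ENNReal.ofReal (1/c) := by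
      calc _ ≤ ∫⁻ v in Ioi v0, ENNReal.ofReal (2*K*Real.exp (-c * v)) :=
            setLIntegral_mono' measurableSet_Ioi fun v hv => hpt v (lt_of_le_of_lt hv00 hv)
        _ = ENNReal.ofReal (∫ v in Ioi v0, 2*K*Real.exp (-c * v)) := by
            rw [ofReal_integral_eq_lintegral_ofReal]
            · exact (integrableOn_exp_mul_Ioi (by linarith) v0).const_mul _
            · exact ae_of_all _ fun v => by positivity
        _ = ENNReal.ofReal (1/c) := by
            rw [integral_const_mul, integral_exp_mul_Ioi (by linarith)]
            congr 1
            have : -c * v0 = - Real.log (2*K) := by rw [hv0]; field_simp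
            rw [this, Real.exp_neg, Real.exp_log (by positivity)]
            field_simp
    calc _ ≤ ENNReal.ofReal v0 + ENNReal.ofReal (1/c) := add_le_add e1 e2
      _ = ENNReal.ofReal (v0 + 1/c) := (ENNReal.ofReal_add hv00 (by positivity)).symm
      _ ≤ _ := ENNReal.ofReal_le_ofReal hα2
  have hi2 : Integrable (fun ω => g ω ^ 2) P := by
    refine ⟨(hgi.aestronglyMeasurable.pow 2), ?_⟩
    rw [hasFiniteIntegral_iff_ofReal (ae_of_all _ fun ω => sq_nonneg _)]
    exact hL.trans_lt ENNReal.ofReal_lt_top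
  have hI2 : ∫ ω, g ω ^ 2 ∂P ≤ α^2 := by
    rw [integral_eq_lintegral_of_nonneg_ae (ae_of_all _ fun ω => sq_nonneg _) hi2.aestronglyMeasurable]
    exact ENNReal.toReal_le_of_le_ofReal (sq_nonneg _) hL
  have : ∫ ω, g ω ∂P ≤ ∫ ω, (g ω ^ 2 * (1/(2*α)) + α/2) ∂P := by
    refine integral_mono hgi ((hi2.mul_const _).add (integrable_const _)) fun ω => ?_
    have : g ω ^ 2 * (1/(2*α)) + α/2 - g ω = (g ω - α)^2 / (2*α) := by field_simp; ring
    have h2 : 0 ≤ (g ω - α)^2 / (2*α) := by positivity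
    simp only []
    linarith
  rw [integral_add (hi2.mul_const _) (integrable_const _), integral_mul_const] at this
  simp only [integral_const, probReal_univ, smul_eq_mul, one_mul] at this
  have h3 : (∫ ω, g ω ^ 2 ∂P) * (1/(2*α)) ≤ α^2 * (1/(2*α)) := by gcongr
  have h4 : α^2 * (1/(2*α)) = α/2 := by field_simp
  linarith

lemma lexMinArgmax_spec {K : ℕ} (S : Finset (Fin K → ℝ)) (hS : S.Nonempty) (f : (Fin K → ℝ) → ℝ) :
    lexMinArgmax S f ∈ S ∧ ∀ γ ∈ S, f γ ≤ f (lexMinArgmax S f) := by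
  classical
  obtain ⟨δ, hδ, hmax⟩ := S.exists_max_image f hS
  have h : (S.filter fun δ => ∀ γ ∈ S, f γ ≤ f δ).Nonempty := ⟨δ, Finset.mem_filter.2 ⟨hδ, hmax⟩⟩
  have hm : lexMinArgmax S f ∈ S.filter fun δ => ∀ γ ∈ S, f γ ≤ f δ := by
    unfold lexMinArgmax
    rw [dif_pos (by convert h)]
    generalize_proofs _ p
    have := Finset.min'_mem _ p
    obtain ⟨x, hx, hxe⟩ := Finset.mem_image.1 this
    rw [← hxe]
    convert hx
    exact ofLex_toLex x
  exact Finset.mem_filter.1 hm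

lemma IsCdfOn.nonneg {a b : ℝ} {F : ℝ → ℝ} (h : IsCdfOn a b F) (x : ℝ) : 0 ≤ F x := by
  have := h.1 (min_le_left x (a-1))
  rw [h.2.2.1 (min x (a-1)) (by have := min_le_right x (a-1); linarith)] at this
  exact this

lemma IsCdfOn.le_one {a b : ℝ} {F : ℝ → ℝ} (h : IsCdfOn a b F) (x : ℝ) : F x ≤ 1 := by
  have := h.1 (le_max_left x b)
  rwa [h.2.2.2 (max x b) (le_max_right _ _)] at this

lemma mix_cdf {a b : ℝ} {K : ℕ} {δ : Fin K → ℝ} (hδ : δ ∈ stdSimplex ℝ (Fin K))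
    {F : Fin K → ℝ → ℝ} (hF : ∀ i, IsCdfOn a b (F i)) : IsCdfOn a b (mix δ F) := by
  refine ⟨?_, ?_, ?_, ?_⟩
  · intro x y hxy
    exact Finset.sum_le_sum fun i _ => mul_le_mul_of_nonneg_left ((hF i).1 hxy) (hδ.1 i)
  · intro x
    unfold mix
    exact tendsto_finsetSum _ fun i _ => ((hF i).2.1 x).const_mul (δ i)
  · intro x hx
    simp [mix, fun i => (hF i).2.2.1 x hx]
  · intro x hx
    simp [mix, fun i => (hF i).2.2.2 x hx, hδ.2]

lemma mix_mem {K : ℕ} {D : Set (ℝ → ℝ)} (hD : Convex ℝ D) {δ : Fin K → ℝ}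
    (hδ : δ ∈ stdSimplex ℝ (Fin K)) {F : Fin K → ℝ → ℝ} (hF : ∀ i, F i ∈ D) : mix δ F ∈ D := by
  have := hD.sum_mem (t := Finset.univ) (fun i _ => hδ.1 i) hδ.2 (fun i _ => hF i)
  convert! this using 1
  ext x; simp [mix]

lemma supDist_mix_le {K : ℕ} {δ : Fin K → ℝ} (hδ : δ ∈ stdSimplex ℝ (Fin K))
    (F G : Fin K → ℝ → ℝ) (l : ℝ) (hl : ∀ j x, |F j x - G j x| ≤ l) :
    supDist (mix δ F) (mix δ G) ≤ l := by
  refine ciSup_le fun x => ?_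
  have : mix δ F x - mix δ G x = ∑ i, δ i * (F i x - G i x) := by
    simp [mix, mul_sub]
  rw [this]
  calc _ ≤ ∑ i, |δ i * (F i x - G i x)| := Finset.abs_sum_le_sum_abs _ _
    _ ≤ ∑ i, δ i * l := Finset.sum_le_sum fun i _ => by
        rw [abs_mul, abs_of_nonneg (hδ.1 i)]
        exact mul_le_mul_of_nonneg_left (hl i x) (hδ.1 i)
    _ = l := by rw [← Finset.sum_mul, hδ.2, one_mul]

lemma emp_eq_frac {K n : ℕ} (Pi : Fin K → Finset (Fin n)) (ω : Fin n → Fin K → ℝ) (j : Fin K) (z : ℝ) :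
    empCdfPartition Pi ω j z = frac (Pi j) {y : Fin K → ℝ | y j ≤ z} ω := by
  simp [empCdfPartition, frac, indicator]

lemma emp_cdf {a b : ℝ} {K n : ℕ} (Pi : Fin K → Finset (Fin n)) (hPine : ∀ j, (Pi j).Nonempty)
    (ω : Fin n → Fin K → ℝ) (hω : ∀ t j, ω t j ∈ Icc a b) (j : Fin K) :
    IsCdfOn a b (empCdfPartition Pi ω j) := by
  have hm : (0:ℝ) < (Pi j).card := by exact_mod_cast (hPine j).card_pos
  refine ⟨?_, ?_, ?_, ?_⟩
  · intro x y hxy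
    refine div_le_div_of_nonneg_right (Finset.sum_le_sum fun t _ => ?_) hm.le
    split_ifs with h1 h2 h2
    · exact le_rfl
    · exact absurd (h1.trans hxy) h2
    · exact zero_le_one
    · exact le_rfl
  · intro x
    refine ContinuousWithinAt.div_const (tendsto_finsetSum _ fun t _ => ?_) _
    by_cases h : ω t j ≤ x
    · refine tendsto_const_nhds.congr' ?_
      filter_upwards [self_mem_nhdsWithin] with y hy
      have hy' : x ≤ y := hy
      rw [if_pos h, if_pos (h.trans hy')]
    · refine tendsto_const_nhds.congr' ?_
      filter_upwards [mem_nhdsWithin_of_mem_nhds (Iio_mem_nhds (not_le.1 h))] with y hy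
      have hy' : y < ω t j := hy
      rw [if_neg h, if_neg (not_le.2 hy')]
  · intro x hx
    unfold empCdfPartition
    rw [Finset.sum_eq_zero, zero_div]
    intro t _
    rw [if_neg]
    have := (hω t j).1
    linarith
  · intro x hx
    unfold empCdfPartition
    rw [Finset.sum_congr rfl (g := fun _ => (1:ℝ))]
    · simp [hm.ne']
    · intro t _
      rw [if_pos ((hω t j).2.trans hx)]

lemma exists_rat_gt (h : ℝ → ℝ) (x l : ℝ) (hc : ContinuousWithinAt h (Ici x) x) (hl : l < h x) :
    ∃ q : ℚ, l < h q := by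
  have h1 : ∀ᶠ y in nhdsWithin x (Ici x), l < h y := hc.eventually (lt_mem_nhds hl)
  have h2 : ∀ᶠ y in nhdsWithin x (Ioi x), l < h y := nhdsWithin_mono x Ioi_subset_Ici_self h1
  obtain ⟨u, hu, hsub⟩ := mem_nhdsGT_iff_exists_Ioo_subset.1 h2
  obtain ⟨q, hq1, hq2⟩ := exists_rat_btwn (mem_Ioi.1 hu)
  exact ⟨q, hsub ⟨hq1, hq2⟩⟩

lemma arm_tail {a b : ℝ} {K n : ℕ} (Pi : Fin K → Finset (Fin n)) (hPine : ∀ j, (Pi j).Nonempty)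
    (F : Fin K → ℝ → ℝ) (hF : ∀ i, IsCdfOn a b (F i))
    (ν : Measure (Fin K → ℝ)) [IsProbabilityMeasure ν]
    (hmarg : ∀ (i : Fin K) (x : ℝ), ν {y | y i ≤ x} = ENNReal.ofReal (F i x))
    (j : Fin K) (l : ℝ) (hl : 0 < l) :
    (Measure.pi fun _ : Fin n => ν) {ω | (∀ t i, ω t i ∈ Icc a b) ∧
      ∃ x, l < |F j x - empCdfPartition Pi ω j x|}
      ≤ ENNReal.ofReal (2 * Real.exp (-(31/20 * (Pi j).card * l^2))) := by
  set P := Measure.pi fun _ : Fin n => ν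
  have hreal : ∀ x, ν.real {y | y j ≤ x} = F j x := fun x => by
    rw [measureReal_def, hmarg, ENNReal.toReal_ofReal ((hF j).nonneg x)]
  have hmeas : ∀ x : ℝ, MeasurableSet {y : Fin K → ℝ | y j ≤ x} := fun x =>
    measurableSet_le (measurable_pi_apply j) measurable_const
  have t1 := chain_tail ν (fun q : ℚ => {y : Fin K → ℝ | y j ≤ q}) (fun q => hmeas q)
    (fun q q' hq y hy => by
      have h1 : y j ≤ (q:ℝ) := hy
      have h2 : (q:ℝ) ≤ q' := by exact_mod_cast hq
      exact h1.trans h2) (Pi j) (hPine j) l hl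
  have t2 := chain_tail ν (fun q : ℚ => {y : Fin K → ℝ | y j ≤ -q}ᶜ) (fun q => (hmeas _).compl)
    (fun q q' hq y hy hy' => hy (by
      have h1 : y j ≤ -(q':ℝ) := hy'
      have h2 : (q:ℝ) ≤ q' := by exact_mod_cast hq
      show y j ≤ -(q:ℝ)
      linarith)) (Pi j) (hPine j) l hl
  have hsplit : 2 * Real.exp (-(31/20 * (Pi j).card * l^2)) =
    Real.exp (-(31/20 * (Pi j).card * l^2)) + Real.exp (-(31/20 * (Pi j).card * l^2)) := by ring
  rw [hsplit, ENNReal.ofReal_add (Real.exp_pos _).le (Real.exp_pos _).le]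
  refine le_trans ?_ (add_le_add t1 t2)
  refine le_trans (measure_mono ?_) (measure_union_le _ _)
  rintro ω ⟨hω, x, hx⟩
  have hc := emp_cdf Pi hPine ω hω j
  have hm : ((Pi j).card : ℝ) ≠ 0 := by exact_mod_cast (hPine j).card_pos.ne'
  rcases lt_abs.1 hx with h | h
  · left
    obtain ⟨q, hq⟩ := exists_rat_gt (fun x => F j x - empCdfPartition Pi ω j x) x l
      (((hF j).2.1 x).sub (hc.2.1 x)) h
    refine ⟨q, ?_⟩
    rw [← emp_eq_frac, hreal]
    linarith
  · right
    obtain ⟨q, hq⟩ := exists_rat_gt (fun x => -(F j x - empCdfPartition Pi ω j x)) x l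
      (((hF j).2.1 x).sub (hc.2.1 x)).neg h
    refine ⟨-q, ?_⟩
    have e : ∀ A : Set (Fin K → ℝ), frac (Pi j) Aᶜ ω = 1 - frac (Pi j) A ω := by
      intro A
      have : ∀ y, Aᶜ.indicator (fun _ => (1:ℝ)) y = 1 - A.indicator (fun _ => (1:ℝ)) y := by
        intro y; by_cases hy : y ∈ A <;> simp [hy]
      simp only [frac, this, Finset.sum_sub_distrib, sub_div]
      simp [hm]
    rw [e, probReal_compl_eq_one_sub (hmeas _)]
    push_cast
    rw [neg_neg, ← emp_eq_frac, hreal]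
    linarith

lemma ae_range {a b : ℝ} {K n : ℕ}
    (F : Fin K → ℝ → ℝ) (hF : ∀ i, IsCdfOn a b (F i))
    (ν : Measure (Fin K → ℝ)) [IsProbabilityMeasure ν]
    (hmarg : ∀ (i : Fin K) (x : ℝ), ν {y | y i ≤ x} = ENNReal.ofReal (F i x)) :
    ∀ᵐ ω ∂(Measure.pi fun _ : Fin n => ν), ∀ t i, ω t i ∈ Icc a b := by
  rw [ae_all_iff]; intro t
  rw [ae_all_iff]; intro i
  have hmeas : ∀ x : ℝ, MeasurableSet {y : Fin K → ℝ | y i ≤ x} := fun x =>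
    measurableSet_le (measurable_pi_apply i) measurable_const
  have h1 : ∀ᵐ y ∂ν, y i ≤ b := by
    refine (mem_ae_iff_prob_eq_one (hmeas b)).2 ?_
    rw [hmarg, (hF i).2.2.2 b le_rfl, ENNReal.ofReal_one]
  have h2 : ∀ᵐ y ∂ν, ∀ q : ℚ, (q:ℝ) < a → ¬ y i ≤ (q:ℝ) := by
    rw [ae_all_iff]; intro q
    by_cases hq : (q:ℝ) < a
    · simp only [hq, true_imp_iff]
      rw [ae_iff]
      simp only [not_not]
      rw [hmarg, (hF i).2.2.1 q hq, ENNReal.ofReal_zero]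
    · simp [hq]
  have h3 : ∀ᵐ y ∂ν, y i ∈ Icc a b := by
    filter_upwards [h1, h2] with y hy1 hy2
    refine ⟨?_, hy1⟩
    by_contra h
    obtain ⟨q, hq1, hq2⟩ := exists_rat_btwn (not_le.1 h)
    exact hy2 q hq2 hq1.le
  exact (Measure.tendsto_eval_ae_ae (μ := fun _ : Fin n => ν) (i := t)).eventually h3

end Aux

/-- Theorem 3 of the paper: the static assignment policy `π̂` with partition `Π_n`,
discretization `M_K^n` and `β_n = min_j |Π_{n,j}|` satisfies, for `n ≥ K`,
`sup_F E[r_n(π̂, M_K)] ≤ ε(n) + 3.01·C·√(log K/β_n)`, where the supremum is over all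
outcome distributions `F¹,…,F^K ∈ D` (the `n` potential outcome vectors being i.i.d.,
with arbitrary dependence between coordinates, and the `i`-th marginal having cdf `F^i`). -/
theorem static_assignment_regret_bound
    (a b : ℝ) (hab : a < b)
    (T : (ℝ → ℝ) → ℝ) (D : Set (ℝ → ℝ)) (hDne : D.Nonempty)
    (hDcdf : ∀ F ∈ D, IsCdfOn a b F) (hDconv : Convex ℝ D)
    (C : ℝ) (hC : 0 < C) (hLip : LipschitzAssumption a b T D C)
    (hTmeas : MeasurabilityAssumption a b T)
    (K n : ℕ) (hK : 2 ≤ K) (hKn : K ≤ n)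
    (M : Set (Fin K → ℝ)) (hMsub : M ⊆ stdSimplex ℝ (Fin K)) (hMclosed : IsClosed M)
    (hM2 : M.Nontrivial)
    (Mn : Finset (Fin K → ℝ)) (hMnsub : (Mn : Set (Fin K → ℝ)) ⊆ M) (hMnne : Mn.Nonempty)
    (Pi : Fin K → Finset (Fin n))
    (hPidisj : ∀ j j', j ≠ j' → Disjoint (Pi j) (Pi j'))
    (hPicover : ∀ t : Fin n, ∃ j, t ∈ Pi j)
    (hPine : ∀ j, (Pi j).Nonempty)
    (F : Fin K → ℝ → ℝ) (hF : ∀ i, F i ∈ D)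
    (ν : ProbabilityMeasure (Fin K → ℝ))
    (hmarg : ∀ (i : Fin K) (x : ℝ),
      (ν : Measure (Fin K → ℝ)) {y | y i ≤ x} = ENNReal.ofReal (F i x)) :
    ∫ ω : Fin n → Fin K → ℝ,
        (sSup ((fun δ => T (mix δ F)) '' M)
          - T (mix (lexMinArgmax Mn fun δ => T (mix δ (empCdfPartition Pi ω))) F))
      ∂(Measure.pi fun _ : Fin n => (ν : Measure (Fin K → ℝ)))
    ≤ epsOpt T D M Mn
        + 3.01 * C * Real.sqrt (Real.log K / (⨅ j : Fin K, ((Pi j).card : ℝ))) := by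
  have hFc : ∀ i, IsCdfOn a b (F i) := fun i => hDcdf _ (hF i)
  have hMne : M.Nonempty := hM2.nonempty
  -- differences of `T` over mixtures are bounded by `C`
  have hTb : ∀ G : Fin K → ℝ → ℝ, (∀ i, G i ∈ D) → ∀ δ ∈ M, ∀ δ' ∈ M,
      T (mix δ G) - T (mix δ' G) ≤ C := by
    intro G hG δ hδ δ' hδ'
    have c1 := mix_cdf (hMsub hδ) (fun i => hDcdf _ (hG i))
    have c2 := mix_cdf (hMsub hδ') (fun i => hDcdf _ (hG i))
    have h1 := hLip _ (mix_mem hDconv (hMsub hδ) hG) _ c2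
    have h2 : supDist (mix δ G) (mix δ' G) ≤ 1 := by
      refine ciSup_le fun x => ?_
      rw [abs_le]
      have := c1.nonneg x; have := c1.le_one x
      have := c2.nonneg x; have := c2.le_one x
      constructor <;> linarith
    have h3 := mul_le_mul_of_nonneg_left h2 hC.le
    linarith [le_abs_self (T (mix δ G) - T (mix δ' G))]
  have hbdd : ∀ G : Fin K → ℝ → ℝ, (∀ i, G i ∈ D) → BddAbove ((fun δ => T (mix δ G)) '' M) := by
    intro G hG
    obtain ⟨δ₀, hδ₀⟩ := hMne
    refine ⟨T (mix δ₀ G) + C, ?_⟩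
    rintro _ ⟨δ, hδ, rfl⟩
    have := hTb G hG δ hδ δ₀ hδ₀
    simp only []
    linarith
  have heps0 : 0 ≤ epsOpt T D M Mn := by
    refine Real.sSup_nonneg ?_
    rintro _ ⟨G, _, rfl⟩
    exact abs_nonneg _
  have hMnne' : ((fun δ => T (mix δ F)) '' (Mn : Set (Fin K → ℝ))).Nonempty :=
    Set.Nonempty.image _ (by exact_mod_cast hMnne)
  have heps : sSup ((fun δ => T (mix δ F)) '' M)
      - sSup ((fun δ => T (mix δ F)) '' (Mn : Set (Fin K → ℝ))) ≤ epsOpt T D M Mn := by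
    refine (le_abs_self _).trans (le_csSup ⟨C, ?_⟩ ⟨F, hF, rfl⟩)
    rintro _ ⟨G, hG, rfl⟩
    have hb := hbdd G hG
    obtain ⟨δ₀, hδ₀⟩ := hMnne
    have hs1 : sSup ((fun δ => T (mix δ G)) '' (Mn : Set (Fin K → ℝ)))
        ≤ sSup ((fun δ => T (mix δ G)) '' M) :=
      csSup_le_csSup hb (Set.Nonempty.image _ ⟨δ₀, hδ₀⟩) (Set.image_mono hMnsub)
    have hs2 : T (mix δ₀ G) ≤ sSup ((fun δ => T (mix δ G)) '' (Mn : Set (Fin K → ℝ))) :=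
      le_csSup (hb.mono (Set.image_mono hMnsub)) ⟨δ₀, hδ₀, rfl⟩
    have hs3 : sSup ((fun δ => T (mix δ G)) '' M) ≤ T (mix δ₀ G) + C := by
      refine csSup_le (hMne.image _) ?_
      rintro _ ⟨δ, hδ, rfl⟩
      have := hTb G hG δ hδ δ₀ (hMnsub hδ₀)
      simp only []
      linarith
    rw [abs_le]
    constructor <;> linarith
  -- the minimal block size
  have hK0 : 0 < K := by omega
  have : Nonempty (Fin K) := ⟨⟨0, hK0⟩⟩
  set β := ⨅ j : Fin K, ((Pi j).card : ℝ) with hβ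
  have hβle : ∀ j, β ≤ (Pi j).card := fun j => ciInf_le (Set.finite_range _).bddBelow j
  have hβ0 : 0 < β := by
    obtain ⟨j, hj⟩ := exists_eq_ciInf_of_finite (f := fun j : Fin K => ((Pi j).card : ℝ))
    rw [hβ, ← hj]
    exact_mod_cast (hPine j).card_pos
  set P := Measure.pi fun _ : Fin n => (ν : Measure (Fin K → ℝ)) with hP
  set f : (Fin n → Fin K → ℝ) → ℝ := fun ω => sSup ((fun δ => T (mix δ F)) '' M)
          - T (mix (lexMinArgmax Mn fun δ => T (mix δ (empCdfPartition Pi ω))) F) with hf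
  set e := epsOpt T D M Mn with he
  have hrhs : 0 ≤ 3.01 * C * Real.sqrt (Real.log K / β) := by positivity
  by_cases hint : Integrable f P
  swap
  · rw [integral_undef hint]
    linarith
  have hdet : ∀ l : ℝ, ∀ ω : Fin n → Fin K → ℝ, (∀ t i, ω t i ∈ Icc a b) →
      (∀ j x, |F j x - empCdfPartition Pi ω j x| ≤ l) → f ω ≤ e + 2 * C * l := by
    intro l ω hω hl
    obtain ⟨hmem, hmax⟩ := lexMinArgmax_spec Mn hMnne fun δ => T (mix δ (empCdfPartition Pi ω))
    set δh := lexMinArgmax Mn fun δ => T (mix δ (empCdfPartition Pi ω)) with hδh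
    have hLipδ : ∀ δ ∈ Mn, |T (mix δ F) - T (mix δ (empCdfPartition Pi ω))| ≤ C * l := by
      intro δ hδ
      have hs := hMsub (hMnsub hδ)
      refine (hLip _ (mix_mem hDconv hs hF) _ (mix_cdf hs (emp_cdf Pi hPine ω hω))).trans ?_
      exact mul_le_mul_of_nonneg_left (supDist_mix_le hs _ _ l hl) hC.le
    have hsup : sSup ((fun δ => T (mix δ F)) '' (Mn : Set (Fin K → ℝ))) ≤ T (mix δh F) + 2 * C * l := by
      refine csSup_le hMnne' ?_
      rintro _ ⟨δ, hδ, rfl⟩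
      have h1 := (abs_le.1 (hLipδ δ hδ)).2
      have h2 := (abs_le.1 (hLipδ δh hmem)).1
      have h3 := hmax δ hδ
      simp only [] at h3 ⊢
      linarith
    have : f ω = sSup ((fun δ => T (mix δ F)) '' M) - T (mix δh F) := rfl
    linarith
  set g : (Fin n → Fin K → ℝ) → ℝ := fun ω => max (f ω - e) 0 * (1 / (2 * C)) with hg
  have hgi : Integrable g P := ((hint.sub (integrable_const e)).pos_part).mul_const _
  have hg0 : ∀ ω, 0 ≤ g ω := fun ω => by
    have : 0 ≤ max (f ω - e) 0 := le_max_right _ _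
    positivity
  have hfg : ∀ ω, f ω ≤ e + 2 * C * g ω := by
    intro ω
    have h1 : 2 * C * g ω = max (f ω - e) 0 := by simp only [hg]; field_simp
    have := le_max_left (f ω - e) 0
    linarith
  have hgood : ∀ᵐ ω ∂P, ∀ t i, ω t i ∈ Icc a b := ae_range F hFc (ν : Measure (Fin K → ℝ)) hmarg
  have htail : ∀ l, 0 < l → P {ω | l < g ω} ≤ ENNReal.ofReal (2 * K * Real.exp (-(31/20 * β * l^2))) := by
    intro l hl
    have h1 : P {ω | l < g ω} ≤ P (⋃ j : Fin K, {ω | (∀ t i, ω t i ∈ Icc a b) ∧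
        ∃ x, l < |F j x - empCdfPartition Pi ω j x|}) := by
      refine measure_mono_ae ?_
      filter_upwards [hgood] with ω hω h
      have hlt : l < g ω := h
      by_contra hno
      have hall : ∀ j x, |F j x - empCdfPartition Pi ω j x| ≤ l := by
        intro j x
        by_contra hx
        exact hno (mem_iUnion.2 ⟨j, hω, x, not_le.1 hx⟩)
      have h2 := hdet l ω hω hall
      have h3 : 2 * C * g ω = max (f ω - e) 0 := by simp only [hg]; field_simp
      have h4 : max (f ω - e) 0 ≤ 2 * C * l := max_le (by linarith) (by positivity)
      have h5 : 2 * C * l < 2 * C * g ω := mul_lt_mul_of_pos_left hlt (by positivity)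
      linarith
    refine h1.trans ((measure_iUnion_fintype_le _ _).trans ?_)
    calc _ ≤ ∑ j : Fin K, ENNReal.ofReal (2 * Real.exp (-(31/20 * β * l^2))) := by
          refine Finset.sum_le_sum fun j _ => ?_
          refine (arm_tail Pi hPine F hFc (ν : Measure (Fin K → ℝ)) hmarg j l hl).trans ?_
          apply ENNReal.ofReal_le_ofReal
          have := hβle j
          gcongr
      _ = ENNReal.ofReal (2 * K * Real.exp (-(31/20 * β * l^2))) := by
          rw [Finset.sum_const, Finset.card_univ, Fintype.card_fin, nsmul_eq_mul,
            ← ENNReal.ofReal_natCast, ← ENNReal.ofReal_mul (by positivity)]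
          congr 1; ring
  have hE := expect_bound P g hg0 hgi K hK β hβ0 htail
  calc ∫ ω, f ω ∂P ≤ ∫ ω, (e + 2 * C * g ω) ∂P :=
        integral_mono hint ((integrable_const e).add (hgi.const_mul _)) hfg
    _ = e + 2 * C * ∫ ω, g ω ∂P := by
        rw [integral_add (integrable_const e) (hgi.const_mul _), integral_const_mul]
        simp
    _ ≤ e + 2 * C * (1.505 * Real.sqrt (Real.log K / β)) := by gcongr
    _ = _ := by ring

end TRDT
end
end

section
/- Let K ≥ 2 and β ≥ 1 be integers. For each j = 1,…,K, let F̂_j be the empirical cdf of n_j ≥ β random variables that are i.i.d. with cdf F_j (no independence across j is required). Then E[ max_{j=1,…,K} ‖F̂_j − F_j‖_∞ ] ≤ 1.505 · √( log(K) / β ). More precisely, E[max_j ‖F̂_j − F_j‖_∞] ≤ inf_{a≥1} ( log(2 + 8√(π·log(2^a))·2^a) / (log(2)·√(8a)) ) · √(log(K)/β). -/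
open MeasureTheory Set
noncomputable section
namespace TRDT

/-- The cdf of a (probability) measure `μ` on `ℝ`. -/
def cdfOf (μ : Measure ℝ) : ℝ → ℝ := fun x => (μ (Set.Iic x)).toReal

/-- The empirical cdf of the sample `y : Fin m → ℝ`. -/
def empiricalCdf {m : ℕ} (y : Fin m → ℝ) : ℝ → ℝ :=
  fun x => (∑ t : Fin m, if y t ≤ x then (1 : ℝ) else 0) / m


lemma poly_ineq (x s : ℝ) (hx : 0 < x) (hxs : x ≤ s) (hs : s < 1) :
    0 ≤ (1 - s + x) * (4 * (1 + x) * s) -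
      (2 * (s - x) + 7 / 4 * x) * (2 * (1 - s) * (1 + 2 * x + 2 * x ^ 2) + 2 * x * (1 + x) * s) := by
  have h : 0 ≤ x ^ 2 * (1 - s / 2) + x * (1 - 4.5 * s + 4 * s ^ 2) + (1 - s) / 2 := by
    have hs0 : 0 < s := by linarith
    rcases le_total s 0.83 with h | h
    · have h1 : -0.27 ≤ 1 - 4.5 * s + 4 * s ^ 2 := by nlinarith [sq_nonneg (s - 0.5625)]
      have h2 : x * (-0.27) ≤ x * (1 - 4.5 * s + 4 * s ^ 2) := mul_le_mul_of_nonneg_left h1 hx.le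
      have h3 : x ^ 2 * 0.58 ≤ x ^ 2 * (1 - s / 2) :=
        mul_le_mul_of_nonneg_left (by linarith) (by positivity)
      nlinarith [sq_nonneg (x - 0.25)]
    · have h1 : 0 ≤ 1 - 4.5 * s + 4 * s ^ 2 := by nlinarith
      have : 0 ≤ x * (1 - 4.5 * s + 4 * s ^ 2) := mul_nonneg hx.le h1
      have : 0 ≤ x ^ 2 * (1 - s / 2) := mul_nonneg (by positivity) (by linarith)
      linarith
  have := mul_nonneg hx.le h
  nlinarith

lemma phi_ineq (x s : ℝ) (hx : 0 < x) (hxs : x ≤ s) (hs : s < 1) :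
    7 / 4 * x ^ 2 ≤ (s - x) * (-(2 * x)) +
      (1 - s + x) * Real.log ((1 - Real.exp (-(2 * x)) * s) / (1 - s)) := by
  have hT : 0 < 1 - s := by linarith
  have hE : 0 < 1 + 2 * x + 2 * x ^ 2 := by positivity
  have hexp : 1 + 2 * x + 2 * x ^ 2 ≤ Real.exp (2 * x) := by
    have := Real.quadratic_le_exp_of_nonneg (x := 2 * x) (by linarith)
    nlinarith
  have hc : Real.exp (-(2 * x)) ≤ 1 / (1 + 2 * x + 2 * x ^ 2) := by
    rw [Real.exp_neg, ← one_div]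
    exact one_div_le_one_div_of_le hE hexp
  set q := 2 * x * (1 + x) / (1 + 2 * x + 2 * x ^ 2) with hq
  have hq0 : 0 < q := by positivity
  have hq1 : q = 1 - 1 / (1 + 2 * x + 2 * x ^ 2) := by rw [hq]; field_simp; ring
  set u := q * s / (1 - s) with hu
  have hs0 : 0 < s := by linarith
  have hu0 : 0 ≤ u := by positivity
  have h1 : 1 + u ≤ (1 - Real.exp (-(2 * x)) * s) / (1 - s) := by
    rw [le_div_iff₀ hT, hu, add_mul, div_mul_cancel₀ _ hT.ne']
    nlinarith
  have h2 : 2 * u / (u + 2) ≤ Real.log ((1 - Real.exp (-(2 * x)) * s) / (1 - s)) :=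
    (Real.le_log_one_add_of_nonneg hu0).trans (Real.log_le_log (by positivity) h1)
  have h3 : (1 - s + x) * (2 * u / (u + 2)) ≤
     (1 - s + x) * Real.log ((1 - Real.exp (-(2 * x)) * s) / (1 - s)) :=
    mul_le_mul_of_nonneg_left h2 (by linarith)
  have h4 : 2 * u / (u + 2) = 4 * x * (1 + x) * s /
     (2 * (1 - s) * (1 + 2 * x + 2 * x ^ 2) + 2 * x * (1 + x) * s) := by
    rw [hu, hq]; field_simp; ring
  have h5 : 2 * x * (s - x) + 7 / 4 * x ^ 2 ≤ (1 - s + x) * (2 * u / (u + 2)) := by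
    rw [h4, ← mul_div_assoc, le_div_iff₀ (by positivity)]
    have := mul_nonneg hx.le (poly_ineq x s hx hxs hs)
    linarith
  linarith

lemma ca_ineq (a : ℝ) (ha : 1 ≤ a) : Real.sqrt 2 ≤
    (Real.log (2 + 8 * Real.sqrt (Real.pi * Real.log ((2 : ℝ) ^ a)) * (2 : ℝ) ^ a)
            / (Real.log 2 * Real.sqrt (8 * a))) := by
  have hl : 0.6931 < Real.log 2 := by have := Real.log_two_gt_d9; linarith
  obtain ⟨b, hb, rfl⟩ : ∃ b : ℝ, 1 ≤ b ∧ a = b ^ 2 :=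
    ⟨Real.sqrt a, by rw [Real.one_le_sqrt]; exact ha, (Real.sq_sqrt (by linarith)).symm⟩
  have hb0 : 0 < b := by linarith
  rw [le_div_iff₀ (by positivity), Real.le_log_iff_exp_le (by positivity)]
  have h8 : Real.sqrt 2 * (Real.log 2 * Real.sqrt (8 * b ^ 2)) = Real.log 2 * (4 * b) := by
    have : Real.sqrt 2 * Real.sqrt (8 * b ^ 2) = 4 * b := by
      rw [← Real.sqrt_mul (by norm_num), show (2 * (8 * b ^ 2)) = (4 * b) ^ 2 by ring,
        Real.sqrt_sq (by positivity)]
    rw [← this]; ring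
  rw [h8, Real.log_rpow (by norm_num)]
  have hs : 1.475 * b ≤ Real.sqrt (Real.pi * (b ^ 2 * Real.log 2)) := by
    apply Real.le_sqrt_of_sq_le
    have h : 2.1757 ≤ Real.pi * Real.log 2 := by
      nlinarith [Real.pi_gt_d2]
    nlinarith [sq_nonneg b]
  have e1 : (2 : ℝ) ^ (b ^ 2) = Real.exp (Real.log 2 * b ^ 2) := by
    rw [Real.rpow_def_of_pos (by norm_num)]
  have e2 : Real.exp (Real.log 2 * b ^ 2) =
      Real.exp (Real.log 2 * (4 * b)) * Real.exp (Real.log 2 * (b - 2) ^ 2) / 16 := by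
    have : (16 : ℝ) = Real.exp (Real.log 2 * 4) := by
      rw [← Real.rpow_def_of_pos (by norm_num)]; norm_num
    rw [this, ← Real.exp_add, ← Real.exp_sub]; congr 1; ring
  have e3 : 1 + 0.6931 * (b - 2) ^ 2 ≤ Real.exp (Real.log 2 * (b - 2) ^ 2) := by
    have := Real.add_one_le_exp (Real.log 2 * (b - 2) ^ 2)
    nlinarith [sq_nonneg (b - 2)]
  have hpos := Real.exp_pos (Real.log 2 * (4 * b))
  have key : 1 ≤ 8 * (1.475 * b) * (1 + 0.6931 * (b - 2) ^ 2) / 16 := by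
    rcases le_total b 1.4 with h | h
    · have : 0.36 ≤ (b - 2) ^ 2 := by nlinarith
      nlinarith [mul_nonneg (sub_nonneg.2 hb) (sub_nonneg.2 h), mul_nonneg hb0.le (sub_nonneg.2 this)]
    · nlinarith [mul_nonneg hb0.le (sq_nonneg (b - 2))]
  rw [e1, e2]
  calc Real.exp (Real.log 2 * (4 * b)) ≤ Real.exp (Real.log 2 * (4 * b)) *
        (8 * (1.475 * b) * (1 + 0.6931 * (b - 2) ^ 2) / 16) := le_mul_of_one_le_right hpos.le key
    _ = 8 * (1.475 * b) * (Real.exp (Real.log 2 * (4 * b)) * (1 + 0.6931 * (b - 2) ^ 2) / 16) := by ring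
    _ ≤ 8 * Real.sqrt (Real.pi * (b ^ 2 * Real.log 2)) * (Real.exp (Real.log 2 * (4 * b)) *
        Real.exp (Real.log 2 * (b - 2) ^ 2) / 16) := by gcongr
    _ ≤ _ := by linarith
lemma sum_trunc {ι L : Type*} [Fintype ι] [DecidableEq ι] [Fintype L] [DecidableEq L]
    (τ : L → L) (q q' : L → ℝ)
    (hq : ∀ l, ∑ l' with τ l' = l, q l' = ∑ l' with τ l' = l, q' l')
    (f : (ι → L) → ℝ) (hf : ∀ z, f z = f (fun j => τ (z j))) :
    ∑ z, f z * ∏ j, q (z j) = ∑ z, f z * ∏ j, q' (z j) := by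
  have aux : ∀ q : L → ℝ, ∑ z, f z * ∏ j, q (z j) =
      ∑ y : ι → L, f y * ∏ j, ∑ l' with τ l' = y j, q l' := by
    intro q
    rw [← Finset.sum_fiberwise Finset.univ (fun (z : ι → L) => (fun j => τ (z j)))]
    apply Finset.sum_congr rfl
    intro y _
    rw [Finset.prod_univ_sum, Finset.mul_sum]
    apply Finset.sum_congr
    · ext z; simp [funext_iff]
    · intro z hz
      rw [hf z]
      congr 2
      simp only [Fintype.mem_piFinset, Finset.mem_filter, Finset.mem_univ, true_and] at hz
      funext j; exact hz j
  rw [aux q, aux q']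
  simp only [hq]

lemma fiber_eq {m : ℕ} (i : ℕ) (hi : i < m) (q q' : Fin (m + 1) → ℝ)
    (h : ∀ l : Fin (m + 1), (l : ℕ) ≤ i → q l = q' l) (hs : ∑ l, q l = ∑ l, q' l) (l : Fin (m + 1)) :
    ∑ l' ∈ Finset.univ.filter (fun l' : Fin (m + 1) => (if (l' : ℕ) ≤ i then l' else Fin.last m) = l), q l' =
    ∑ l' ∈ Finset.univ.filter (fun l' : Fin (m + 1) => (if (l' : ℕ) ≤ i then l' else Fin.last m) = l), q' l' := by
  by_cases hl : l = Fin.last m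
  · have h1 : ∀ q : Fin (m + 1) → ℝ, ∑ l' ∈ Finset.univ.filter (fun l' : Fin (m + 1) => (if (l' : ℕ) ≤ i then l' else Fin.last m) = l), q l'
       = ∑ l, q l - ∑ l' ∈ Finset.univ.filter (fun l' : Fin (m + 1) => (l' : ℕ) ≤ i), q l' := by
      intro q
      rw [← Finset.sum_filter_not_add_sum_filter Finset.univ (fun l' : Fin (m+1) => (l' : ℕ) ≤ i) q,
        add_sub_cancel_right]
      apply Finset.sum_congr _ (fun _ _ => rfl)
      ext l'
      simp only [Finset.mem_filter, Finset.mem_univ, true_and, hl]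
      split_ifs with hh
      · simp only [hh, not_true, iff_false]
        rintro rfl; simp at hh; omega
      · simp [hh]
    rw [h1, h1, hs]
    congr 1
    apply Finset.sum_congr rfl
    intro l' hl'
    exact h l' (by simpa using hl')
  · apply Finset.sum_congr rfl
    intro l' hl'
    simp only [Finset.mem_filter, Finset.mem_univ, true_and] at hl'
    split_ifs at hl' with hh
    · exact h l' hh
    · exact absurd hl'.symm hl

/-- finite maximal inequality -/
lemma finite_max {m n : ℕ} (p : Fin (m + 1) → ℝ) (hp : ∀ l, 0 ≤ p l) (hp1 : ∑ l, p l = 1)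
    (x : ℝ) (hx : 0 < x) (c : ℝ) (hc0 : 0 < c) (hc1 : c < 1) (Λ : ℝ)
    (hphi : ∀ s, x ≤ s → s < 1 → Λ ≤ (s - x) * Real.log c +
      (1 - s + x) * Real.log ((1 - c * s) / (1 - s))) (hn : 0 < n) :
    ∑ z : Fin n → Fin (m + 1) with (∃ i < m, (Finset.card {j | ((z j : Fin (m+1)) : ℕ) ≤ i} : ℝ) ≤
      n * ((∑ l ∈ Finset.univ.filter (fun l : Fin (m + 1) => (l : ℕ) ≤ i), p l) - x)), ∏ j, p (z j) ≤ Real.exp (-(n * Λ)) := by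
  classical
  set Pc : ℕ → ℝ := fun i => ∑ l ∈ Finset.univ.filter (fun l : Fin (m + 1) => (l : ℕ) ≤ i), p l with hPc
  set N : ℕ → (Fin n → Fin (m + 1)) → ℕ := fun i z => Finset.card {j | ((z j : Fin (m+1)) : ℕ) ≤ i} with hN
  set E : ℕ → (Fin n → Fin (m + 1)) → Prop := fun i z => (N i z : ℝ) ≤ n * (Pc i - x) with hE
  set f : ℕ → (Fin n → Fin (m + 1)) → ℝ := fun i z => if E i z ∧ ∀ l < i, ¬ E l z then 1 else 0 with hf
  have hPc1 : ∀ i, Pc i ≤ 1 := fun i => by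
    rw [← hp1]; exact Finset.sum_le_sum_of_subset_of_nonneg (Finset.filter_subset _ _) (fun l _ _ => hp l)
  have hPc0 : ∀ i, 0 ≤ Pc i := fun i => Finset.sum_nonneg (fun l _ => hp l)
  set qinf : Fin (m + 1) → ℝ := fun l => if (l : ℕ) < m then c * p l else
    1 - c * ∑ l ∈ Finset.univ.filter (fun l : Fin (m + 1) => (l : ℕ) < m), p l with hqinf
  have hf0 : ∀ i z, 0 ≤ f i z := fun i z => by simp only [hf]; split_ifs <;> norm_num
  have hqinf0 : ∀ l, 0 ≤ qinf l := by
    intro l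
    simp only [hqinf]
    split_ifs
    · exact mul_nonneg hc0.le (hp l)
    · have h1 : ∑ l ∈ Finset.univ.filter (fun l : Fin (m + 1) => (l : ℕ) < m), p l ≤ 1 := by
        rw [← hp1]; exact Finset.sum_le_sum_of_subset_of_nonneg (Finset.filter_subset _ _) (fun l _ _ => hp l)
      nlinarith
  have hqinf1 : ∑ l, qinf l = 1 := by
    rw [← Finset.sum_filter_add_sum_filter_not Finset.univ (fun l : Fin (m+1) => (l : ℕ) < m)]
    have h1 : ∑ l ∈ Finset.univ.filter (fun l : Fin (m + 1) => (l : ℕ) < m), qinf l = c * ∑ l ∈ Finset.univ.filter (fun l : Fin (m + 1) => (l : ℕ) < m), p l := by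
      rw [Finset.mul_sum]
      apply Finset.sum_congr rfl
      intro l hl
      simp only [Finset.mem_filter, Finset.mem_univ, true_and] at hl
      simp [hqinf, hl]
    have h2 : (Finset.univ.filter (fun l : Fin (m+1) => ¬ (l : ℕ) < m)) = {Fin.last m} := by
      ext l; simp [Fin.ext_iff]; omega
    rw [h1, h2, Finset.sum_singleton]
    simp [hqinf]
  have hfdep : ∀ i, ∀ z, f i z = f i (fun j => if (z j : ℕ) ≤ i then z j else Fin.last m) := by
    intro i z
    by_cases him : i < m
    · have hNN : ∀ l ≤ i, N l (fun j => if (z j : ℕ) ≤ i then z j else Fin.last m) = N l z := by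
        intro l hl
        simp only [hN]
        congr 1
        ext j
        simp only [Finset.mem_filter, Finset.mem_univ, true_and]
        split_ifs with h
        · rfl
        · simp only [Fin.val_last]; omega
      have hEE : ∀ l ≤ i, (E l (fun j => if (z j : ℕ) ≤ i then z j else Fin.last m) ↔ E l z) := by
        intro l hl; simp only [hE, hNN l hl]
      simp only [hf]
      congr 1
      rw [hEE i le_rfl, eq_iff_iff]
      refine and_congr Iff.rfl (forall_congr' fun l => forall_congr' fun hl => ?_)
      rw [hEE l hl.le]
    · congr 1; funext j
      split_ifs with h
      · rfl
      · exfalso; have := (z j).2; omega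
  have hstep : ∀ i < m, ∑ z, f i z * ∏ j, p (z j) ≤ Real.exp (-(n * Λ)) * ∑ z, f i z * ∏ j, qinf (z j) := by
    intro i hi
    rcases (hPc1 i).lt_or_eq with hlt | heq
    · set ρ := (1 - c * Pc i) / (1 - Pc i) with hρ
      have hT : 0 < 1 - Pc i := by linarith
      have hρ1 : 1 ≤ ρ := by rw [hρ, le_div_iff₀ hT]; nlinarith [hPc0 i]
      set q : Fin (m + 1) → ℝ := fun l => p l * (if (l : ℕ) ≤ i then c else ρ) with hq
      have hq1 : ∑ l, q l = 1 := by
        have h0 := hp1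
        rw [← Finset.sum_filter_add_sum_filter_not Finset.univ (fun l : Fin (m+1) => (l : ℕ) ≤ i)] at h0 ⊢
        have h1 : ∑ l ∈ Finset.univ.filter (fun l : Fin (m + 1) => (l : ℕ) ≤ i), q l = Pc i * c := by
          simp only [hPc]
          rw [Finset.sum_mul]
          apply Finset.sum_congr rfl
          intro l hl
          simp only [Finset.mem_filter, Finset.mem_univ, true_and] at hl
          simp [hq, hl]
        have h2 : ∑ l ∈ Finset.univ.filter (fun l : Fin (m + 1) => ¬ (l : ℕ) ≤ i), q l = (∑ l ∈ Finset.univ.filter (fun l : Fin (m + 1) => ¬ (l : ℕ) ≤ i), p l) * ρ := by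
          rw [Finset.sum_mul]
          apply Finset.sum_congr rfl
          intro l hl
          simp only [Finset.mem_filter, Finset.mem_univ, true_and] at hl
          simp [hq, hl]
        have h3 : ∑ l ∈ Finset.univ.filter (fun l : Fin (m + 1) => ¬ (l : ℕ) ≤ i), p l = 1 - Pc i := by
          rw [← h0]; simp [hPc]
        rw [h1, h2, h3, hρ, mul_div_cancel₀ _ hT.ne']; ring
      have hsw : ∑ z, f i z * ∏ j, qinf (z j) = ∑ z, f i z * ∏ j, q (z j) := by
        apply sum_trunc (fun l : Fin (m + 1) => if (l : ℕ) ≤ i then l else Fin.last m)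
        · apply fiber_eq i hi
          · intro l hl
            have : (l : ℕ) < m := by omega
            simp [hqinf, hq, hl, this, mul_comm]
          · rw [hqinf1, hq1]
        · exact hfdep i
      rw [hsw, Finset.mul_sum]
      apply Finset.sum_le_sum
      intro z _
      by_cases hz : E i z ∧ ∀ l < i, ¬ E l z
      · have hfz : f i z = 1 := by simp only [hf]; rw [if_pos hz]
        rw [hfz, one_mul, one_mul]
        simp only [hq]
        rw [Finset.prod_mul_distrib]
        have hprod : ∏ j, (if ((z j : Fin (m+1)) : ℕ) ≤ i then c else ρ) = c ^ (N i z) * ρ ^ (n - N i z) := by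
          rw [Finset.prod_ite, Finset.prod_const, Finset.prod_const]
          congr 2
          have := Finset.card_filter_add_card_filter_not (s := (Finset.univ : Finset (Fin n)))
            (fun j => ((z j : Fin (m+1)) : ℕ) ≤ i)
          rw [Finset.card_univ, Fintype.card_fin] at this
          simp only [hN]; omega
        have hNn : N i z ≤ n := by
          simpa using Finset.card_le_univ (Finset.univ.filter (fun j => ((z j : Fin (m+1)) : ℕ) ≤ i))
        have hbig : Real.exp (n * Λ) ≤ c ^ (N i z) * ρ ^ (n - N i z) := by
          have hρ0 : 0 < ρ := by linarith
          rw [← Real.le_log_iff_exp_le (by positivity), Real.log_mul (by positivity) (by positivity),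
            Real.log_pow, Real.log_pow, Nat.cast_sub hNn]
          have hEz : (N i z : ℝ) ≤ n * (Pc i - x) := hz.1
          have hn' : (0:ℝ) < n := by exact_mod_cast hn
          have hxp : x ≤ Pc i := by
            by_contra hcon
            have : (n:ℝ) * (Pc i - x) < 0 := mul_neg_of_pos_of_neg hn' (by linarith)
            have : (0:ℝ) ≤ N i z := Nat.cast_nonneg _
            linarith
          have h1 := mul_le_mul_of_nonneg_left (hphi (Pc i) hxp hlt) hn'.le
          have hlc : Real.log c < 0 := Real.log_neg hc0 hc1
          have hlρ : 0 ≤ Real.log ρ := Real.log_nonneg hρ1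
          nlinarith [mul_nonneg (sub_nonneg.2 hEz) (sub_nonneg.2 (hlc.le.trans hlρ))]
        rw [hprod, Real.exp_neg]
        have hpp : 0 ≤ ∏ j, p (z j) := Finset.prod_nonneg (fun j _ => hp _)
        have he := Real.exp_pos (n * Λ)
        rw [inv_mul_eq_div, le_div_iff₀ he]
        exact mul_le_mul_of_nonneg_left hbig hpp
      · have hfz : f i z = 0 := by simp only [hf]; rw [if_neg hz]
        simp [hfz]
    · have hzero : ∑ z, f i z * ∏ j, p (z j) = 0 := by
        apply Finset.sum_eq_zero
        intro z _
        by_cases hz : E i z ∧ ∀ l < i, ¬ E l z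
        · have hEz : (N i z : ℝ) ≤ n * (Pc i - x) := hz.1
          have hn' : (0:ℝ) < n := by exact_mod_cast hn
          have : (N i z : ℝ) < n := by rw [heq] at hEz; nlinarith
          have hNlt : N i z < n := by exact_mod_cast this
          have hex : ∃ j, ¬ ((z j : Fin (m+1)) : ℕ) ≤ i := by
            by_contra hcon
            push Not at hcon
            have : N i z = n := by
              simp only [hN]
              rw [Finset.filter_true_of_mem (fun j _ => hcon j)]; simp
            omega
          obtain ⟨j, hj⟩ := hex
          have hpz : p (z j) = 0 := by
            have h0 : ∑ l ∈ Finset.univ.filter (fun l : Fin (m + 1) => ¬ (l : ℕ) ≤ i), p l = 0 := by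
              have h0 := hp1
              rw [← Finset.sum_filter_add_sum_filter_not Finset.univ (fun l : Fin (m+1) => (l : ℕ) ≤ i)] at h0
              have : Pc i = ∑ l ∈ Finset.univ.filter (fun l : Fin (m + 1) => (l : ℕ) ≤ i), p l := rfl
              linarith
            exact (Finset.sum_eq_zero_iff_of_nonneg (fun l _ => hp l)).1 h0 (z j) (by simpa using hj)
          rw [Finset.prod_eq_zero (Finset.mem_univ j) hpz, mul_zero]
        · have hfz : f i z = 0 := by simp only [hf]; rw [if_neg hz]
          simp [hfz]
      rw [hzero]
      exact mul_nonneg (Real.exp_pos _).le (Finset.sum_nonneg fun z _ =>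
        mul_nonneg (hf0 i z) (Finset.prod_nonneg fun j _ => hqinf0 _))
  have hfsum : ∀ z, ∑ i ∈ Finset.range m, f i z = if ∃ i < m, E i z then 1 else 0 := by
    intro z
    split_ifs with h
    · have hs := Nat.find_spec h
      rw [Finset.sum_eq_single (Nat.find h)]
      · simp only [hf]
        rw [if_pos]
        refine ⟨hs.2, fun l hl hE' => Nat.find_min h hl ⟨by omega, hE'⟩⟩
      · intro b hb hne
        simp only [hf]
        rw [if_neg]
        rintro ⟨h1, h2⟩
        rcases lt_trichotomy b (Nat.find h) with h3 | h3 | h3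
        · exact Nat.find_min h h3 ⟨Finset.mem_range.1 hb, h1⟩
        · exact hne h3
        · exact h2 _ h3 hs.2
      · intro h'; exact absurd (Finset.mem_range.2 hs.1) h'
    · apply Finset.sum_eq_zero
      intro i hi
      simp only [hf]
      rw [if_neg]
      exact fun h' => h ⟨i, Finset.mem_range.1 hi, h'.1⟩
  have hlhs : ∑ z : Fin n → Fin (m + 1) with (∃ i < m, E i z), ∏ j, p (z j)
      = ∑ i ∈ Finset.range m, ∑ z, f i z * ∏ j, p (z j) := by
    rw [Finset.sum_comm, Finset.sum_filter]
    apply Finset.sum_congr rfl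
    intro z _
    rw [← Finset.sum_mul, hfsum z]
    split_ifs <;> simp
  have hfin : ∑ i ∈ Finset.range m, ∑ z, f i z * ∏ j, qinf (z j) ≤ 1 := by
    have h1 : ∑ z : Fin n → Fin (m + 1), ∏ j, qinf (z j) = 1 := by
      have := Finset.prod_univ_sum (fun _ : Fin n => (Finset.univ : Finset (Fin (m+1)))) (fun _ l => qinf l)
      rw [Fintype.piFinset_univ] at this
      rw [← this, hqinf1]; simp
    rw [← h1, Finset.sum_comm]
    apply Finset.sum_le_sum
    intro z _
    rw [← Finset.sum_mul, hfsum z]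
    have := Finset.prod_nonneg (s := Finset.univ) fun (j : Fin n) _ => hqinf0 (z j)
    split_ifs <;> simp [this]
  have : ∑ z : Fin n → Fin (m + 1) with (∃ i < m, E i z), ∏ j, p (z j) ≤ Real.exp (-(n * Λ)) := by
    rw [hlhs]
    calc _ ≤ ∑ i ∈ Finset.range m, Real.exp (-(n * Λ)) * ∑ z, f i z * ∏ j, qinf (z j) :=
          Finset.sum_le_sum fun i hi => hstep i (Finset.mem_range.1 hi)
      _ = Real.exp (-(n * Λ)) * ∑ i ∈ Finset.range m, ∑ z, f i z * ∏ j, qinf (z j) := by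
          rw [Finset.mul_sum]
      _ ≤ Real.exp (-(n * Λ)) * 1 := mul_le_mul_of_nonneg_left hfin (Real.exp_pos _).le
      _ = _ := mul_one _
  convert this

lemma chain_bound {m n : ℕ} (hn : 0 < n) (μ : Measure ℝ) [IsProbabilityMeasure μ]
    (A : Fin m → Set ℝ) (hA : Monotone A) (hAm : ∀ i, MeasurableSet (A i)) (x : ℝ) (hx : 0 < x) :
    (Measure.pi fun _ : Fin n => μ) {y | ∃ i, ((Nat.card {j // y j ∈ A i} : ℕ) : ℝ) ≤ n * (μ.real (A i) - x)}
      ≤ ENNReal.ofReal (Real.exp (-(n * (7 / 4 * x ^ 2)))) := by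
  classical
  set g : ℝ → Fin (m + 1) := fun y => ⟨Finset.card {i | y ∉ A i}, by
    have := Finset.card_le_univ (Finset.univ.filter (fun i => y ∉ A i))
    rw [Fintype.card_fin] at this; omega⟩ with hg
  have hgA : ∀ y i, y ∈ A i ↔ (g y : ℕ) ≤ i := by
    intro y i
    constructor
    · intro h
      have : Finset.univ.filter (fun i => y ∉ A i) ⊆ Finset.Iio i := by
        intro l hl
        simp only [Finset.mem_filter, Finset.mem_univ, true_and] at hl
        rw [Finset.mem_Iio]
        by_contra hc
        exact hl (hA (not_lt.1 hc) h)
      simpa [hg] using Finset.card_le_card this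
    · intro h
      by_contra hc
      have : Finset.Iic i ⊆ Finset.univ.filter (fun i => y ∉ A i) := by
        intro l hl
        simp only [Finset.mem_filter, Finset.mem_univ, true_and]
        exact fun h' => hc (hA (Finset.mem_Iic.1 hl) h')
      have := Finset.card_le_card this
      simp only [hg] at h
      simp at this
      omega
  have hgm : Measurable g := by
    apply measurable_to_countable'
    intro l
    have h1 : ∀ k : ℕ, MeasurableSet {y | (g y : ℕ) ≤ k} := by
      intro k
      by_cases hk : k < m
      · have : {y | (g y : ℕ) ≤ k} = A ⟨k, hk⟩ := by ext y; exact (hgA y ⟨k, hk⟩).symm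
        rw [this]; exact hAm _
      · have : {y | (g y : ℕ) ≤ k} = univ := by
          ext y; simp only [mem_setOf_eq, mem_univ, iff_true]; have := (g y).2; omega
        rw [this]; exact MeasurableSet.univ
    have h2 : MeasurableSet {y | (g y : ℕ) < l} := by
      rcases hl : (l : ℕ) with _ | k
      · simp
      · simpa [Nat.lt_succ_iff] using h1 k
    have : g ⁻¹' {l} = {y | (g y : ℕ) ≤ l} \ {y | (g y : ℕ) < l} := by
      ext y; simp only [mem_preimage, mem_singleton_iff, mem_diff, mem_setOf_eq, Fin.ext_iff]; omega
    rw [this]; exact (h1 l).diff h2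
  set p : Fin (m + 1) → ℝ := fun l => μ.real (g ⁻¹' {l}) with hp
  have hpsum : ∀ S : Finset (Fin (m + 1)), ∑ l ∈ S, p l = μ.real (g ⁻¹' S) := by
    intro S
    have := measureReal_biUnion_finset (μ := μ) (s := S) (f := fun l => g ⁻¹' {l})
      (fun a _ b _ hab => Disjoint.preimage _ (by simpa using hab))
      (fun l _ => hgm (measurableSet_singleton l))
    rw [← this]
    congr 1; ext y; simp
  have hfin := finite_max (m := m) (n := n) p (fun l => measureReal_nonneg)
    (by rw [hpsum]; simp) x hx (Real.exp (-(2 * x))) (Real.exp_pos _) (by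
      rw [Real.exp_lt_one_iff]; linarith) (7 / 4 * x ^ 2)
    (fun s h1 h2 => by rw [Real.log_exp]; exact phi_ineq x s hx h1 h2) hn
  have hP : ∀ i : Fin m, (∑ l ∈ Finset.univ.filter (fun l : Fin (m + 1) => (l : ℕ) ≤ i), p l) = μ.real (A i) := by
    intro i
    rw [hpsum]; congr 1; ext y; simp [hgA]
  set S : Finset (Fin n → Fin (m + 1)) := Finset.univ.filter (fun z => ∃ i < m, (Finset.card {j | ((z j : Fin (m+1)) : ℕ) ≤ i} : ℝ) ≤
      n * ((∑ l ∈ Finset.univ.filter (fun l : Fin (m + 1) => (l : ℕ) ≤ i), p l) - x)) with hS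
  have hsub : {y : Fin n → ℝ | ∃ i, ((Nat.card {j // y j ∈ A i} : ℕ) : ℝ) ≤ n * (μ.real (A i) - x)} ⊆
      ⋃ z ∈ S, Set.pi univ (fun j => g ⁻¹' {z j}) := by
    rintro y ⟨i, hi⟩
    simp only [mem_iUnion]
    refine ⟨fun j => g (y j), ?_, by simp⟩
    simp only [hS, Finset.mem_filter, Finset.mem_univ, true_and]
    refine ⟨i, i.2, ?_⟩
    rw [hP i]
    convert hi using 2
    rw [Nat.card_eq_fintype_card, Fintype.card_subtype]
    simp only [hgA]
  calc _ ≤ _ := measure_mono hsub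
    _ ≤ ∑ z ∈ S, (Measure.pi fun _ : Fin n => μ) (Set.pi univ (fun j => g ⁻¹' {z j})) :=
        measure_biUnion_finset_le _ _
    _ = ∑ z ∈ S, ENNReal.ofReal (∏ j, p (z j)) := by
        apply Finset.sum_congr rfl
        intro z _
        rw [Measure.pi_pi, ENNReal.ofReal_prod_of_nonneg (fun j _ => measureReal_nonneg)]
        simp [hp]
    _ = ENNReal.ofReal (∑ z ∈ S, ∏ j, p (z j)) := by
        rw [ENNReal.ofReal_sum_of_nonneg]
        exact fun z _ => Finset.prod_nonneg fun j _ => measureReal_nonneg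
    _ ≤ _ := ENNReal.ofReal_le_ofReal hfin

lemma countable_bound {ι : Type*} [LinearOrder ι] [Countable ι] {n : ℕ} (hn : 0 < n) (μ : Measure ℝ)
    [IsProbabilityMeasure μ]
    (A : ι → Set ℝ) (hA : Monotone A) (hAm : ∀ i, MeasurableSet (A i)) (x : ℝ) (hx : 0 < x) :
    (Measure.pi fun _ : Fin n => μ) {y | ∃ i, ((Nat.card {j // y j ∈ A i} : ℕ) : ℝ) ≤ n * (μ.real (A i) - x)}
      ≤ ENNReal.ofReal (Real.exp (-(n * (7 / 4 * x ^ 2)))) := by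
  have : {y : Fin n → ℝ | ∃ i, ((Nat.card {j // y j ∈ A i} : ℕ) : ℝ) ≤ n * (μ.real (A i) - x)} =
    ⋃ S : Finset ι, {y | ∃ i ∈ S, ((Nat.card {j // y j ∈ A i} : ℕ) : ℝ) ≤ n * (μ.real (A i) - x)} := by
    ext y
    simp only [mem_setOf_eq, mem_iUnion]
    exact ⟨fun ⟨i, h⟩ => ⟨{i}, i, by simp, h⟩, fun ⟨_, i, _, h⟩ => ⟨i, h⟩⟩
  rw [this, Directed.measure_iUnion]
  · apply iSup_le
    intro S
    refine le_trans (measure_mono ?_) (chain_bound hn μ (fun k : Fin S.card => A (S.orderEmbOfFin rfl k))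
      (fun a b h => hA ((S.orderEmbOfFin rfl).monotone h)) (fun _ => hAm _) x hx)
    rintro y ⟨i, hi, h⟩
    have : i ∈ Set.range (S.orderEmbOfFin rfl) := by simpa using hi
    obtain ⟨k, rfl⟩ := this
    exact ⟨k, h⟩
  · apply Monotone.directed_le
    rintro S T hST y ⟨i, hi, h⟩
    exact ⟨i, hST hi, h⟩

lemma emp_rightCont {n : ℕ} (y : Fin n → ℝ) (t : ℝ) :
    ContinuousWithinAt (empiricalCdf y) (Ioi t) t := by
  unfold empiricalCdf
  apply ContinuousWithinAt.div_const
  apply tendsto_finsetSum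
  intro j _
  apply tendsto_const_nhds.congr'
  by_cases h : y j ≤ t
  · filter_upwards [self_mem_nhdsWithin] with u hu
    rw [if_pos h, if_pos (h.trans (le_of_lt hu))]
  · have : Iio (y j) ∈ nhdsWithin t (Ioi t) := mem_nhdsWithin_of_mem_nhds (Iio_mem_nhds (not_le.1 h))
    filter_upwards [this] with u hu
    rw [if_neg h, if_neg (not_le.2 hu)]

lemma cdfOf_rightCont (μ : Measure ℝ) [IsProbabilityMeasure μ] (t : ℝ) :
    ContinuousWithinAt (cdfOf μ) (Ioi t) t := by
  have h : cdfOf μ = ProbabilityTheory.cdf μ := by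
    funext u; rw [ProbabilityTheory.cdf_eq_real]; rfl
  rw [h]
  exact ((ProbabilityTheory.cdf μ).right_continuous t).mono Ioi_subset_Ici_self

lemma emp_mem {n : ℕ} (y : Fin n → ℝ) (t : ℝ) : 0 ≤ empiricalCdf y t ∧ empiricalCdf y t ≤ 1 := by
  unfold empiricalCdf
  constructor
  · exact div_nonneg (Finset.sum_nonneg fun j _ => by split_ifs <;> norm_num) (by positivity)
  · apply div_le_one_of_le₀ _ (by positivity)
    calc _ ≤ ∑ j : Fin n, (1 : ℝ) := Finset.sum_le_sum fun j _ => by split_ifs <;> norm_num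
      _ = n := by simp

lemma cdf_mem (μ : Measure ℝ) [IsProbabilityMeasure μ] (t : ℝ) : 0 ≤ cdfOf μ t ∧ cdfOf μ t ≤ 1 := by
  have : cdfOf μ t = μ.real (Iic t) := rfl
  rw [this]; exact ⟨measureReal_nonneg, measureReal_le_one⟩

lemma abs_le_one' {n : ℕ} (y : Fin n → ℝ) (μ : Measure ℝ) [IsProbabilityMeasure μ] (t : ℝ) :
    |empiricalCdf y t - cdfOf μ t| ≤ 1 := by
  have h1 := emp_mem y t; have h2 := cdf_mem μ t
  rw [abs_le]; constructor <;> linarith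

lemma supDist_le_one {n : ℕ} (y : Fin n → ℝ) (μ : Measure ℝ) [IsProbabilityMeasure μ] :
    supDist (empiricalCdf y) (cdfOf μ) ≤ 1 := ciSup_le fun t => abs_le_one' y μ t

lemma supDist_nonneg {n : ℕ} (y : Fin n → ℝ) (μ : Measure ℝ) :
    0 ≤ supDist (empiricalCdf y) (cdfOf μ) := Real.iSup_nonneg fun t => abs_nonneg _

lemma exists_rat {n : ℕ} (y : Fin n → ℝ) (μ : Measure ℝ) [IsProbabilityMeasure μ] (x : ℝ)
    (h : x < supDist (empiricalCdf y) (cdfOf μ)) :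
    ∃ q : ℚ, x < |empiricalCdf y q - cdfOf μ q| := by
  obtain ⟨t, ht⟩ := exists_lt_of_lt_ciSup h
  have hc : ContinuousWithinAt (fun u => |empiricalCdf y u - cdfOf μ u|) (Ioi t) t :=
    ((emp_rightCont y t).sub (cdfOf_rightCont μ t)).abs
  have hev : ∀ᶠ u in nhdsWithin t (Ioi t), x < |empiricalCdf y u - cdfOf μ u| :=
    hc.eventually (lt_mem_nhds ht)
  obtain ⟨v, hv, hsub⟩ := (mem_nhdsGT_iff_exists_Ioo_subset).1 hev
  obtain ⟨q, hq1, hq2⟩ := exists_rat_btwn (mem_Ioi.1 hv)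
  exact ⟨q, hsub ⟨hq1, hq2⟩⟩

lemma emp_card {n : ℕ} (y : Fin n → ℝ) (t : ℝ) (hn : 0 < n) :
    ((Nat.card {j // y j ∈ Iic t} : ℕ) : ℝ) = n * empiricalCdf y t := by
  classical
  have hn' : (n : ℝ) ≠ 0 := by positivity
  unfold empiricalCdf
  rw [mul_div_cancel₀ _ hn', Nat.card_eq_fintype_card, Fintype.card_subtype]
  simp

lemma emp_card' {n : ℕ} (y : Fin n → ℝ) (t : ℝ) (hn : 0 < n) :
    ((Nat.card {j // y j ∈ Ioi t} : ℕ) : ℝ) = n * (1 - empiricalCdf y t) := by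
  classical
  rw [mul_sub, ← emp_card y t hn, Nat.card_eq_fintype_card, Fintype.card_subtype,
    Nat.card_eq_fintype_card, Fintype.card_subtype, mul_one]
  have := Finset.card_filter_add_card_filter_not (s := (Finset.univ : Finset (Fin n)))
            (fun j => y j ∈ Iic t)
  rw [Finset.card_univ, Fintype.card_fin] at this
  have h2 : (Finset.univ.filter (fun j => ¬ y j ∈ Iic t)) = Finset.univ.filter (fun j => y j ∈ Ioi t) := by
    ext; simp
  rw [h2] at this
  have h3 : ((Finset.card (Finset.univ.filter (fun j => y j ∈ Iic t)) : ℝ)) + (Finset.card (Finset.univ.filter (fun j => y j ∈ Ioi t)) : ℝ) = n := by exact_mod_cast this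
  linarith

/-- DKW type inequality -/
lemma dkw {n : ℕ} (hn : 0 < n) (μ : Measure ℝ) [IsProbabilityMeasure μ] (x : ℝ) (hx : 0 < x) :
    (Measure.pi fun _ : Fin n => μ) {y | x < supDist (empiricalCdf y) (cdfOf μ)}
      ≤ ENNReal.ofReal (2 * Real.exp (-(n * (7 / 4 * x ^ 2)))) := by
  haveI : Countable ℚᵒᵈ := (OrderDual.ofDual (α := ℚ)).injective.countable
  have h1 := countable_bound (ι := ℚ) hn μ (fun q => Iic (q : ℝ))
    (fun a b h => Iic_subset_Iic.2 (by exact_mod_cast h)) (fun _ => measurableSet_Iic) x hx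
  have h2 := countable_bound (ι := ℚᵒᵈ) hn μ (fun q => Ioi ((OrderDual.ofDual q : ℚ) : ℝ))
    (fun a b h => Ioi_subset_Ioi (by exact_mod_cast h)) (fun _ => measurableSet_Ioi) x hx
  rw [two_mul, ENNReal.ofReal_add (Real.exp_pos _).le (Real.exp_pos _).le]
  refine le_trans (measure_mono ?_) ((measure_union_le _ _).trans (add_le_add h1 h2))
  intro y hy
  obtain ⟨q, hq⟩ := exists_rat y μ x hy
  have hn' : (0 : ℝ) < n := by exact_mod_cast hn
  have hF : cdfOf μ q = μ.real (Iic (q : ℝ)) := rfl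
  rcases lt_abs.1 hq with h | h
  · right
    refine ⟨OrderDual.toDual q, ?_⟩
    simp only [OrderDual.ofDual_toDual]
    rw [emp_card' y _ hn]
    have : μ.real (Ioi (q : ℝ)) = 1 - cdfOf μ q := by
      rw [hF, ← compl_Iic, probReal_compl_eq_one_sub measurableSet_Iic]
    rw [this]
    exact mul_le_mul_of_nonneg_left (by linarith) hn'.le
  · left
    refine ⟨q, ?_⟩
    rw [emp_card y _ hn, ← hF]
    exact mul_le_mul_of_nonneg_left (by linarith) hn'.le

lemma tail_int (C r : ℝ) (hC : 1 ≤ C) (hr : 0 < r) (G : ℝ → ENNReal) (h1 : ∀ u, G u ≤ 1)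
    (h2 : ∀ u, 0 < u → G u ≤ ENNReal.ofReal (C * Real.exp (-(r * u)))) :
    ∫⁻ u in Ioi (0 : ℝ), G u ≤ ENNReal.ofReal ((1 + Real.log C) / r) := by
  set u0 := Real.log C / r with hu0
  have hu0n : 0 ≤ u0 := div_nonneg (Real.log_nonneg hC) hr.le
  have hC0 : 0 < C := by linarith
  rw [← Ioc_union_Ioi_eq_Ioi hu0n, lintegral_union measurableSet_Ioi (by
    rw [Set.disjoint_left]; intro a ha hb; exact absurd ha.2 (not_le.2 hb))]
  have hA : ∫⁻ u in Ioc 0 u0, G u ≤ ENNReal.ofReal u0 := by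
    calc _ ≤ ∫⁻ u in Ioc 0 u0, 1 := lintegral_mono h1
      _ = _ := by simp
  have hexp : ∀ u, C * Real.exp (-(r * u)) = C * Real.exp (-r * u) := fun u => by rw [neg_mul]
  have hint : IntegrableOn (fun u => C * Real.exp (-(r * u))) (Ioi u0) := by
    simp only [hexp]
    exact (integrableOn_exp_mul_Ioi (by linarith) u0).const_mul C
  have hB : ∫⁻ u in Ioi u0, G u ≤ ENNReal.ofReal (1 / r) := by
    calc _ ≤ ∫⁻ u in Ioi u0, ENNReal.ofReal (C * Real.exp (-(r * u))) := by
          apply setLIntegral_mono' measurableSet_Ioi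
          intro u hu
          exact h2 u (hu0n.trans_lt hu)
      _ = ENNReal.ofReal (∫ u in Ioi u0, C * Real.exp (-(r * u))) := by
          rw [ofReal_integral_eq_lintegral_ofReal hint]
          exact Filter.Eventually.of_forall fun u => by positivity
      _ = ENNReal.ofReal (1 / r) := by
          congr 1
          simp only [hexp]
          rw [integral_const_mul, integral_exp_mul_Ioi (by linarith)]
          have : Real.exp (-r * u0) = 1 / C := by
            rw [hu0, show -r * (Real.log C / r) = - Real.log C by field_simp, Real.exp_neg,
              Real.exp_log hC0, one_div]
          rw [this]; field_simp
  calc _ ≤ ENNReal.ofReal u0 + ENNReal.ofReal (1 / r) := add_le_add hA hB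
    _ = _ := by
      rw [← ENNReal.ofReal_add hu0n (by positivity)]; congr 1; rw [hu0]; ring

lemma mean_bound {Ω : Type*} [MeasurableSpace Ω] (P : Measure Ω) [IsProbabilityMeasure P]
    (f : Ω → ℝ) (hf0 : ∀ ω, 0 ≤ f ω) (hf1 : ∀ ω, f ω ≤ 1) (C r : ℝ) (hC : 1 ≤ C) (hr : 0 < r)
    (h : ∀ x, 0 < x → P {ω | x < f ω} ≤ ENNReal.ofReal (C * Real.exp (-(r * x ^ 2)))) :
    ∫ ω, f ω ∂P ≤ Real.sqrt ((1 + Real.log C) / r) := by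
  by_cases hi : Integrable f P
  swap
  · rw [integral_undef hi]; positivity
  apply Real.le_sqrt_of_sq_le
  have hi2 : Integrable (fun ω => f ω ^ 2) P := by
    apply Integrable.mono' hi (hi.1.pow 2)
    filter_upwards with ω
    show ‖f ω ^ 2‖ ≤ f ω
    rw [Real.norm_of_nonneg (sq_nonneg _)]
    nlinarith [hf0 ω, hf1 ω]
  have hJ : (∫ ω, f ω ∂P) ^ 2 ≤ ∫ ω, f ω ^ 2 ∂P := by
    set c := ∫ ω, f ω ∂P with hc
    have h0 : 0 ≤ ∫ ω, (f ω - c) ^ 2 ∂P := integral_nonneg fun ω => sq_nonneg _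
    have h1 : ∫ ω, (f ω - c) ^ 2 ∂P = ∫ ω, (f ω ^ 2 - 2 * c * f ω) + c ^ 2 ∂P := by
      congr 1; funext ω; ring
    have hi3 : Integrable (fun ω => f ω ^ 2 - 2 * c * f ω) P := hi2.sub (hi.const_mul _)
    rw [h1, integral_add hi3 (integrable_const _),
      integral_sub hi2 (hi.const_mul _), integral_const_mul, ← hc] at h0
    simp at h0
    nlinarith
  refine hJ.trans ?_
  have hnn : 0 ≤ (1 + Real.log C) / r := div_nonneg (by have := Real.log_nonneg hC; linarith) hr.le
  rw [← ENNReal.ofReal_le_ofReal_iff hnn, ofReal_integral_eq_lintegral_ofReal hi2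
    (Filter.Eventually.of_forall fun ω => sq_nonneg _),
    lintegral_eq_lintegral_meas_lt P (Filter.Eventually.of_forall fun ω => sq_nonneg _) hi2.1.aemeasurable]
  apply tail_int C r hC hr
  · intro u; exact prob_le_one
  · intro u hu
    have hs : 0 < Real.sqrt u := Real.sqrt_pos.2 hu
    have := h _ hs
    rw [Real.sq_sqrt hu.le] at this
    refine le_trans (measure_mono ?_) this
    intro ω hω
    exact (Real.sqrt_lt' (lt_of_le_of_ne (hf0 ω) (fun h0 => by
      have h3 : u < f ω ^ 2 := hω
      rw [← h0] at h3; norm_num at h3; linarith))).2 hω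

lemma main_bound
    {Ω : Type*} [MeasurableSpace Ω] (P : Measure Ω) [IsProbabilityMeasure P]
    (K : ℕ) (hK : 2 ≤ K) (β : ℕ) (hβ : 1 ≤ β)
    (n : Fin K → ℕ) (hn : ∀ j, β ≤ n j)
    (μ : Fin K → ProbabilityMeasure ℝ)
    (X : (j : Fin K) → Fin (n j) → Ω → ℝ) (hXm : ∀ j t, Measurable (X j t))
    (hXlaw : ∀ j, P.map (fun ω => fun t : Fin (n j) => X j t ω)
      = Measure.pi fun _ : Fin (n j) => (μ j : Measure ℝ)) :
    ∫ ω, (⨆ j : Fin K, supDist (empiricalCdf fun t => X j t ω) (cdfOf (μ j))) ∂P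
        ≤ Real.sqrt 2 * Real.sqrt (Real.log K / β) := by
  haveI : Nonempty (Fin K) := ⟨⟨0, by omega⟩⟩
  have hβ' : (0 : ℝ) < β := by exact_mod_cast hβ
  have hK' : (2 : ℝ) ≤ K := by exact_mod_cast hK
  have hb := mean_bound P (fun ω => ⨆ j : Fin K, supDist (empiricalCdf fun t => X j t ω) (cdfOf (μ j)))
    (fun ω => Real.iSup_nonneg fun j => supDist_nonneg _ _)
    (fun ω => ciSup_le fun j => supDist_le_one _ _) (2 * K) (7 / 4 * β) (by linarith) (by positivity)
    (by
      intro x hx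
      have hsub : {ω | x < ⨆ j : Fin K, supDist (empiricalCdf fun t => X j t ω) (cdfOf (μ j))} ⊆
          ⋃ j, {ω | x < supDist (empiricalCdf fun t => X j t ω) (cdfOf (μ j))} := by
        intro ω hω
        obtain ⟨j, hj⟩ := exists_lt_of_lt_ciSup (show x < _ from hω)
        exact mem_iUnion.2 ⟨j, hj⟩
      have hj : ∀ j, P {ω | x < supDist (empiricalCdf fun t => X j t ω) (cdfOf (μ j))} ≤
          ENNReal.ofReal (2 * Real.exp (-(7 / 4 * β * x ^ 2))) := by
        intro j
        have h1 := Measure.le_map_apply (μ := P) (f := fun ω => fun t : Fin (n j) => X j t ω)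
          (measurable_pi_lambda _ (fun t => hXm j t)).aemeasurable
          {y | x < supDist (empiricalCdf y) (cdfOf (μ j))}
        rw [hXlaw j] at h1
        refine h1.trans ((dkw (by have := hn j; omega) _ x hx).trans (ENNReal.ofReal_le_ofReal ?_))
        have hnj : (β : ℝ) ≤ n j := by exact_mod_cast hn j
        have : 7 / 4 * β * x ^ 2 ≤ n j * (7 / 4 * x ^ 2) := by nlinarith [sq_nonneg x]
        gcongr
      calc _ ≤ _ := measure_mono hsub
        _ ≤ ∑ j, P {ω | x < supDist (empiricalCdf fun t => X j t ω) (cdfOf (μ j))} :=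
            measure_iUnion_fintype_le _ _
        _ ≤ ∑ j : Fin K, ENNReal.ofReal (2 * Real.exp (-(7 / 4 * β * x ^ 2))) :=
            Finset.sum_le_sum fun j _ => hj j
        _ = _ := by
            rw [← ENNReal.ofReal_sum_of_nonneg (fun _ _ => by positivity)]
            congr 1; simp; ring)
  refine hb.trans ?_
  rw [← Real.sqrt_mul (by norm_num)]
  apply Real.sqrt_le_sqrt
  have hl2 := Real.log_two_gt_d9
  have hl2' := Real.log_two_lt_d9
  have hlK : Real.log 2 ≤ Real.log K := Real.log_le_log (by norm_num) hK'
  rw [Real.log_mul (by norm_num) (by positivity), div_le_iff₀ (by positivity)]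
  field_simp
  linarith

/-- Display (C.2) in the proof of Theorem 3: if for each `j = 1,…,K` the empirical cdf
`F̂_j` is based on `n_j ≥ β` i.i.d. observations with cdf `F_j` (no independence across `j`
required), then `E[max_j ‖F̂_j − F_j‖_∞] ≤ 1.505·√(log K/β)`; more precisely, for every
`a ≥ 1`, `E[max_j ‖F̂_j − F_j‖_∞] ≤ (log(2 + 8√(π log 2^a)·2^a)/(log 2·√(8a)))·√(log K/β)`. -/
theorem expected_max_supDist_bound
    {Ω : Type*} [MeasurableSpace Ω] (P : Measure Ω) [IsProbabilityMeasure P]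
    (K : ℕ) (hK : 2 ≤ K) (β : ℕ) (hβ : 1 ≤ β)
    (n : Fin K → ℕ) (hn : ∀ j, β ≤ n j)
    (μ : Fin K → ProbabilityMeasure ℝ)
    (X : (j : Fin K) → Fin (n j) → Ω → ℝ) (hXm : ∀ j t, Measurable (X j t))
    (hXlaw : ∀ j, P.map (fun ω => fun t : Fin (n j) => X j t ω)
      = Measure.pi fun _ : Fin (n j) => (μ j : Measure ℝ)) :
    (∫ ω, (⨆ j : Fin K, supDist (empiricalCdf fun t => X j t ω) (cdfOf (μ j))) ∂P
        ≤ 1.505 * Real.sqrt (Real.log K / β)) ∧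
    ∀ a : ℝ, 1 ≤ a →
      ∫ ω, (⨆ j : Fin K, supDist (empiricalCdf fun t => X j t ω) (cdfOf (μ j))) ∂P
        ≤ (Real.log (2 + 8 * Real.sqrt (Real.pi * Real.log ((2 : ℝ) ^ a)) * (2 : ℝ) ^ a)
            / (Real.log 2 * Real.sqrt (8 * a))) * Real.sqrt (Real.log K / β) := by
  have hb := main_bound P K hK β hβ n hn μ X hXm hXlaw
  refine ⟨hb.trans ?_, fun a ha => hb.trans ?_⟩
  · apply mul_le_mul_of_nonneg_right _ (Real.sqrt_nonneg _)
    rw [Real.sqrt_le_left (by norm_num)]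
    norm_num
  · exact mul_le_mul_of_nonneg_right (ca_ineq a ha) (Real.sqrt_nonneg _)

end TRDT
end
end
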